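/- arXiv:1902.02327 — 2 statements merged into one kernel-verified Lean document; each statement's English description precedes it below -/
import Mathlib

section
/- Let α>0 and a₀,a₁,x ∈ ℝ with a₁≠0. Let (Yⁿ) be C_α-valued random variables satisfying an LDP on C_α with good rate function I_Y and speed γ(n)=n. Let (Zⁿ) be C-valued random variables such that the joint law of (Yⁿ,Zⁿ) disintegrates as μ_{Yⁿ}(dy) νₙ(y)(dz), where for each y ∈ C_α, νₙ(y) is the law of a continuous Gaussian process with mean function m and covariance function kʸ/n (i.e., under νₙ(y), ⟨λ,·⟩ is Gaussian with mean ⟨λ,m⟩ and variance (1/n)∫₀¹∫₀¹ kʸ(t,s) dλ(t)dλ(s) for every λ ∈ M[0,1]). Then (Yⁿ,Zⁿ) satisfies a weak LDP on C_α×C with speed n and rate function I(y,f)=I_Y(y)+J(f|y), and (Zⁿ) satisfies an LDP on C with speed n and rate function I_Z(f)=inf over y∈C_α of { I_Y(y)+J(f|y) }. -/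
open MeasureTheory ProbabilityTheory Filter Topology
open scoped ENNReal NNReal

noncomputable section

/-- The unit interval `[0,1]` as a subtype of `ℝ`. -/
abbrev UI : Type := Set.Icc (0:ℝ) 1

/-- `C([0,1],ℝ)`, the continuous real functions on `[0,1]` with the sup-norm. -/
abbrev CC : Type := C(UI, ℝ)

instance : MeasurableSpace CC := borel CC
instance : BorelSpace CC := ⟨rfl⟩

/-- Pairing `⟨λ,h⟩ = ∫₀¹ h dλ` of a finite signed Borel measure on `[0,1]`
with a function `h`. -/
def pairSM (lam : MeasureTheory.SignedMeasure UI) (h : UI → ℝ) : ℝ :=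
  (∫ t, h t ∂lam.toJordanDecomposition.posPart) -
    (∫ t, h t ∂lam.toJordanDecomposition.negPart)

/-- Double integral `∫₀¹∫₀¹ k(t,s) dλ(t) dλ(s)`. -/
def dblInt (lam : MeasureTheory.SignedMeasure UI) (k : UI → UI → ℝ) : ℝ :=
  pairSM lam (fun t => pairSM lam (fun s => k t s))

/-- `Λ_k(λ) = (1/2)∫₀¹∫₀¹ k(t,s) dλ(t)dλ(s)`. -/
def LamK (k : UI → UI → ℝ) (lam : MeasureTheory.SignedMeasure UI) : ℝ :=
  (1/2) * dblInt lam k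

/-- The Cramér transform `Λ*_k(h) = sup_λ (⟨λ,h⟩ − Λ_k(λ)) ∈ [0,∞]`. -/
def CramerK (k : UI → UI → ℝ) (h : UI → ℝ) : ℝ≥0∞ :=
  ⨆ lam : MeasureTheory.SignedMeasure UI, ENNReal.ofReal (pairSM lam h - LamK k lam)

/-- A continuous, symmetric, positive semidefinite kernel on `[0,1]²`. -/
def IsPSDKernel (k : UI → UI → ℝ) : Prop :=
  Continuous (fun p : UI × UI => k p.1 p.2) ∧ (∀ s t, k s t = k t s) ∧
    ∀ (n : ℕ) (t : Fin n → UI) (c : Fin n → ℝ),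
      0 ≤ ∑ i, ∑ j, c i * c j * k (t i) (t j)

/-- Extended logarithm of an extended nonnegative real. -/
def elog (x : ℝ≥0∞) : EReal :=
  if x = 0 then ⊥ else if x = ⊤ then ⊤ else ((Real.log x.toReal : ℝ) : EReal)

/-- Large-deviation lower bound for open sets. -/
def LDPLower {E : Type*} [TopologicalSpace E] [MeasurableSpace E]
    (μ : ℕ → Measure E) (γ : ℕ → ℝ) (I : E → ℝ≥0∞) : Prop :=
  ∀ Θ : Set E, IsOpen Θ →
    -(⨅ x ∈ Θ, (I x : EReal)) ≤
      Filter.atTop.liminf fun n => (((γ n)⁻¹ : ℝ) : EReal) * elog (μ n Θ)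

/-- Large-deviation upper bound for closed sets. -/
def LDPUpper {E : Type*} [TopologicalSpace E] [MeasurableSpace E]
    (μ : ℕ → Measure E) (γ : ℕ → ℝ) (I : E → ℝ≥0∞) : Prop :=
  ∀ Γ : Set E, IsClosed Γ →
    (Filter.atTop.limsup fun n => (((γ n)⁻¹ : ℝ) : EReal) * elog (μ n Γ)) ≤
      -(⨅ x ∈ Γ, (I x : EReal))

/-- Large-deviation upper bound for compact sets. -/
def LDPUpperCompact {E : Type*} [TopologicalSpace E] [MeasurableSpace E]
    (μ : ℕ → Measure E) (γ : ℕ → ℝ) (I : E → ℝ≥0∞) : Prop :=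
  ∀ Γ : Set E, IsCompact Γ →
    (Filter.atTop.limsup fun n => (((γ n)⁻¹ : ℝ) : EReal) * elog (μ n Γ)) ≤
      -(⨅ x ∈ Γ, (I x : EReal))

/-- `(μₙ)` satisfies a large deviation principle with speed `γ` and
(lower semicontinuous) rate function `I`. -/
def LDP {E : Type*} [TopologicalSpace E] [MeasurableSpace E]
    (μ : ℕ → Measure E) (γ : ℕ → ℝ) (I : E → ℝ≥0∞) : Prop :=
  LowerSemicontinuous I ∧ LDPLower μ γ I ∧ LDPUpper μ γ I

/-- `(μₙ)` satisfies a weak large deviation principle with speed `γ` and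
rate function `I` (upper bound only for compact sets). -/
def WLDP {E : Type*} [TopologicalSpace E] [MeasurableSpace E]
    (μ : ℕ → Measure E) (γ : ℕ → ℝ) (I : E → ℝ≥0∞) : Prop :=
  LowerSemicontinuous I ∧ LDPLower μ γ I ∧ LDPUpperCompact μ γ I

/-- A good rate function: lower semicontinuous with compact sublevel sets. -/
def GoodRate {E : Type*} [TopologicalSpace E] (I : E → ℝ≥0∞) : Prop :=
  LowerSemicontinuous I ∧ ∀ a : ℝ≥0, IsCompact {x | I x ≤ (a : ℝ≥0∞)}

/-- A family of random variables satisfies an LDP if the family of their laws does. -/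
def LDPrv {Ω E : Type*} [MeasurableSpace Ω] [TopologicalSpace E] [MeasurableSpace E]
    (P : Measure Ω) (X : ℕ → Ω → E) (γ : ℕ → ℝ) (I : E → ℝ≥0∞) : Prop :=
  LDP (fun n => P.map (X n)) γ I

/-- A family of random variables satisfies a WLDP if the family of their laws does. -/
def WLDPrv {Ω E : Type*} [MeasurableSpace Ω] [TopologicalSpace E] [MeasurableSpace E]
    (P : Measure Ω) (X : ℕ → Ω → E) (γ : ℕ → ℝ) (I : E → ℝ≥0∞) : Prop :=
  WLDP (fun n => P.map (X n)) γ I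

/-- Exponential tightness at speed `γ(n)` of a family of `C([0,1],ℝ)`-valued
random variables. -/
def ExpTight {Ω : Type*} [MeasurableSpace Ω] (P : Measure Ω) (X : ℕ → Ω → CC)
    (γ : ℕ → ℝ) : Prop :=
  ∀ R : ℝ, 0 < R → ∃ K : Set CC, IsCompact K ∧
    (Filter.atTop.limsup fun n => (((γ n)⁻¹ : ℝ) : EReal) * elog (P (X n ⁻¹' Kᶜ))) ≤
      ((-R : ℝ) : EReal)

/-- A real random variable is Gaussian. -/
def IsGaussianRV {Ω : Type*} [MeasurableSpace Ω] (P : Measure Ω) (ξ : Ω → ℝ) : Prop :=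
  ∃ (m : ℝ) (v : ℝ≥0), P.map ξ = gaussianReal m v

/-- A `C([0,1],ℝ)`-valued random variable is a continuous Gaussian process:
`⟨λ,X⟩` is a Gaussian real random variable for every signed measure `λ`. -/
def IsContGaussian {Ω : Type*} [MeasurableSpace Ω] (P : Measure Ω) (X : Ω → CC) : Prop :=
  Measurable X ∧ ∀ lam : MeasureTheory.SignedMeasure UI,
    IsGaussianRV P fun ω => pairSM lam (X ω)

/-- A continuous Gaussian process is centered: `E⟨λ,X⟩ = 0` for all `λ`. -/
def IsCentered {Ω : Type*} [MeasurableSpace Ω] (P : Measure Ω) (X : Ω → CC) : Prop :=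
  ∀ lam : MeasureTheory.SignedMeasure UI, ∫ ω, pairSM lam (X ω) ∂P = 0

/-- `k` is the covariance function of some centered continuous Gaussian process. -/
def IsCovOfCenteredCGP (k : UI → UI → ℝ) : Prop :=
  ∃ (Ω' : Type) (_ : MeasurableSpace Ω') (P' : Measure Ω') (U : Ω' → CC),
    IsProbabilityMeasure P' ∧ IsContGaussian P' U ∧ IsCentered P' U ∧
      ∀ s t : UI, k s t = ∫ ω, U ω s * U ω t ∂P'

/-- Hypothesis (G): `(Xⁿ)` are centered continuous Gaussian processes,
exponentially tight at speed `γ(n)`, with `γ(n)·Var⟨λ,Xⁿ⟩ → ∫∫ k̄ dλdλ`,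
where `k̄` is a continuous symmetric positive semidefinite kernel which is the
covariance of some centered continuous Gaussian process. -/
def HypG {Ω : Type*} [MeasurableSpace Ω] (P : Measure Ω) (X : ℕ → Ω → CC)
    (γ : ℕ → ℝ) (kbar : UI → UI → ℝ) : Prop :=
  (∀ n, IsContGaussian P (X n)) ∧ (∀ n, IsCentered P (X n)) ∧
    ExpTight P X γ ∧ IsPSDKernel kbar ∧ IsCovOfCenteredCGP kbar ∧
    ∀ lam : MeasureTheory.SignedMeasure UI,
      Tendsto (fun n => γ n * variance (fun ω => pairSM lam (X n ω)) P) atTop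
        (nhds (dblInt lam kbar))

/-- `C_α = {y ∈ C([0,1],ℝ) : y(t) ≥ α for all t}`. -/
def Calpha (α : ℝ) : Set CC := {y : CC | ∀ t, α ≤ y t}

/-- The mean function `m(t) = e^{a₁t}(x + (a₀/a₁)(1−e^{−a₁t}))` of the
Ornstein–Uhlenbeck process. -/
def mFun (a0 a1 x : ℝ) (t : UI) : ℝ :=
  Real.exp (a1 * t) * (x + a0 / a1 * (1 - Real.exp (-(a1 * t))))

/-- The covariance kernel `kʸ(s,t) = e^{a₁(s+t)} ∫₀^{s∧t} e^{−2a₁u} y(u)² du`. -/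
def kyFun (a1 : ℝ) (y : CC) (s t : UI) : ℝ :=
  Real.exp (a1 * ((s : ℝ) + (t : ℝ))) *
    ∫ u in (0:ℝ)..(min (s : ℝ) (t : ℝ)),
      Real.exp (-(2 * a1 * u)) * (Set.IccExtend zero_le_one (⇑y) u) ^ 2

/-- The Freidlin–Wentzell rate function
`J(f|y) = (1/2)∫₀¹ ((φ(t) − a₀ − a₁f(t))/y(t))² dt` if `f = x + ∫₀^· φ` for some
`φ ∈ L²[0,1]`, and `+∞` otherwise. -/
def Jfw (a0 a1 x : ℝ) (y f : CC) : ℝ≥0∞ :=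
  ⨅ (φ : ℝ → ℝ) (_ : MemLp φ 2 (volume.restrict (Set.Icc (0:ℝ) 1)))
      (_ : ∀ t : UI, f t = x + ∫ s in (0:ℝ)..(t : ℝ), φ s),
    ENNReal.ofReal ((1/2) * ∫ t in (0:ℝ)..1,
      ((φ t - a0 - a1 * Set.IccExtend zero_le_one (⇑f) t) /
        Set.IccExtend zero_le_one (⇑y) t) ^ 2)

/-! ### Elementary reformulation of large deviation bounds -/

lemma elog_le_iff (p : ℝ≥0∞) (c : ℝ) :
    elog p ≤ (c : EReal) ↔ p ≤ ENNReal.ofReal (Real.exp c) := by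
  unfold elog
  split_ifs with h0 h1
  · simp [h0]
  · simp [h1]
  · have hp : 0 < p.toReal := ENNReal.toReal_pos h0 h1
    rw [EReal.coe_le_coe_iff, Real.log_le_iff_le_exp hp,
      ENNReal.le_ofReal_iff_toReal_le h1 (Real.exp_pos c).le]

lemma le_elog_iff (p : ℝ≥0∞) (c : ℝ) :
    (c : EReal) ≤ elog p ↔ ENNReal.ofReal (Real.exp c) ≤ p := by
  unfold elog
  split_ifs with h0 h1
  · simp [h0, Real.exp_pos]
  · simp [h1]
  · have hp : 0 < p.toReal := ENNReal.toReal_pos h0 h1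
    rw [EReal.coe_le_coe_iff, Real.le_log_iff_exp_le hp, ENNReal.ofReal_le_iff_le_toReal h1]

lemma inv_mul_le_coe_iff {n : ℕ} (hn : 0 < n) (E : EReal) (c : ℝ) :
    ((((n : ℝ))⁻¹ : ℝ) : EReal) * E ≤ (c : EReal) ↔ E ≤ ((n * c : ℝ) : EReal) := by
  have hn' : (0 : ℝ) < n := by exact_mod_cast hn
  have hi : (0 : ℝ) < (n : ℝ)⁻¹ := inv_pos.2 hn'
  induction E with
  | bot => simp [EReal.coe_mul_bot_of_pos hi]
  | top => simp [EReal.coe_mul_top_of_pos hi, -EReal.coe_mul]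
  | coe r =>
    rw [← EReal.coe_mul, EReal.coe_le_coe_iff, EReal.coe_le_coe_iff, inv_mul_le_iff₀ hn']

lemma coe_le_inv_mul_iff {n : ℕ} (hn : 0 < n) (E : EReal) (c : ℝ) :
    (c : EReal) ≤ ((((n : ℝ))⁻¹ : ℝ) : EReal) * E ↔ ((n * c : ℝ) : EReal) ≤ E := by
  have hn' : (0 : ℝ) < n := by exact_mod_cast hn
  have hi : (0 : ℝ) < (n : ℝ)⁻¹ := inv_pos.2 hn'
  induction E with
  | bot => simp [EReal.coe_mul_bot_of_pos hi, -EReal.coe_mul]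
  | top => simp [EReal.coe_mul_top_of_pos hi]
  | coe r =>
    rw [← EReal.coe_mul, EReal.coe_le_coe_iff, EReal.coe_le_coe_iff, le_inv_mul_iff₀ hn']

lemma coe_biInf_ereal {E : Type*} (I : E → ℝ≥0∞) (S : Set E) :
    (⨅ x ∈ S, (I x : EReal)) = ((⨅ x ∈ S, I x : ℝ≥0∞) : EReal) := by
  have h : ∀ {ι : Sort _} (g : ι → ℝ≥0∞), ((⨅ i, g i : ℝ≥0∞) : EReal) = ⨅ i, (g i : EReal) := by
    intro ι g
    exact Monotone.map_iInf_of_continuousAt (f := fun x : ℝ≥0∞ => (x : EReal))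
      continuous_coe_ennreal_ereal.continuousAt
      (fun a b hab => EReal.coe_ennreal_le_coe_ennreal_iff.2 hab) (by simp)
  have h2 : ∀ {ι : Prop} (g : ι → ℝ≥0∞), ((⨅ i, g i : ℝ≥0∞) : EReal) = ⨅ i, (g i : EReal) := by
    intro ι g
    by_cases hι : ι <;> simp [hι]
  rw [h]
  simp_rw [h2]

lemma limsup_le_neg_iff (p : ℕ → ℝ≥0∞) (hp : ∀ n, p n ≤ 1) (L : ℝ≥0∞) :
    (Filter.atTop.limsup fun n : ℕ => ((((n : ℝ))⁻¹ : ℝ) : EReal) * elog (p n)) ≤ -(L : EReal) ↔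
      ∀ a : ℝ, 0 ≤ a → ENNReal.ofReal a < L →
        ∀ᶠ n : ℕ in atTop, p n ≤ ENNReal.ofReal (Real.exp (-(n * a))) := by
  constructor
  · intro h a ha haL
    have h1 : -(L : EReal) < ((-a : ℝ) : EReal) := by
      rw [EReal.coe_neg, EReal.neg_lt_neg_iff]
      have : ((ENNReal.ofReal a : ℝ≥0∞) : EReal) < (L : EReal) :=
        EReal.coe_ennreal_lt_coe_ennreal_iff.2 haL
      rwa [EReal.coe_ennreal_ofReal, max_eq_left ha] at this
    have h2 := eventually_lt_of_limsup_lt (lt_of_le_of_lt h h1)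
    filter_upwards [h2, eventually_gt_atTop 0] with n hn hn0
    have := (inv_mul_le_coe_iff hn0 _ _).1 hn.le
    rw [elog_le_iff] at this
    simpa using this
  · intro h
    rw [← EReal.le_of_forall_lt_iff_le]
    intro z hz
    refine limsup_le_of_le (by isBoundedDefault) ?_
    rcases lt_or_ge 0 z with hz0 | hz0
    · filter_upwards [eventually_gt_atTop 0] with n hn0
      rw [inv_mul_le_coe_iff hn0, elog_le_iff]
      refine (hp n).trans ?_
      rw [← ENNReal.ofReal_one]
      apply ENNReal.ofReal_le_ofReal
      rw [Real.one_le_exp_iff]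
      positivity
    · have h1 : ENNReal.ofReal (-z) < L := by
        rw [← EReal.coe_ennreal_lt_coe_ennreal_iff, EReal.coe_ennreal_ofReal,
          max_eq_left (by linarith), EReal.coe_neg]
        exact EReal.neg_lt_comm.1 hz
      filter_upwards [h (-z) (by linarith) h1, eventually_gt_atTop 0] with n hn hn0
      rw [inv_mul_le_coe_iff hn0, elog_le_iff]
      simpa using hn

lemma neg_le_liminf_iff (p : ℕ → ℝ≥0∞) (L : ℝ≥0∞) :
    -(L : EReal) ≤ (Filter.atTop.liminf fun n : ℕ => ((((n : ℝ))⁻¹ : ℝ) : EReal) * elog (p n)) ↔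
      (L ≠ ⊤ → ∀ ε : ℝ, 0 < ε →
        ∀ᶠ n : ℕ in atTop, ENNReal.ofReal (Real.exp (-(n * (L.toReal + ε)))) ≤ p n) := by
  constructor
  · intro h hL ε hε
    have h1 : ((-(L.toReal + ε) : ℝ) : EReal) < -(L : EReal) := by
      rw [EReal.coe_neg, EReal.neg_lt_neg_iff, ← ENNReal.ofReal_toReal hL, EReal.coe_ennreal_ofReal,
        max_eq_left ENNReal.toReal_nonneg, EReal.coe_lt_coe_iff,
        ENNReal.toReal_ofReal ENNReal.toReal_nonneg]
      linarith
    have h2 := eventually_lt_of_lt_liminf (lt_of_lt_of_le h1 h)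
    filter_upwards [h2, eventually_gt_atTop 0] with n hn hn0
    have := (coe_le_inv_mul_iff hn0 _ _).1 hn.le
    rw [le_elog_iff] at this
    rwa [mul_neg] at this
  · intro h
    by_cases hL : L = ⊤
    · simp [hL]
    rw [← EReal.ge_of_forall_gt_iff_ge]
    intro z hz
    refine le_liminf_of_le (by isBoundedDefault) ?_
    have hz' : z < - L.toReal := by
      rw [← ENNReal.ofReal_toReal hL, EReal.coe_ennreal_ofReal,
        max_eq_left ENNReal.toReal_nonneg, ← EReal.coe_neg, EReal.coe_lt_coe_iff] at hz
      exact hz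
    filter_upwards [h hL (-z - L.toReal) (by linarith), eventually_gt_atTop 0] with n hn hn0
    rw [coe_le_inv_mul_iff hn0, le_elog_iff]
    refine le_trans (le_of_eq ?_) hn
    congr 2
    ring

/-- Reformulated upper bound. -/
lemma upper_iff {E : Type*} [MeasurableSpace E] (μ : ℕ → Measure E)
    (hμ : ∀ n, IsProbabilityMeasure (μ n)) (I : E → ℝ≥0∞) (S : Set E) :
    (Filter.atTop.limsup fun n : ℕ => ((((n : ℝ))⁻¹ : ℝ) : EReal) * elog (μ n S)) ≤
        -(⨅ x ∈ S, (I x : EReal)) ↔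
      ∀ a : ℝ, 0 ≤ a → ENNReal.ofReal a < (⨅ x ∈ S, I x) →
        ∀ᶠ n : ℕ in atTop, μ n S ≤ ENNReal.ofReal (Real.exp (-(n * a))) := by
  rw [coe_biInf_ereal, limsup_le_neg_iff _ (fun n => prob_le_one)]

/-- Reformulated lower bound. -/
lemma lower_iff {E : Type*} [MeasurableSpace E] (μ : ℕ → Measure E)
    (I : E → ℝ≥0∞) (S : Set E) :
    -(⨅ x ∈ S, (I x : EReal)) ≤
      (Filter.atTop.liminf fun n : ℕ => ((((n : ℝ))⁻¹ : ℝ) : EReal) * elog (μ n S)) ↔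
      ∀ x ∈ S, I x ≠ ⊤ → ∀ ε : ℝ, 0 < ε →
        ∀ᶠ n : ℕ in atTop, ENNReal.ofReal (Real.exp (-(n * ((I x).toReal + ε)))) ≤ μ n S := by
  constructor
  · intro h x hx
    rw [← neg_le_liminf_iff]
    refine le_trans ?_ h
    rw [EReal.neg_le_neg_iff]
    exact iInf₂_le x hx
  · intro h
    rw [EReal.neg_le]
    refine le_iInf₂ fun x hx => ?_
    rw [EReal.neg_le, neg_le_liminf_iff]
    exact h x hx

/-! ### Abstract duality in a Hilbert space -/

lemma hilbert_duality {H ι : Type*} [NormedAddCommGroup H] [InnerProductSpace ℝ H]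
    [CompleteSpace H] (v : ι → H) (w : ι → ℝ) (L : ℝ)
    (hL : ∀ c : ι →₀ ℝ, Finsupp.linearCombination ℝ w c -
      (1/2) * ‖Finsupp.linearCombination ℝ v c‖ ^ 2 ≤ L) :
    ∃ ψ : H, (1/2) * ‖ψ‖ ^ 2 ≤ L ∧ ∀ i, w i = inner ℝ ψ (v i) := by
  set A := Finsupp.linearCombination ℝ v with hA
  set W := Finsupp.linearCombination ℝ w with hW
  have hL0 : 0 ≤ L := by simpa using hL 0
  have hsq : ∀ c, (W c) ^ 2 ≤ 2 * L * ‖A c‖ ^ 2 := by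
    intro c
    have key : ∀ θ : ℝ, 0 ≤ ((1/2) * ‖A c‖ ^ 2) * (θ * θ) + (-(W c)) * θ + L := by
      intro θ
      have := hL (θ • c)
      rw [map_smul, map_smul, norm_smul, mul_pow, Real.norm_eq_abs, sq_abs, smul_eq_mul] at this
      linarith
    have := discrim_le_zero key
    unfold discrim at this
    linarith
  have hb : ∀ c, |W c| ≤ Real.sqrt (2 * L) * ‖A c‖ := by
    intro c
    refine abs_le_of_sq_le_sq ?_ (by positivity)
    rw [mul_pow, Real.sq_sqrt (by positivity)]
    exact hsq c
  have hker : W ∈ (LinearMap.ker A).dualAnnihilator := by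
    rw [Submodule.mem_dualAnnihilator]
    intro c hc
    have := hb c
    rw [LinearMap.mem_ker.1 hc, norm_zero, mul_zero] at this
    exact abs_nonpos_iff.1 this
  rw [← LinearMap.range_dualMap_eq_dualAnnihilator_ker] at hker
  obtain ⟨g, hg⟩ := hker
  have hgc : ∀ c, g (A c) = W c := fun c => by
    rw [← hg]; rfl
  let p := LinearMap.range A
  let gp : p →L[ℝ] ℝ := LinearMap.mkContinuous (g.domRestrict p) (Real.sqrt (2 * L)) (by
    rintro ⟨_, ⟨c, rfl⟩⟩
    have := hb c
    rw [← hgc] at this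
    exact this)
  obtain ⟨G, hG, hGn⟩ := exists_extension_norm_eq p gp
  refine ⟨(InnerProductSpace.toDual ℝ H).symm G, ?_, ?_⟩
  · rw [LinearIsometryEquiv.norm_map, hGn]
    have h1 : ‖gp‖ ≤ Real.sqrt (2 * L) := LinearMap.mkContinuous_norm_le _ (by positivity) _
    have h2 : ‖gp‖ ^ 2 ≤ 2 * L := by
      rw [← Real.sq_sqrt (show 0 ≤ 2 * L by positivity)]
      gcongr
    linarith
  · intro i
    rw [InnerProductSpace.toDual_symm_apply]
    have h1 : A (Finsupp.single i 1) = v i := by simp [hA]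
    have h2 : W (Finsupp.single i 1) = w i := by simp [hW]
    have h3 := hG ⟨A (Finsupp.single i 1), ⟨_, rfl⟩⟩
    rw [← h1, ← h2, ← hgc]
    exact h3.symm

section Abstract

variable {H : Type*} [NormedAddCommGroup H] [InnerProductSpace ℝ H]

/-- The linear functional `∑ cᵢ (f - m)(tᵢ)`. -/
def SL (m : CC) (c : UI →₀ ℝ) (f : CC) : ℝ :=
  Finsupp.linearCombination ℝ (fun t => f t - m t) c

/-- The vector `∑ cᵢ V y tᵢ`. -/
def AV (V : CC → UI → H) (c : UI →₀ ℝ) (y : CC) : H :=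
  Finsupp.linearCombination ℝ (V y) c

/-- Rate function written with a Hilbert space infimum. -/
def Jinf (m : CC) (V : CC → UI → H) (y f : CC) : ℝ≥0∞ :=
  ⨅ (ψ : H) (_ : ∀ t, f t = m t + inner ℝ ψ (V y t)), ENNReal.ofReal ((1/2) * ‖ψ‖ ^ 2)

/-- The dual functional. -/
def Lc (m : CC) (V : CC → UI → H) (c : UI →₀ ℝ) (y f : CC) : ℝ :=
  SL m c f - (1/2) * ‖AV V c y‖ ^ 2

lemma inner_AV (V : CC → UI → H) (c : UI →₀ ℝ) (y : CC) (ψ : H) (w : UI → ℝ)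
    (hw : ∀ t, w t = inner ℝ ψ (V y t)) :
    Finsupp.linearCombination ℝ w c = inner ℝ ψ (AV V c y) := by
  unfold AV
  rw [Finsupp.linearCombination_apply, Finsupp.linearCombination_apply, Finsupp.sum, Finsupp.sum,
    inner_sum]
  refine Finset.sum_congr rfl fun t _ => ?_
  rw [inner_smul_right, hw, smul_eq_mul]

lemma Lc_le_Jinf (m : CC) (V : CC → UI → H) (c : UI →₀ ℝ) (y f : CC) :
    ENNReal.ofReal (Lc m V c y f) ≤ Jinf m V y f := by
  refine le_iInf₂ fun ψ hψ => ENNReal.ofReal_le_ofReal ?_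
  unfold Lc SL
  rw [inner_AV V c y ψ (fun t => f t - m t) (fun t => by simp [hψ t])]
  have h1 := real_inner_le_norm ψ (AV V c y)
  nlinarith [sq_nonneg (‖ψ‖ - ‖AV V c y‖)]

lemma Jinf_le [CompleteSpace H] (m : CC) (V : CC → UI → H) (y f : CC) (L : ℝ)
    (h : ∀ c, Lc m V c y f ≤ L) : Jinf m V y f ≤ ENNReal.ofReal L := by
  obtain ⟨ψ, h1, h2⟩ := hilbert_duality (V y) (fun t => f t - m t) L h
  refine (iInf₂_le ψ fun t => ?_).trans (ENNReal.ofReal_le_ofReal h1)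
  rw [← h2 t]; ring

lemma Jinf_eq_iSup [CompleteSpace H] (m : CC) (V : CC → UI → H) (y f : CC) :
    Jinf m V y f = ⨆ c, ENNReal.ofReal (Lc m V c y f) := by
  apply le_antisymm
  · by_cases ht : (⨆ c, ENNReal.ofReal (Lc m V c y f)) = ⊤
    · rw [ht]; exact le_top
    · rw [← ENNReal.ofReal_toReal ht]
      apply Jinf_le
      intro c
      have := le_iSup (fun c => ENNReal.ofReal (Lc m V c y f)) c
      exact (ENNReal.ofReal_le_iff_le_toReal ht).1 this
  · exact iSup_le fun c => Lc_le_Jinf m V c y f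

lemma continuous_SL (m : CC) (c : UI →₀ ℝ) : Continuous (SL m c) := by
  unfold SL
  simp only [Finsupp.linearCombination_apply, Finsupp.sum]
  refine continuous_finsetSum _ fun t _ => ?_
  exact continuous_const.mul ((continuous_eval_const (F := CC) t).sub continuous_const)

lemma continuous_AV (V : CC → UI → H) (hV : ∀ t, Continuous fun y => V y t) (c : UI →₀ ℝ) :
    Continuous (AV V c) := by
  unfold AV
  simp only [Finsupp.linearCombination_apply, Finsupp.sum]
  exact continuous_finsetSum _ fun t _ => (hV t).const_smul _

lemma lsc_Jinf [CompleteSpace H] (m : CC) (V : CC → UI → H) (hV : ∀ t, Continuous fun y => V y t) :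
    LowerSemicontinuous fun p : CC × CC => Jinf m V p.1 p.2 := by
  simp_rw [Jinf_eq_iSup]
  refine lowerSemicontinuous_iSup fun c => Continuous.lowerSemicontinuous ?_
  refine ENNReal.continuous_ofReal.comp ?_
  unfold Lc
  have h1 := (continuous_SL m c).comp (continuous_snd (X := CC) (Y := CC))
  have h2 := (continuous_AV V hV c).comp (continuous_fst (X := CC) (Y := CC))
  exact h1.sub (continuous_const.mul (h2.norm.pow 2))

end Abstract

/-! ### Dyadic chaining -/

/-- Dyadic point `j / 2^k`, projected to `[0,1]`. -/
def dy (k j : ℕ) : UI := Set.projIcc 0 1 zero_le_one ((j : ℝ) / 2 ^ k)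

lemma dy_coe {k j : ℕ} (h : j ≤ 2 ^ k) : ((dy k j : UI) : ℝ) = (j : ℝ) / 2 ^ k := by
  unfold dy
  rw [Set.projIcc_of_mem zero_le_one (x := (j : ℝ) / 2 ^ k)]
  refine ⟨by positivity, ?_⟩
  rw [div_le_one (by positivity)]
  exact_mod_cast h

lemma dy_double (k j : ℕ) : dy (k + 1) (2 * j) = dy k j := by
  unfold dy
  congr 1
  push_cast
  rw [pow_succ]
  field_simp

/-- The set of functions with dyadic modulus of continuity controlled by `A (3/4)^k`. -/
def KA (c : CC) (A : ℝ) : Set CC :=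
  {z | z 0 = c 0 ∧ ∀ k j : ℕ, j < 2 ^ k →
    |(z (dy k (j + 1)) - c (dy k (j + 1))) - (z (dy k j) - c (dy k j))| ≤ A * (3 / 4) ^ k}

lemma floor_le_two_pow (k : ℕ) (t : UI) : ⌊(2 : ℝ) ^ k * (t : ℝ)⌋₊ ≤ 2 ^ k := by
  have h : (2 : ℝ) ^ k * (t : ℝ) ≤ ((2 ^ k : ℕ) : ℝ) := by
    push_cast
    have := t.2.2
    have h2 : (0 : ℝ) < 2 ^ k := by positivity
    nlinarith
  exact (Nat.floor_le_floor h).trans (by rw [Nat.floor_natCast])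

lemma dyadic_modulus (w : UI → ℝ) (hw : Continuous w) (A : ℝ) (hA : 0 ≤ A)
    (h : ∀ k j : ℕ, j < 2 ^ k → |w (dy k (j + 1)) - w (dy k j)| ≤ A * (3 / 4) ^ k)
    (k : ℕ) (s t : UI) (hst : |(t : ℝ) - s| ≤ (1 / 2) ^ k) :
    |w t - w s| ≤ 7 * A * (3 / 4) ^ k := by
  set fl : ℕ → UI → ℕ := fun k t => ⌊(2 : ℝ) ^ k * (t : ℝ)⌋₊ with hfl
  have hle : ∀ k t, fl k t ≤ 2 ^ k := floor_le_two_pow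
  have hstep : ∀ k t, |w (dy (k + 1) (fl (k + 1) t)) - w (dy k (fl k t))| ≤
      A * (3 / 4) ^ (k + 1) := by
    intro k t
    have ht0 : 0 ≤ (t : ℝ) := t.2.1
    have hx0 : 0 ≤ (2 : ℝ) ^ k * (t : ℝ) := by positivity
    have e1 : 2 * fl k t ≤ fl (k + 1) t := by
      apply Nat.le_floor
      push_cast
      have := Nat.floor_le hx0
      rw [pow_succ]
      linarith
    have e2 : fl (k + 1) t < 2 * fl k t + 2 := by
      rw [hfl]
      simp only
      rw [Nat.floor_lt (by positivity)]
      push_cast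
      have := Nat.lt_floor_add_one ((2 : ℝ) ^ k * (t : ℝ))
      rw [pow_succ]
      linarith
    rw [← dy_double k (fl k t)]
    rcases (show fl (k + 1) t = 2 * fl k t ∨ fl (k + 1) t = 2 * fl k t + 1 by omega) with e | e
    · rw [e]; simp; positivity
    · rw [e]
      apply h
      have := hle (k + 1) t
      omega
  have hsum : ∀ k t N, |w (dy (k + N) (fl (k + N) t)) - w (dy k (fl k t))| ≤
      3 * A * ((3 / 4) ^ k - (3 / 4) ^ (k + N)) := by
    intro k t N
    induction N with
    | zero => simp
    | succ N ih =>
      have h1 := hstep (k + N) t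
      have h2 : w (dy (k + (N + 1)) (fl (k + (N + 1)) t)) - w (dy k (fl k t)) =
        (w (dy (k + N + 1) (fl (k + N + 1) t)) - w (dy (k + N) (fl (k + N) t))) +
        (w (dy (k + N) (fl (k + N) t)) - w (dy k (fl k t))) := by
        rw [← add_assoc]; ring
      rw [h2]
      refine (abs_add_le _ _).trans ((add_le_add h1 ih).trans (le_of_eq ?_))
      rw [← add_assoc, pow_succ (3 / 4 : ℝ) (k + N)]
      ring
  have hlim : ∀ t, Tendsto (fun N => dy N (fl N t)) atTop (𝓝 t) := by
    intro t
    rw [tendsto_subtype_rng]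
    have ht0 : 0 ≤ (t : ℝ) := t.2.1
    have hz : Tendsto (fun N : ℕ => (t : ℝ) - (1 / 2) ^ N) atTop (𝓝 ((t : ℝ) - 0)) :=
      tendsto_const_nhds.sub (tendsto_pow_atTop_nhds_zero_of_lt_one (by norm_num) (by norm_num))
    rw [sub_zero] at hz
    refine tendsto_of_tendsto_of_tendsto_of_le_of_le hz tendsto_const_nhds ?_ ?_
    · intro N
      simp only
      rw [dy_coe (hle N t), le_div_iff₀ (by positivity)]
      have := Nat.lt_floor_add_one ((2 : ℝ) ^ N * (t : ℝ))
      have h3 : (1 / 2 : ℝ) ^ N * 2 ^ N = 1 := by rw [← mul_pow]; norm_num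
      rw [sub_mul, h3]
      simp only [hfl]
      linarith
    · intro N
      simp only
      rw [dy_coe (hle N t), div_le_iff₀ (by positivity)]
      have := Nat.floor_le (show 0 ≤ (2 : ℝ) ^ N * (t : ℝ) by positivity)
      simp only [hfl]
      linarith
  have happ : ∀ k t, |w t - w (dy k (fl k t))| ≤ 3 * A * (3 / 4) ^ k := by
    intro k t
    have h1 : Tendsto (fun N => |w (dy (k + N) (fl (k + N) t)) - w (dy k (fl k t))|) atTop
        (𝓝 |w t - w (dy k (fl k t))|) := by
      have h2 := ((hw.tendsto t).comp (hlim t)).comp (tendsto_add_atTop_nat k)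
      have h3 := (h2.sub_const (w (dy k (fl k t)))).abs
      refine h3.congr fun N => ?_
      simp [add_comm]
    refine le_of_tendsto' h1 fun N => (hsum k t N).trans ?_
    have : (0 : ℝ) ≤ (3 / 4) ^ (k + N) := by positivity
    nlinarith
  wlog hle' : s ≤ t generalizing s t
  · rw [abs_sub_comm]
    refine this t s ?_ (le_of_not_ge hle')
    rwa [abs_sub_comm]
  have hs0 : 0 ≤ (s : ℝ) := s.2.1
  have hst' : (s : ℝ) ≤ t := hle'
  have hk : (1 / 2 : ℝ) ^ k * 2 ^ k = 1 := by rw [← mul_pow]; norm_num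
  have hpk : (0 : ℝ) < 2 ^ k := by positivity
  have e1 : fl k s ≤ fl k t := Nat.floor_le_floor (by gcongr)
  have e2 : fl k t < fl k s + 2 := by
    rw [hfl]
    simp only
    have ht0 : 0 ≤ (t : ℝ) := t.2.1
    rw [Nat.floor_lt (by positivity)]
    have := Nat.lt_floor_add_one ((2 : ℝ) ^ k * (s : ℝ))
    rw [abs_of_nonneg (by linarith)] at hst
    push_cast
    nlinarith
  have hmid : |w (dy k (fl k t)) - w (dy k (fl k s))| ≤ A * (3 / 4) ^ k := by
    rcases (show fl k t = fl k s ∨ fl k t = fl k s + 1 by omega) with e | e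
    · rw [e]; simp; positivity
    · rw [e]
      apply h
      have := hle k t
      omega
  have f1 := abs_le.1 (happ k t)
  have f2 := abs_le.1 (happ k s)
  have f3 := abs_le.1 hmid
  rw [abs_le]
  constructor <;> linarith [f1.1, f1.2, f2.1, f2.2, f3.1, f3.2]

lemma KA_modulus {c : CC} {A : ℝ} (hA : 0 ≤ A) {z : CC} (hz : z ∈ KA c A) (k : ℕ) (s t : UI)
    (hst : |(t : ℝ) - s| ≤ (1 / 2) ^ k) :
    |(z t - c t) - (z s - c s)| ≤ 7 * A * (3 / 4) ^ k :=
  dyadic_modulus (fun t => z t - c t) (by fun_prop) A hA hz.2 k s t hst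

lemma KA_sup {c : CC} {A : ℝ} (hA : 0 ≤ A) {z : CC} (hz : z ∈ KA c A) (t : UI) :
    |z t - c t| ≤ 7 * A := by
  have := KA_modulus hA hz 0 0 t (by
    have h1 := t.2.1
    have h2 := t.2.2
    rw [abs_le]; simp; constructor <;> linarith)
  rw [hz.1] at this
  simpa using this

lemma isClosed_KA (c : CC) (A : ℝ) : IsClosed (KA c A) := by
  have : KA c A = {z : CC | z 0 = c 0} ∩ ⋂ (k : ℕ) (j : ℕ) (_ : j < 2 ^ k),
      {z : CC | |(z (dy k (j + 1)) - c (dy k (j + 1))) - (z (dy k j) - c (dy k j))| ≤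
        A * (3 / 4) ^ k} := by
    ext z; simp [KA]
  rw [this]
  refine IsClosed.inter (isClosed_eq (continuous_eval_const (F := CC) 0) continuous_const) ?_
  refine isClosed_iInter fun k => isClosed_iInter fun j => isClosed_iInter fun _ => ?_
  refine isClosed_le ?_ continuous_const
  exact (((continuous_eval_const (F := CC) _).sub continuous_const).sub
    ((continuous_eval_const (F := CC) _).sub continuous_const)).abs

lemma isCompact_KA (c : CC) (A : ℝ) (hA : 0 ≤ A) : IsCompact (KA c A) := by
  let e := ContinuousMap.isometryEquivBoundedOfCompact UI ℝ
  have hc : IsCompact (e '' KA c A) := by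
    refine BoundedContinuousFunction.arzela_ascoli₂ (Metric.closedBall 0 (‖c‖ + 7 * A))
      (isCompact_closedBall _ _) _ ?_ ?_ ?_
    · exact e.toHomeomorph.isClosed_image.2 (isClosed_KA c A)
    · rintro _ t ⟨z, hz, rfl⟩
      have h1 := KA_sup hA hz t
      have h2 := ContinuousMap.norm_coe_le_norm c t
      rw [mem_closedBall_zero_iff]
      change ‖z t‖ ≤ _
      rw [Real.norm_eq_abs] at *
      calc |z t| = |c t + (z t - c t)| := by ring_nf
        _ ≤ _ := (abs_add_le _ _).trans (add_le_add h2 h1)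
    · intro t0
      rw [Metric.equicontinuousAt_iff]
      intro ε hε
      obtain ⟨k, hk⟩ : ∃ k : ℕ, 7 * A * (3 / 4) ^ k < ε / 2 := by
        have : Tendsto (fun k : ℕ => 7 * A * (3 / 4 : ℝ) ^ k) atTop (𝓝 (7 * A * 0)) :=
          (tendsto_pow_atTop_nhds_zero_of_lt_one (by norm_num) (by norm_num)).const_mul _
        rw [mul_zero] at this
        exact ((tendsto_order.1 this).2 _ (half_pos hε)).exists
      obtain ⟨δ, hδ, hcδ⟩ := Metric.continuous_iff.1 c.continuous t0 (ε / 2) (half_pos hε)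
      refine ⟨min δ ((1 / 2) ^ k), lt_min hδ (by positivity), ?_⟩
      rintro t ht ⟨_, ⟨z, hz, rfl⟩⟩
      change dist (z t0) (z t) < ε
      rw [dist_comm] at ht
      have h1 := KA_modulus hA hz k t t0 (by
        have := (lt_min_iff.1 ht).2
        rw [Subtype.dist_eq, Real.dist_eq] at this
        exact this.le)
      have h2 := hcδ t (by rw [dist_comm]; exact (lt_min_iff.1 ht).1)
      rw [dist_comm, Real.dist_eq] at h2
      rw [Real.dist_eq]
      calc |z t0 - z t| = |(z t0 - c t0 - (z t - c t)) + (c t0 - c t)| := by ring_nf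
        _ ≤ _ := abs_add_le _ _
        _ < ε := by linarith
  have := hc.image e.symm.continuous
  rwa [← Set.image_comp, show (e.symm ∘ e) = id by ext1; simp, Set.image_id] at this

/-! ### Exponential Chebyshev bounds and the chaining estimate -/

lemma exp_markov {X : Type*} [MeasurableSpace X] (μ : Measure X) (g : X → ℝ) (hg : Measurable g)
    (r R : ℝ) (h : ∫⁻ z, ENNReal.ofReal (Real.exp (g z)) ∂μ ≤ ENNReal.ofReal (Real.exp R)) :
    μ {z | r ≤ g z} ≤ ENNReal.ofReal (Real.exp (R - r)) := by
  have hm : Measurable fun z => ENNReal.ofReal (Real.exp (g z)) := by fun_prop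
  have h1 := mul_meas_ge_le_lintegral hm (μ := μ) (ENNReal.ofReal (Real.exp r))
  have hs : {z | ENNReal.ofReal (Real.exp r) ≤ ENNReal.ofReal (Real.exp (g z))} =
      {z | r ≤ g z} := by
    ext z
    simp only [Set.mem_ofPred_eq]
    rw [ENNReal.ofReal_le_ofReal_iff (Real.exp_pos _).le, Real.exp_le_exp]
  rw [hs] at h1
  have h2 := h1.trans h
  have h3 : μ {z | r ≤ g z} = ENNReal.ofReal (Real.exp (-r)) *
      (ENNReal.ofReal (Real.exp r) * μ {z | r ≤ g z}) := by
    rw [← mul_assoc, ← ENNReal.ofReal_mul (Real.exp_pos _).le, ← Real.exp_add]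
    simp
  rw [h3]
  refine (mul_le_mul_right h2 _).trans (le_of_eq ?_)
  rw [← ENNReal.ofReal_mul (Real.exp_pos _).le, ← Real.exp_add]
  ring_nf

lemma measurable_eval (t : UI) : Measurable fun z : CC => z t :=
  (continuous_eval_const (F := CC) t).measurable

lemma abs_tail (μ : Measure CC) (g : CC → ℝ) (hg : Measurable g) (N D a : ℝ) (hD : 0 < D)
    (h : ∀ θ : ℝ, ∫⁻ z, ENNReal.ofReal (Real.exp (N * (θ * g z))) ∂μ ≤
      ENNReal.ofReal (Real.exp (N * (θ ^ 2 / 2 * D)))) (hN : 0 < N) (ha : 0 < a) :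
    μ {z | a < |g z|} ≤ ENNReal.ofReal (2 * Real.exp (-(N * a ^ 2 / (2 * D)))) := by
  have hsub : {z | a < |g z|} ⊆ {z | N * (a ^ 2 / D) ≤ N * (a / D * g z)} ∪
      {z | N * (a ^ 2 / D) ≤ N * (-(a / D) * g z)} := by
    intro z hz
    have hz' : a < |g z| := hz
    rcases lt_abs.1 hz' with h1 | h1
    · left
      show N * (a ^ 2 / D) ≤ N * (a / D * g z)
      rw [sq, mul_div_right_comm]
      gcongr
    · right
      show N * (a ^ 2 / D) ≤ N * (-(a / D) * g z)
      rw [sq, mul_div_right_comm, neg_mul, ← mul_neg]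
      gcongr
  refine (measure_mono hsub).trans ((measure_union_le _ _).trans ?_)
  have b1 := exp_markov μ (fun z => N * (a / D * g z)) (by fun_prop) (N * (a ^ 2 / D)) _ (h (a / D))
  have b2 := exp_markov μ (fun z => N * (-(a / D) * g z)) (by fun_prop) (N * (a ^ 2 / D)) _
    (h (-(a / D)))
  have e : N * ((a / D) ^ 2 / 2 * D) - N * (a ^ 2 / D) = -(N * a ^ 2 / (2 * D)) := by
    field_simp; ring
  rw [neg_sq, e] at b2
  rw [e] at b1
  refine (add_le_add b1 b2).trans (le_of_eq ?_)
  rw [← ENNReal.ofReal_add (Real.exp_pos _).le (Real.exp_pos _).le]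
  ring_nf

lemma chain (μ : Measure CC) (c : CC) (n : ℕ) (hn : 0 < n) (C A : ℝ) (hC : 0 < C) (hA : 0 < A)
    (hinc : ∀ s t : UI, ∀ θ : ℝ,
      ∫⁻ z : CC, ENNReal.ofReal (Real.exp (n * (θ * ((z t - c t) - (z s - c s))))) ∂μ ≤
        ENNReal.ofReal (Real.exp (n * (θ ^ 2 / 2 * (C * |(t : ℝ) - s|)))))
    (h0 : μ {z : CC | z 0 ≠ c 0} = 0) (hB : 16 ≤ n * A ^ 2 / (2 * C)) :
    μ (KA c A)ᶜ ≤ ENNReal.ofReal (4 * Real.exp (-(n * A ^ 2 / (2 * C)))) := by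
  set B := n * A ^ 2 / (2 * C) with hBdef
  have hn' : (0 : ℝ) < n := by exact_mod_cast hn
  let T : ℕ → ℕ → Set CC := fun k j =>
    {z | A * (3 / 4) ^ k < |(z (dy k (j + 1)) - c (dy k (j + 1))) - (z (dy k j) - c (dy k j))|}
  have hsub : (KA c A)ᶜ ⊆ {z : CC | z 0 ≠ c 0} ∪ ⋃ k, ⋃ j ∈ Finset.range (2 ^ k), T k j := by
    intro z hz
    by_cases hz0 : z 0 = c 0
    · right
      have : ¬ (z 0 = c 0 ∧ _) := hz
      rw [not_and] at this
      have := this hz0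
      push Not at this
      obtain ⟨k, j, hj, hz⟩ := this
      simp only [Set.mem_iUnion]
      exact ⟨k, j, Finset.mem_range.2 hj, hz⟩
    · exact Or.inl hz0
  have hT : ∀ k j, j < 2 ^ k → μ (T k j) ≤ ENNReal.ofReal (2 * Real.exp (-(B * (9 / 8) ^ k))) := by
    intro k j hj
    have hd : |((dy k (j + 1) : UI) : ℝ) - (dy k j : UI)| = (1 / 2) ^ k := by
      rw [dy_coe hj.le, dy_coe (show j + 1 ≤ 2 ^ k by omega)]
      push_cast
      rw [← sub_div, add_sub_cancel_left, abs_of_nonneg (by positivity), one_div_pow]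
    have := abs_tail μ (fun z => (z (dy k (j + 1)) - c (dy k (j + 1))) - (z (dy k j) - c (dy k j)))
      (((measurable_eval _).sub_const _).sub ((measurable_eval _).sub_const _)) n
      (C * (1 / 2) ^ k) (A * (3 / 4) ^ k) (by positivity)
      (fun θ => by rw [← hd]; exact hinc _ _ θ) hn' (by positivity)
    refine this.trans (le_of_eq ?_)
    have e1 : (n : ℝ) * (A * (3 / 4) ^ k) ^ 2 / (2 * (C * (1 / 2) ^ k)) = B * (9 / 8) ^ k := by
      have : ((3 / 4 : ℝ) ^ k) ^ 2 = (9 / 8) ^ k * (1 / 2) ^ k := by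
        rw [← pow_mul, mul_comm k 2, pow_mul, ← mul_pow]; norm_num
      rw [mul_pow, this, hBdef]
      field_simp
    rw [e1]
  have hU : ∀ k, μ (⋃ j ∈ Finset.range (2 ^ k), T k j) ≤
      ENNReal.ofReal (2 * Real.exp (-B) * (1 / 2) ^ k) := by
    intro k
    refine (measure_biUnion_finset_le _ _).trans ?_
    refine (Finset.sum_le_sum fun j hj => hT k j (Finset.mem_range.1 hj)).trans ?_
    rw [Finset.sum_const, Finset.card_range, nsmul_eq_mul, ← ENNReal.ofReal_natCast,
      ← ENNReal.ofReal_mul (by positivity)]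
    apply ENNReal.ofReal_le_ofReal
    push_cast
    have hb : 1 + (k : ℝ) * (1 / 8) ≤ (9 / 8) ^ k := by
      have := one_add_mul_le_pow (show (-2 : ℝ) ≤ 1 / 8 by norm_num) k
      norm_num at this ⊢
      linarith
    have h2 : Real.exp (-2) ≤ 1 / 4 := by
      rw [Real.exp_neg, show (1 / 4 : ℝ) = 4⁻¹ by norm_num]
      apply inv_anti₀ (by norm_num)
      have h1 := Real.add_one_le_exp (1 : ℝ)
      have : Real.exp 2 = Real.exp 1 * Real.exp 1 := by rw [← Real.exp_add]; norm_num
      nlinarith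
    have h1 : Real.exp (-(B * (9 / 8) ^ k)) ≤ Real.exp (-B) * (1 / 4) ^ k := by
      calc Real.exp (-(B * (9 / 8) ^ k)) ≤ Real.exp (-B + k * (-2)) := by
            apply Real.exp_le_exp.2
            have hk : (0 : ℝ) ≤ k := by positivity
            nlinarith
        _ = Real.exp (-B) * (Real.exp (-2)) ^ k := by rw [Real.exp_add, Real.exp_nat_mul]
        _ ≤ _ := by gcongr
    calc (2 : ℝ) ^ k * (2 * Real.exp (-(B * (9 / 8) ^ k)))
        ≤ 2 ^ k * (2 * (Real.exp (-B) * (1 / 4) ^ k)) := by gcongr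
      _ = 2 * Real.exp (-B) * (2 ^ k * (1 / 4) ^ k) := by ring
      _ = _ := by rw [← mul_pow]; norm_num
  refine (measure_mono hsub).trans ((measure_union_le _ _).trans ?_)
  rw [h0, zero_add]
  refine (measure_iUnion_le _).trans ((ENNReal.tsum_le_tsum hU).trans ?_)
  rw [← ENNReal.ofReal_tsum_of_nonneg (fun k => by positivity)
    (summable_geometric_two.mul_left _), tsum_mul_left, tsum_geometric_two]
  apply ENNReal.ofReal_le_ofReal
  linarith

/-! ### Uniform Gaussian estimates -/

section Gauss

variable {H : Type*} [NormedAddCommGroup H] [InnerProductSpace ℝ H]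

/-- The data used in the abstract part of the argument. -/
structure GSetup (α : ℝ) (m : CC) (V : CC → UI → H) (C : ℝ) (ν : ℕ → CC → Measure CC) : Prop where
  hC : 0 < C
  lip : ∀ y y' t, ‖V y t - V y' t‖ ≤ C * ‖y - y'‖
  bdd : ∀ y t, ‖V y t‖ ≤ C * ‖y‖
  inc : ∀ y (s t : UI), ‖V y t - V y s‖ ^ 2 ≤ C * ‖y‖ ^ 2 * |(t : ℝ) - s|
  zero : ∀ y, V y 0 = 0
  start : ∀ n : ℕ, 0 < n → ∀ y ∈ Calpha α, ν n y {z : CC | z 0 ≠ m 0} = 0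
  mgf : ∀ n : ℕ, 0 < n → ∀ y ∈ Calpha α, ∀ c : UI →₀ ℝ,
    ∫⁻ z, ENNReal.ofReal (Real.exp (n * SL m c z)) ∂(ν n y) =
      ENNReal.ofReal (Real.exp (n * ((1/2) * ‖AV V c y‖ ^ 2)))

variable {α : ℝ} {m : CC} {V : CC → UI → H} {C : ℝ} {ν : ℕ → CC → Measure CC}

lemma GSetup.cont_y (G : GSetup α m V C ν) (t : UI) : Continuous fun y => V y t := by
  refine continuous_iff_continuousAt.2 fun y0 => ?_
  rw [ContinuousAt, tendsto_iff_norm_sub_tendsto_zero]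
  have h1 : Tendsto (fun y : CC => C * ‖y - y0‖) (𝓝 y0) (𝓝 0) := by
    have : Continuous fun y : CC => C * ‖y - y0‖ := by fun_prop
    have h := this.tendsto y0
    simpa using h
  exact squeeze_zero (fun _ => norm_nonneg _) (fun y => G.lip y y0 t) h1

lemma GSetup.cont_t (G : GSetup α m V C ν) (y : CC) : Continuous fun t => V y t := by
  refine continuous_iff_continuousAt.2 fun t0 => ?_
  rw [ContinuousAt, tendsto_iff_norm_sub_tendsto_zero]
  have h1 : Tendsto (fun t : UI => Real.sqrt (C * ‖y‖ ^ 2 * |(t : ℝ) - t0|)) (𝓝 t0) (𝓝 0) := by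
    have : Continuous fun t : UI => Real.sqrt (C * ‖y‖ ^ 2 * |(t : ℝ) - t0|) := by fun_prop
    have h := this.tendsto t0
    simpa using h
  exact squeeze_zero (fun _ => norm_nonneg _)
    (fun t => Real.le_sqrt_of_sq_le (G.inc y t0 t)) h1

/-- The Cameron-Martin shift, as a continuous function. -/
def hS (G : GSetup α m V C ν) (c : UI →₀ ℝ) (y : CC) : CC :=
  ⟨fun t => inner ℝ (AV V c y) (V y t), continuous_const.inner (G.cont_t y)⟩

lemma measurable_SL (m : CC) (c : UI →₀ ℝ) : Measurable (SL m c) := (continuous_SL m c).measurable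

lemma SL_add (m : CC) (c c' : UI →₀ ℝ) (z : CC) : SL m (c + c') z = SL m c z + SL m c' z := by
  simp [SL]

lemma AV_add (V : CC → UI → H) (c c' : UI →₀ ℝ) (y : CC) :
    AV V (c + c') y = AV V c y + AV V c' y := by
  simp [AV]

/-- Tilted measure. -/
def tilt (n : ℕ) (m : CC) (V : CC → UI → H) (ν : ℕ → CC → Measure CC) (c : UI →₀ ℝ) (y : CC) :
    Measure CC :=
  (ν n y).withDensity fun z =>
    ENNReal.ofReal (Real.exp (n * SL m c z - n * ((1/2) * ‖AV V c y‖ ^ 2)))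

lemma tilt_mgf (G : GSetup α m V C ν) {n : ℕ} (hn : 0 < n) {y : CC} (hy : y ∈ Calpha α)
    (c c' : UI →₀ ℝ) :
    ∫⁻ z, ENNReal.ofReal (Real.exp (n * SL m c' z)) ∂(tilt n m V ν c y) =
      ENNReal.ofReal (Real.exp (n * (inner ℝ (AV V c y) (AV V c' y) +
        (1/2) * ‖AV V c' y‖ ^ 2))) := by
  unfold tilt
  have hm1 := measurable_SL m c
  have hm2 := measurable_SL m c'
  rw [lintegral_withDensity_eq_lintegral_mul _ (by fun_prop) (by fun_prop)]
  have h1 : ∀ z, ((fun z => ENNReal.ofReal (Real.exp (n * SL m c z -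
      n * ((1/2) * ‖AV V c y‖ ^ 2)))) * fun z => ENNReal.ofReal (Real.exp (n * SL m c' z))) z =
      ENNReal.ofReal (Real.exp (-(n * ((1/2) * ‖AV V c y‖ ^ 2)))) *
        ENNReal.ofReal (Real.exp (n * SL m (c + c') z)) := by
    intro z
    rw [Pi.mul_apply, ← ENNReal.ofReal_mul (Real.exp_pos _).le,
      ← ENNReal.ofReal_mul (Real.exp_pos _).le, ← Real.exp_add, ← Real.exp_add, SL_add]
    ring_nf
  rw [lintegral_congr h1, lintegral_const_mul' _ _ ENNReal.ofReal_ne_top, G.mgf n hn y hy,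
    ← ENNReal.ofReal_mul (Real.exp_pos _).le, ← Real.exp_add, AV_add, norm_add_sq_real]
  ring_nf

lemma tilt_univ (G : GSetup α m V C ν) {n : ℕ} (hn : 0 < n) {y : CC} (hy : y ∈ Calpha α)
    (c : UI →₀ ℝ) : tilt n m V ν c y Set.univ = 1 := by
  have := tilt_mgf G hn hy c 0
  simpa [SL, AV] using this

lemma tilt_chain (G : GSetup α m V C ν) {n : ℕ} (hn : 0 < n) {y : CC} (hy : y ∈ Calpha α)
    (c : UI →₀ ℝ) {M A : ℝ} (hM : 0 < M) (hyM : ‖y‖ ≤ M) (hA : 0 < A)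
    (hB : 16 ≤ n * A ^ 2 / (2 * (C * M ^ 2))) :
    tilt n m V ν c y (KA (m + hS G c y) A)ᶜ ≤
      ENNReal.ofReal (4 * Real.exp (-(n * A ^ 2 / (2 * (C * M ^ 2))))) := by
  have hC := G.hC
  refine chain _ _ n hn (C * M ^ 2) A (by positivity) hA ?_ ?_ hB
  · intro s t θ
    set c' : UI →₀ ℝ := θ • (Finsupp.single t 1 - Finsupp.single s 1) with hc'
    have hSL : ∀ z, SL m c' z = θ * ((z t - m t) - (z s - m s)) := by
      intro z; simp [SL, hc']
    have hAV : AV V c' y = θ • (V y t - V y s) := by simp [AV, hc']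
    have h1 := tilt_mgf G hn hy c c'
    have h2 : ∀ z : CC, ENNReal.ofReal (Real.exp (n * (θ * ((z t - (m + hS G c y) t) -
        (z s - (m + hS G c y) s))))) =
        ENNReal.ofReal (Real.exp (-(n * (inner ℝ (AV V c y) (AV V c' y))))) *
          ENNReal.ofReal (Real.exp (n * SL m c' z)) := by
      intro z
      rw [← ENNReal.ofReal_mul (Real.exp_pos _).le, ← Real.exp_add, hSL, hAV, inner_smul_right,
        inner_sub_right]
      simp only [ContinuousMap.add_apply, hS, ContinuousMap.coe_mk]
      ring_nf
    rw [lintegral_congr h2, lintegral_const_mul' _ _ ENNReal.ofReal_ne_top, h1,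
      ← ENNReal.ofReal_mul (Real.exp_pos _).le, ← Real.exp_add]
    apply ENNReal.ofReal_le_ofReal
    apply Real.exp_le_exp.2
    have h3 : ‖AV V c' y‖ ^ 2 ≤ θ ^ 2 * (C * M ^ 2 * |(t : ℝ) - s|) := by
      rw [hAV, norm_smul, mul_pow, Real.norm_eq_abs, sq_abs]
      refine mul_le_mul_of_nonneg_left ((G.inc y s t).trans ?_) (sq_nonneg _)
      gcongr
    have hn' : (0 : ℝ) < n := by exact_mod_cast hn
    nlinarith
  · have h1 : (m + hS G c y) 0 = m 0 := by simp [hS, G.zero y]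
    rw [h1]
    exact withDensity_absolutelyContinuous _ _ (G.start n hn y hy)

/-- Uniform exponential tightness. -/
lemma unif_tight (G : GSetup α m V C ν) (M b : ℝ) (hM : 0 < M) :
    ∃ K : Set CC, IsCompact K ∧ ∀ n : ℕ, 0 < n → ∀ y ∈ Calpha α, ‖y‖ ≤ M →
      ν n y Kᶜ ≤ ENNReal.ofReal (Real.exp (-(n * b))) := by
  have hC := G.hC
  set A := Real.sqrt (2 * (C * M ^ 2) * (|b| + 18)) with hA
  have hpos : 0 < 2 * (C * M ^ 2) * (|b| + 18) := by positivity
  have hA0 : 0 < A := Real.sqrt_pos.2 hpos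
  have hA2 : A ^ 2 = 2 * (C * M ^ 2) * (|b| + 18) := Real.sq_sqrt hpos.le
  refine ⟨KA m A, isCompact_KA m A hA0.le, fun n hn y hy hyM => ?_⟩
  have hn' : (1 : ℝ) ≤ n := by exact_mod_cast hn
  have hBe : n * A ^ 2 / (2 * (C * M ^ 2)) = n * (|b| + 18) := by
    rw [hA2]; field_simp
  have hb0 := abs_nonneg b
  have h1 := tilt_chain G hn hy 0 hM hyM hA0 (by rw [hBe]; nlinarith)
  have h2 : tilt n m V ν 0 y = ν n y := by
    simp [tilt, SL, AV]
  have h3 : m + hS G 0 y = m := by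
    ext t; simp [hS, AV]
  rw [h2, h3, hBe] at h1
  refine h1.trans (ENNReal.ofReal_le_ofReal ?_)
  have h4 : (4 : ℝ) ≤ Real.exp (n * 18) := by
    have := Real.add_one_le_exp ((n : ℝ) * 18)
    linarith
  calc 4 * Real.exp (-(n * (|b| + 18))) ≤ Real.exp (n * 18) * Real.exp (-(n * (|b| + 18))) := by
        gcongr
    _ = Real.exp (-(n * |b|)) := by rw [← Real.exp_add]; ring_nf
    _ ≤ _ := by
        apply Real.exp_le_exp.2
        have := le_abs_self b
        nlinarith

/-- Chebyshev upper bound in a half space. -/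
lemma half_space (G : GSetup α m V C ν) {n : ℕ} (hn : 0 < n) {y : CC} (hy : y ∈ Calpha α)
    (c : UI →₀ ℝ) (r : ℝ) :
    ν n y {z | r ≤ SL m c z} ≤
      ENNReal.ofReal (Real.exp (-(n * (r - (1/2) * ‖AV V c y‖ ^ 2)))) := by
  have hn' : (0 : ℝ) < n := by exact_mod_cast hn
  have hm := measurable_SL m c
  have := exp_markov (ν n y) (fun z => n * SL m c z) (by fun_prop) (n * r) _ (G.mgf n hn y hy c).le
  have e : {z | (n : ℝ) * r ≤ n * SL m c z} = {z | r ≤ SL m c z} := by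
    ext z
    simp only [Set.mem_ofPred_eq]
    rw [mul_le_mul_iff_right₀ hn']
  rw [e] at this
  refine this.trans (le_of_eq ?_)
  ring_nf

end Gauss

/-! ### Local lower bound -/

section Lower

variable {H : Type*} [NormedAddCommGroup H] [InnerProductSpace ℝ H]
variable {α : ℝ} {m : CC} {V : CC → UI → H} {C : ℝ} {ν : ℕ → CC → Measure CC}

lemma SL_le_of_KA (G : GSetup α m V C ν) (c : UI →₀ ℝ) (y : CC) {A : ℝ} (hA : 0 ≤ A) {z : CC}
    (hz : z ∈ KA (m + hS G c y) A) :
    SL m c z ≤ ‖AV V c y‖ ^ 2 + 7 * A * c.sum fun _ r => |r| := by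
  have h1 : SL m c z - ‖AV V c y‖ ^ 2 =
      c.sum fun t r => r * (z t - (m + hS G c y) t) := by
    rw [← real_inner_self_eq_norm_sq, ← inner_AV V c y (AV V c y) (fun t => hS G c y t)
      (fun t => rfl), SL, Finsupp.linearCombination_apply, Finsupp.linearCombination_apply,
      Finsupp.sum, Finsupp.sum, ← Finset.sum_sub_distrib]
    refine Finset.sum_congr rfl fun t _ => ?_
    simp only [smul_eq_mul, ContinuousMap.add_apply]
    ring
  have h2 : (c.sum fun t r => r * (z t - (m + hS G c y) t)) ≤
      7 * A * c.sum fun _ r => |r| := by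
    rw [Finsupp.sum, Finsupp.sum, Finset.mul_sum]
    refine Finset.sum_le_sum fun t _ => ?_
    refine (le_abs_self _).trans ?_
    rw [abs_mul, mul_comm]
    exact mul_le_mul_of_nonneg_right (KA_sup hA hz t) (abs_nonneg _)
  linarith

lemma exists_good_coeff [CompleteSpace H] (y0 f0 : CC) (hJ : Jinf m V y0 f0 ≠ ⊤) (ε η : ℝ) (hε : 0 < ε)
    (hη : 0 < η) : ∃ (c : UI →₀ ℝ) (ψ : H), (∀ t, f0 t = m t + inner ℝ ψ (V y0 t)) ∧
      ‖AV V c y0 - ψ‖ < η ∧ (1/2) * ‖AV V c y0‖ ^ 2 < (Jinf m V y0 f0).toReal + ε := by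
  have hlt : Jinf m V y0 f0 < ENNReal.ofReal ((Jinf m V y0 f0).toReal + ε) := by
    rw [ENNReal.lt_ofReal_iff_toReal_lt hJ]; linarith
  obtain ⟨ψ, hψ⟩ := iInf_lt_iff.1 hlt
  obtain ⟨hψ1, hψ2⟩ := iInf_lt_iff.1 hψ
  have hψ3 : (1/2) * ‖ψ‖ ^ 2 < (Jinf m V y0 f0).toReal + ε :=
    (ENNReal.ofReal_lt_ofReal_iff_of_nonneg (by positivity)).1 hψ2
  let K : Submodule ℝ H := (Submodule.span ℝ (Set.range (V y0))).topologicalClosure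
  have : CompleteSpace K := (Submodule.isClosed_topologicalClosure _).completeSpace_coe
  set ψ' : H := K.starProjection ψ with hψ'
  have hnorm : ‖ψ'‖ ≤ ‖ψ‖ := Submodule.norm_starProjection_apply_le K ψ
  have hin : ∀ t, inner ℝ ψ' (V y0 t) = inner ℝ ψ (V y0 t) := by
    intro t
    have hmem : V y0 t ∈ K := Submodule.le_topologicalClosure _ (Submodule.subset_span ⟨t, rfl⟩)
    have := Submodule.starProjection_inner_eq_zero (K := K) ψ (V y0 t) hmem
    rw [inner_sub_left] at this
    linarith
  have hcl : ψ' ∈ closure (Submodule.span ℝ (Set.range (V y0)) : Set H) := by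
    rw [← Submodule.topologicalClosure_coe]
    exact Submodule.starProjection_apply_mem K ψ
  have hopen : IsOpen {P : H | ‖P - ψ'‖ < η ∧ (1/2) * ‖P‖ ^ 2 < (Jinf m V y0 f0).toReal + ε} :=
    IsOpen.and (isOpen_lt (by fun_prop) continuous_const) (isOpen_lt (by fun_prop) continuous_const)
  obtain ⟨P, hP1, hP2⟩ := mem_closure_iff.1 hcl _ hopen (by
    refine ⟨by simpa using hη, lt_of_le_of_lt ?_ hψ3⟩
    gcongr)
  rw [SetLike.mem_coe, Finsupp.mem_span_range_iff_exists_finsupp] at hP2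
  obtain ⟨c, hc⟩ := hP2
  have hc' : AV V c y0 = P := by
    rw [AV, Finsupp.linearCombination_apply]; exact hc
  refine ⟨c, ψ', fun t => by rw [hin, hψ1 t], ?_, ?_⟩
  · rw [hc']; exact hP1.1
  · rw [hc']; exact hP1.2

lemma local_lower [CompleteSpace H] (G : GSetup α m V C ν) (y0 f0 : CC) (hJ : Jinf m V y0 f0 ≠ ⊤)
    (V0 : Set CC) (hV0 : IsOpen V0) (hf0 : f0 ∈ V0) (ε : ℝ) (hε : 0 < ε) :
    ∃ U : Set CC, IsOpen U ∧ y0 ∈ U ∧ ∀ᶠ n : ℕ in atTop, ∀ y ∈ U, y ∈ Calpha α →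
      ENNReal.ofReal (Real.exp (-(n * ((Jinf m V y0 f0).toReal + ε)))) ≤ ν n y V0 := by
  have hC := G.hC
  set J := (Jinf m V y0 f0).toReal with hJdef
  obtain ⟨ρ, hρ, hball⟩ := Metric.isOpen_iff.1 hV0 f0 hf0
  set M := ‖y0‖ + 1 with hMdef
  have hM : 0 < M := by positivity
  obtain ⟨c, ψ, hψ, hcη, hcJ⟩ := exists_good_coeff (m := m) (V := V) y0 f0 hJ (ε / 4)
    (ρ / (4 * (C * M))) (by positivity) (by positivity)
  set l1 := c.sum fun _ r => |r| with hl1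
  have hl1n : 0 ≤ l1 := Finset.sum_nonneg fun t _ => abs_nonneg _
  set A := min (ρ / 56) (ε / (56 * (l1 + 1))) with hA
  have hA0 : 0 < A := lt_min (by positivity) (by positivity)
  have hA1 : 7 * A ≤ ρ / 8 := by
    have := min_le_left (ρ / 56) (ε / (56 * (l1 + 1)))
    rw [← hA] at this; linarith
  have hA2 : 7 * A * l1 ≤ ε / 8 := by
    have := min_le_right (ρ / 56) (ε / (56 * (l1 + 1)))
    rw [← hA, le_div_iff₀ (by positivity)] at this
    nlinarith
  have hcAV := continuous_AV V G.cont_y c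
  let U : Set CC := {y | ‖y‖ < M ∧ (1/2) * ‖AV V c y‖ ^ 2 < J + ε / 2 ∧
    ‖AV V c y - AV V c y0‖ * (C * M) + ‖AV V c y0‖ * (C * ‖y - y0‖) < ρ / 4}
  have hUo : IsOpen U := IsOpen.and (isOpen_lt (by fun_prop) continuous_const)
    (IsOpen.and (isOpen_lt (by fun_prop) continuous_const)
      (isOpen_lt (by fun_prop) continuous_const))
  have hy0U : y0 ∈ U := by
    refine ⟨by rw [hMdef]; linarith, by linarith, ?_⟩
    simp; exact hρ
  refine ⟨U, hUo, hy0U, ?_⟩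
  have hev1 : ∀ᶠ n : ℕ in atTop, 16 ≤ (n : ℝ) * (A ^ 2 / (2 * (C * M ^ 2))) :=
    (tendsto_natCast_atTop_atTop.atTop_mul_const (by positivity)).eventually_ge_atTop 16
  have hev2 : ∀ᶠ n : ℕ in atTop, 1 ≤ (n : ℝ) * (ε / 8) :=
    (tendsto_natCast_atTop_atTop.atTop_mul_const (by positivity)).eventually_ge_atTop 1
  filter_upwards [hev1, hev2, eventually_gt_atTop 0] with n hn1 hn2 hn y hyU hyα
  obtain ⟨hyM, hyJ, hyρ⟩ := hyU
  rw [← mul_div_assoc] at hn1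
  have hch := tilt_chain G hn hyα c hM hyM.le hA0 hn1
  set B := n * A ^ 2 / (2 * (C * M ^ 2)) with hB
  set K := KA (m + hS G c y) A with hK
  have hKm : MeasurableSet K := (isClosed_KA _ _).measurableSet
  -- the tilted measure of `K` is at least one half
  have hhalf : ENNReal.ofReal (1 / 2) ≤ tilt n m V ν c y K := by
    have h1 : tilt n m V ν c y K + tilt n m V ν c y Kᶜ = 1 := by
      rw [measure_add_measure_compl hKm, tilt_univ G hn hyα]
    have h2 : tilt n m V ν c y Kᶜ ≤ ENNReal.ofReal (1 / 2) := by
      refine hch.trans (ENNReal.ofReal_le_ofReal ?_)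
      have h3 := Real.add_one_le_exp B
      rw [Real.exp_neg, ← div_eq_mul_inv, div_le_iff₀ (Real.exp_pos _)]
      linarith
    by_contra hlt
    push Not at hlt
    have h4 : tilt n m V ν c y K + tilt n m V ν c y Kᶜ <
        ENNReal.ofReal (1 / 2) + ENNReal.ofReal (1 / 2) :=
      ENNReal.add_lt_add_of_lt_of_le (ne_top_of_le_ne_top ENNReal.ofReal_ne_top h2) hlt h2
    rw [h1, ← ENNReal.ofReal_add (by norm_num) (by norm_num)] at h4
    norm_num at h4
  -- comparison
  have hcomp : tilt n m V ν c y K ≤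
      ENNReal.ofReal (Real.exp (n * (J + ε / 2 + ε / 8))) * ν n y K := by
    unfold tilt
    rw [withDensity_apply _ hKm, ← setLIntegral_const]
    refine setLIntegral_mono measurable_const fun z hz => ENNReal.ofReal_le_ofReal ?_
    apply Real.exp_le_exp.2
    have h5 := SL_le_of_KA G c y hA0.le hz
    rw [← mul_sub]
    gcongr
    linarith
  have hKV : K ⊆ V0 := by
    intro z hz
    apply hball
    rw [Metric.mem_ball, dist_eq_norm]
    refine lt_of_le_of_lt ((ContinuousMap.norm_le _ (show 0 ≤ 7 * ρ / 8 by positivity)).2 ?_)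
      (show 7 * ρ / 8 < ρ by linarith)
    intro t
    have e1 := KA_sup hA0.le hz t
    have e2 : |inner ℝ (AV V c y) (V y t) - inner ℝ (AV V c y0) (V y0 t)| ≤ ρ / 4 := by
      have : inner ℝ (AV V c y) (V y t) - inner ℝ (AV V c y0) (V y0 t) =
          inner ℝ (AV V c y - AV V c y0) (V y t) + inner ℝ (AV V c y0) (V y t - V y0 t) := by
        rw [inner_sub_left, inner_sub_right]; ring
      rw [this]
      refine (abs_add_le _ _).trans (le_trans (add_le_add ?_ ?_) hyρ.le)
      · refine (abs_real_inner_le_norm _ _).trans ?_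
        have := G.bdd y t
        gcongr
        exact this.trans (by gcongr)
      · refine (abs_real_inner_le_norm _ _).trans ?_
        have := G.lip y y0 t
        gcongr
    have e3 : |inner ℝ (AV V c y0) (V y0 t) - inner ℝ ψ (V y0 t)| ≤ ρ / 4 := by
      rw [← inner_sub_left]
      refine (abs_real_inner_le_norm _ _).trans ?_
      have h6 := G.bdd y0 t
      have h7 : ‖V y0 t‖ ≤ C * M := h6.trans (by rw [hMdef]; gcongr; linarith)
      calc ‖AV V c y0 - ψ‖ * ‖V y0 t‖ ≤ (ρ / (4 * (C * M))) * (C * M) := by gcongr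
        _ = ρ / 4 := by field_simp
    have e4 : (m + hS G c y) t = m t + inner ℝ (AV V c y) (V y t) := rfl
    rw [e4] at e1
    rw [ContinuousMap.sub_apply, Real.norm_eq_abs, hψ t]
    rw [abs_le] at *
    constructor <;> linarith [e1.1, e1.2, e2.1, e2.2, e3.1, e3.2]
  refine le_trans ?_ (measure_mono hKV)
  have h8 := hhalf.trans hcomp
  have h9 : ν n y K = ENNReal.ofReal (Real.exp (-(n * (J + ε / 2 + ε / 8)))) *
      (ENNReal.ofReal (Real.exp (n * (J + ε / 2 + ε / 8))) * ν n y K) := by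
    rw [← mul_assoc, ← ENNReal.ofReal_mul (Real.exp_pos _).le, ← Real.exp_add]
    simp
  rw [h9]
  refine le_trans ?_ (mul_le_mul_right h8 _)
  rw [← ENNReal.ofReal_mul (Real.exp_pos _).le]
  apply ENNReal.ofReal_le_ofReal
  have h10 : Real.exp (-(n * (ε / 8))) ≤ 1 / 2 := by
    rw [Real.exp_neg, ← one_div]
    apply one_div_le_one_div_of_le (by norm_num)
    have := Real.add_one_le_exp ((n : ℝ) * (ε / 8))
    linarith
  calc Real.exp (-(n * (J + ε))) ≤ Real.exp (-(n * (J + ε / 2 + ε / 8)) + -(n * (ε / 8))) := by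
        apply Real.exp_le_exp.2
        have : (0 : ℝ) ≤ n := by positivity
        nlinarith
    _ = Real.exp (-(n * (J + ε / 2 + ε / 8))) * Real.exp (-(n * (ε / 8))) := Real.exp_add _ _
    _ ≤ _ := by gcongr

end Lower

/-! ### Assembling the large deviation principles -/

section Assemble

variable {H : Type*} [NormedAddCommGroup H] [InnerProductSpace ℝ H]
variable {α : ℝ} {m : CC} {V : CC → UI → H} {C : ℝ} {ν : ℕ → CC → Measure CC}

/-- Joint rate function. -/
def IJ (m : CC) (V : CC → UI → H) (IY : CC → ℝ≥0∞) (p : CC × CC) : ℝ≥0∞ :=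
  IY p.1 + Jinf m V p.1 p.2

/-- Abstract data about the joint laws `Q n` with first marginals `R n`. -/
structure QSetup (α : ℝ) (ν : ℕ → CC → Measure CC) (R : ℕ → Measure CC)
    (Q : ℕ → Measure (CC × CC)) (IY : CC → ℝ≥0∞) : Prop where
  probR : ∀ n, IsProbabilityMeasure (R n)
  probQ : ∀ n, IsProbabilityMeasure (Q n)
  supp : ∀ n, ∀ᵐ y ∂(R n), y ∈ Calpha α
  probν : ∀ n y, IsProbabilityMeasure (ν n y)
  dis : ∀ n (B1 B2 : Set CC), MeasurableSet B1 → MeasurableSet B2 →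
      Q n (B1 ×ˢ B2) = ∫⁻ y in B1, ν n y B2 ∂(R n)
  good : GoodRate IY
  suppI : ∀ y, y ∉ Calpha α → IY y = ⊤
  lower : LDPLower R (fun n => (n : ℝ)) IY
  upper : LDPUpper R (fun n => (n : ℝ)) IY

variable {R : ℕ → Measure CC} {Q : ℕ → Measure (CC × CC)} {IY : CC → ℝ≥0∞}

lemma rect_le (S : QSetup α ν R Q IY) (n : ℕ) (B1 B2 : Set CC) (h1 : MeasurableSet B1)
    (h2 : MeasurableSet B2) (k : ℝ≥0∞) (h : ∀ y ∈ B1, y ∈ Calpha α → ν n y B2 ≤ k) :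
    Q n (B1 ×ˢ B2) ≤ k * R n B1 := by
  rw [S.dis n B1 B2 h1 h2, ← setLIntegral_const]
  refine lintegral_mono_ae ?_
  filter_upwards [ae_restrict_of_ae (S.supp n), ae_restrict_mem h1] with y hy hy1
  exact h y hy1 hy

lemma le_rect (S : QSetup α ν R Q IY) (n : ℕ) (B1 B2 : Set CC) (h1 : MeasurableSet B1)
    (h2 : MeasurableSet B2) (k : ℝ≥0∞) (h : ∀ y ∈ B1, y ∈ Calpha α → k ≤ ν n y B2) :
    k * R n B1 ≤ Q n (B1 ×ˢ B2) := by
  rw [S.dis n B1 B2 h1 h2, ← setLIntegral_const]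
  refine lintegral_mono_ae ?_
  filter_upwards [ae_restrict_of_ae (S.supp n), ae_restrict_mem h1] with y hy hy1
  exact h y hy1 hy

lemma joint_lower [CompleteSpace H] (G : GSetup α m V C ν) (S : QSetup α ν R Q IY) :
    LDPLower Q (fun n => (n : ℝ)) (IJ m V IY) := by
  intro Θ hΘ
  rw [lower_iff]
  rintro ⟨y0, f0⟩ hΘ0 hfin ε hε
  have hfin1 : IY y0 ≠ ⊤ := fun h => hfin (by simp [IJ, h])
  have hfin2 : Jinf m V y0 f0 ≠ ⊤ := fun h => hfin (by simp [IJ, h])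
  obtain ⟨U0, V0, hU0, hV0, hy0, hf0, hsub⟩ := isOpen_prod_iff.1 hΘ y0 f0 hΘ0
  obtain ⟨U, hU, hyU, hev⟩ := local_lower G y0 f0 hfin2 V0 hV0 hf0 (ε / 2) (half_pos hε)
  have hY := (lower_iff R IY (U ∩ U0)).1 (S.lower _ (hU.inter hU0)) y0 ⟨hyU, hy0⟩ hfin1 (ε / 2)
    (half_pos hε)
  filter_upwards [hev, hY] with n hn1 hn2
  have h1 := le_rect S n (U ∩ U0) V0 (hU.inter hU0).measurableSet hV0.measurableSet _
    (fun y hy hyα => hn1 y hy.1 hyα)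
  refine le_trans ?_ (h1.trans (measure_mono ?_))
  · refine le_trans (le_of_eq ?_) (mul_le_mul_right hn2 _)
    rw [← ENNReal.ofReal_mul (Real.exp_pos _).le, ← Real.exp_add, IJ, ENNReal.toReal_add hfin1 hfin2]
    ring_nf
  · rintro ⟨y, f⟩ ⟨hy, hf⟩
    exact hsub ⟨hy.2, hf⟩

lemma ball_upper (S : QSetup α ν R Q IY) (y0 : CC) (q : ℝ)
    (hq : q < 0 ∨ ENNReal.ofReal q < IY y0) :
    ∃ r > 0, ∀ᶠ n : ℕ in atTop, R n (Metric.closedBall y0 r) ≤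
      ENNReal.ofReal (Real.exp (-(n * q))) := by
  have := S.probR
  rcases lt_or_ge q 0 with h | h
  · refine ⟨1, one_pos, Eventually.of_forall fun n => prob_le_one.trans ?_⟩
    rw [← ENNReal.ofReal_one]
    apply ENNReal.ofReal_le_ofReal
    rw [Real.one_le_exp_iff]
    have : (0 : ℝ) ≤ n := by positivity
    nlinarith
  · have hq' : ENNReal.ofReal q < IY y0 := hq.resolve_left (not_lt.2 h)
    obtain ⟨q', hq1, hq2⟩ := exists_between hq'
    have hev := S.good.1 y0 q' hq2
    obtain ⟨r, hr, hsub⟩ := Metric.nhds_basis_closedBall.mem_iff.1 hev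
    refine ⟨r, hr, ?_⟩
    refine (upper_iff R S.probR IY _).1 (S.upper _ Metric.isClosed_closedBall) q h ?_
    exact lt_of_lt_of_le hq1 (le_iInf₂ fun y hy => (hsub hy).le)

lemma local_upper [CompleteSpace H] (G : GSetup α m V C ν) (S : QSetup α ν R Q IY) (F : Set (CC × CC))
    (hF : IsClosed F) (a b : ℝ) (ha : 0 ≤ a) (hab : a < b)
    (hb : ∀ p ∈ F, ENNReal.ofReal b ≤ IJ m V IY p) (p0 : CC × CC) :
    ∃ W : Set (CC × CC), IsOpen W ∧ p0 ∈ W ∧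
      ∀ᶠ n : ℕ in atTop, Q n (F ∩ W) ≤ ENNReal.ofReal (Real.exp (-(n * a))) := by
  have := S.probR
  have := S.probν
  by_cases hp : p0 ∈ F
  swap
  · exact ⟨Fᶜ, hF.isOpen_compl, hp, Eventually.of_forall fun n => by simp⟩
  obtain ⟨y0, f0⟩ := p0
  have hI := hb _ hp
  rcases lt_or_ge (ENNReal.ofReal a) (IY y0) with hcase | hcase
  · obtain ⟨r, hr, hev⟩ := ball_upper S y0 a (Or.inr hcase)
    refine ⟨Metric.ball y0 r ×ˢ Set.univ, Metric.isOpen_ball.prod isOpen_univ,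
      ⟨Metric.mem_ball_self hr, trivial⟩, ?_⟩
    filter_upwards [hev] with n hn
    refine (measure_mono Set.inter_subset_right).trans ?_
    refine (rect_le S n _ _ Metric.isOpen_ball.measurableSet MeasurableSet.univ 1
      (fun y _ _ => prob_le_one)).trans ?_
    rw [one_mul]
    exact (measure_mono Metric.ball_subset_closedBall).trans hn
  · have hfin : IY y0 ≠ ⊤ := ne_top_of_le_ne_top ENNReal.ofReal_ne_top hcase
    set p := (IY y0).toReal with hpdef
    have hp0 : 0 ≤ p := ENNReal.toReal_nonneg
    have hpI : ENNReal.ofReal p = IY y0 := ENNReal.ofReal_toReal hfin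
    have hpa : p ≤ a := by
      rw [← hpI] at hcase
      exact (ENNReal.ofReal_le_ofReal_iff ha).1 hcase
    set d := b - a with hd
    have hd0 : 0 < d := by linarith
    have hJ : ENNReal.ofReal (b - p) ≤ Jinf m V y0 f0 := by
      rw [ENNReal.ofReal_sub b hp0, hpI]
      exact tsub_le_iff_left.2 hI
    have hJ2 : ENNReal.ofReal (b - p - d / 3) < Jinf m V y0 f0 := by
      refine lt_of_lt_of_le ?_ hJ
      rw [ENNReal.ofReal_lt_ofReal_iff (by linarith)]
      linarith
    rw [Jinf_eq_iSup, lt_iSup_iff] at hJ2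
    obtain ⟨c, hc⟩ := hJ2
    have hc' : b - p - d / 3 < Lc m V c y0 f0 := by
      by_contra hcon
      exact absurd (ENNReal.ofReal_le_ofReal (not_lt.1 hcon)) (not_le.2 hc)
    unfold Lc at hc'
    obtain ⟨r, hr, hev⟩ := ball_upper S y0 (p - d / 3) (by
      rcases lt_or_ge (p - d / 3) 0 with h | h
      · exact Or.inl h
      · right
        rw [← hpI, ENNReal.ofReal_lt_ofReal_iff (by linarith)]
        linarith)
    have hcAV := continuous_AV V G.cont_y c
    have hcSL := continuous_SL m c
    let U : Set CC := {y | (1/2) * ‖AV V c y‖ ^ 2 < (1/2) * ‖AV V c y0‖ ^ 2 + d / 6}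
    let V' : Set CC := {f | SL m c f0 - d / 6 < SL m c f}
    have hU : IsOpen U := isOpen_lt (by fun_prop) continuous_const
    have hV' : IsOpen V' := isOpen_lt continuous_const (by fun_prop)
    refine ⟨(U ∩ Metric.ball y0 r) ×ˢ V', (hU.inter Metric.isOpen_ball).prod hV',
      ⟨⟨?_, Metric.mem_ball_self hr⟩, ?_⟩, ?_⟩
    · show (1/2) * ‖AV V c y0‖ ^ 2 < (1/2) * ‖AV V c y0‖ ^ 2 + d / 6
      linarith
    · show SL m c f0 - d / 6 < SL m c f0
      linarith
    filter_upwards [hev, eventually_gt_atTop 0] with n hn hn0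
    refine (measure_mono Set.inter_subset_right).trans ?_
    refine (rect_le S n _ _ (hU.inter Metric.isOpen_ball).measurableSet hV'.measurableSet
      (ENNReal.ofReal (Real.exp (-(n * (b - p - 2 * d / 3))))) ?_).trans ?_
    · rintro y ⟨hyU, -⟩ hyα
      have hyU' : (1/2) * ‖AV V c y‖ ^ 2 < (1/2) * ‖AV V c y0‖ ^ 2 + d / 6 := hyU
      have h1 := half_space G hn0 hyα c (SL m c f0 - d / 6)
      refine (measure_mono ?_).trans (h1.trans (ENNReal.ofReal_le_ofReal (Real.exp_le_exp.2 ?_)))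
      · intro f hf
        exact le_of_lt (show SL m c f0 - d / 6 < SL m c f from hf)
      · have hn' : (0 : ℝ) < n := by exact_mod_cast hn0
        rw [neg_le_neg_iff]
        refine mul_le_mul_of_nonneg_left ?_ hn'.le
        linarith
    · have h2 : R n (U ∩ Metric.ball y0 r) ≤ ENNReal.ofReal (Real.exp (-(n * (p - d / 3)))) :=
        (measure_mono (Set.inter_subset_right.trans Metric.ball_subset_closedBall)).trans hn
      refine (mul_le_mul_right h2 _).trans (le_of_eq ?_)
      rw [← ENNReal.ofReal_mul (Real.exp_pos _).le, ← Real.exp_add, hd]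
      congr 2
      ring

lemma joint_upper [CompleteSpace H] (G : GSetup α m V C ν) (S : QSetup α ν R Q IY) :
    LDPUpper Q (fun n => (n : ℝ)) (IJ m V IY) := by
  have := S.probR
  have := S.probQ
  have := S.probν
  intro F hF
  rw [upper_iff _ S.probQ]
  intro a ha haI
  obtain ⟨b', hb1, hb2⟩ := ENNReal.lt_iff_exists_nnreal_btwn.1 haI
  set b : ℝ := (b' : ℝ) with hbdef
  have hbo : ENNReal.ofReal b = (b' : ℝ≥0∞) := ENNReal.ofReal_coe_nnreal
  have hab : a < b := by
    rw [← hbo] at hb1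
    exact (ENNReal.ofReal_lt_ofReal_iff_of_nonneg ha).1 hb1
  have hbF : ∀ p ∈ F, ENNReal.ofReal b ≤ IJ m V IY p := by
    intro p hp
    rw [hbo]
    exact (hb2.le).trans (iInf₂_le p hp)
  set a1 := (a + b) / 2 with ha1
  have haa1 : a < a1 := by rw [ha1]; linarith
  have ha1b : a1 < b := by rw [ha1]; linarith
  have ha10 : 0 ≤ a1 := by linarith
  have hKY : IsCompact {y | IY y ≤ (b' : ℝ≥0∞)} := S.good.2 b'
  set KY := {y | IY y ≤ (b' : ℝ≥0∞)} with hKYdef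
  obtain ⟨M0, hM0⟩ := hKY.isBounded.subset_ball (0 : CC)
  set M := max M0 1 with hMdef
  have hM : 0 < M := lt_of_lt_of_le one_pos (le_max_right _ _)
  have hKYM : KY ⊆ Metric.ball (0 : CC) M := hM0.trans (Metric.ball_subset_ball (le_max_left _ _))
  obtain ⟨K, hK, hKb⟩ := unif_tight G M b hM
  choose W hWo hWm hWb using fun p => local_upper G S F hF a1 b ha10 ha1b hbF p
  obtain ⟨t, -, ht⟩ := (hKY.prod hK).elim_nhds_subcover W fun p _ => (hWo p).mem_nhds (hWm p)
  obtain ⟨u, v, hu, hv, hKu, hKv, huv⟩ := generalized_tube_lemma hKY hK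
    (isOpen_biUnion fun p _ => hWo p) ht
  set u' := u ∩ Metric.ball (0 : CC) M with hu'
  have hu'o : IsOpen u' := hu.inter Metric.isOpen_ball
  have hKu' : KY ⊆ u' := Set.subset_inter hKu hKYM
  have hcover : F ⊆ (u'ᶜ ×ˢ Set.univ) ∪ ((u' ×ˢ Kᶜ) ∪ ⋃ p ∈ t, F ∩ W p) := by
    rintro ⟨y, f⟩ hyf
    by_cases h1 : y ∈ u'
    · right
      by_cases h2 : f ∈ K
      · right
        have : (y, f) ∈ ⋃ p ∈ t, W p := huv ⟨h1.1, hKv h2⟩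
        simp only [Set.mem_iUnion] at this ⊢
        obtain ⟨p, hp, hW⟩ := this
        exact ⟨p, hp, hyf, hW⟩
      · exact Or.inl ⟨h1, h2⟩
    · exact Or.inl ⟨h1, trivial⟩
  have hev1 : ∀ᶠ n : ℕ in atTop, R n u'ᶜ ≤ ENNReal.ofReal (Real.exp (-(n * a1))) := by
    refine (upper_iff R S.probR IY _).1 (S.upper _ hu'o.isClosed_compl) a1 ha10 ?_
    refine lt_of_lt_of_le (show ENNReal.ofReal a1 < ENNReal.ofReal b from ?_)
      (le_iInf₂ fun y hy => ?_)
    · rw [ENNReal.ofReal_lt_ofReal_iff (by linarith)]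
      exact ha1b
    · rw [hbo]
      by_contra hcon
      exact hy (hKu' (not_le.1 hcon).le)
  have hev2 : ∀ᶠ n : ℕ in atTop, ∀ p ∈ t, Q n (F ∩ W p) ≤
      ENNReal.ofReal (Real.exp (-(n * a1))) := by
    rw [Filter.eventually_all_finset]
    exact fun p _ => hWb p
  have hev3 : ∀ᶠ n : ℕ in atTop, (2 + t.card : ℝ) ≤ (n : ℝ) * (a1 - a) :=
    (tendsto_natCast_atTop_atTop.atTop_mul_const (by linarith)).eventually_ge_atTop _
  filter_upwards [hev1, hev2, hev3, eventually_gt_atTop 0] with n h1 h2 h3 hn0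
  have hn' : (0 : ℝ) < n := by exact_mod_cast hn0
  have e1 : Q n (u'ᶜ ×ˢ Set.univ) ≤ ENNReal.ofReal (Real.exp (-(n * a1))) := by
    refine (rect_le S n _ _ hu'o.measurableSet.compl MeasurableSet.univ 1
      (fun y _ _ => prob_le_one)).trans ?_
    rwa [one_mul]
  have e2 : Q n (u' ×ˢ Kᶜ) ≤ ENNReal.ofReal (Real.exp (-(n * a1))) := by
    refine (rect_le S n _ _ hu'o.measurableSet hK.isClosed.measurableSet.compl
      (ENNReal.ofReal (Real.exp (-(n * b)))) (fun y hy hyα => hKb n hn0 y hyα ?_)).trans ?_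
    · have := hy.2
      rw [mem_ball_zero_iff] at this
      exact this.le
    · refine (mul_le_mul_right prob_le_one _).trans ?_
      rw [mul_one]
      apply ENNReal.ofReal_le_ofReal
      apply Real.exp_le_exp.2
      rw [neg_le_neg_iff]
      gcongr
  have e3 : Q n (⋃ p ∈ t, F ∩ W p) ≤ t.card * ENNReal.ofReal (Real.exp (-(n * a1))) := by
    refine (measure_biUnion_finset_le _ _).trans ((Finset.sum_le_sum h2).trans ?_)
    rw [Finset.sum_const, nsmul_eq_mul]
  refine (measure_mono hcover).trans ((measure_union_le _ _).trans
    ((add_le_add e1 ((measure_union_le _ _).trans (add_le_add e2 e3))).trans ?_))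
  rw [← ENNReal.ofReal_natCast, ← ENNReal.ofReal_mul (by positivity),
    ← ENNReal.ofReal_add (by positivity) (by positivity),
    ← ENNReal.ofReal_add (by positivity) (by positivity)]
  apply ENNReal.ofReal_le_ofReal
  have h5 : (2 + t.card : ℝ) ≤ Real.exp (n * (a1 - a)) := by
    have := Real.add_one_le_exp ((n : ℝ) * (a1 - a))
    linarith
  calc Real.exp (-(n * a1)) + (Real.exp (-(n * a1)) + t.card * Real.exp (-(n * a1)))
      = (2 + t.card : ℝ) * Real.exp (-(n * a1)) := by ring
    _ ≤ Real.exp (n * (a1 - a)) * Real.exp (-(n * a1)) := by gcongr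
    _ = Real.exp (-(n * a)) := by rw [← Real.exp_add]; ring_nf

lemma lsc_IJ [CompleteSpace H] (G : GSetup α m V C ν) (S : QSetup α ν R Q IY) :
    LowerSemicontinuous (IJ m V IY) := by
  unfold IJ
  exact LowerSemicontinuous.add (LowerSemicontinuous.comp S.good.1 continuous_fst)
    (lsc_Jinf m V G.cont_y)

/-- Rate function of the second marginal. -/
lemma lsc_IZ [CompleteSpace H] (G : GSetup α m V C ν) (S : QSetup α ν R Q IY) :
    LowerSemicontinuous fun f => ⨅ y ∈ Calpha α, IJ m V IY (y, f) := by
  intro f0 a ha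
  obtain ⟨b', hb1, hb2⟩ := ENNReal.lt_iff_exists_nnreal_btwn.1 ha
  have hK : IsCompact {y | IY y ≤ (b' : ℝ≥0∞)} := S.good.2 b'
  have hopen : IsOpen {p : CC × CC | (b' : ℝ≥0∞) < IJ m V IY p} :=
    (lsc_IJ G S).isOpen_preimage _
  have hsub : {y | IY y ≤ (b' : ℝ≥0∞)} ×ˢ {f0} ⊆ {p : CC × CC | (b' : ℝ≥0∞) < IJ m V IY p} := by
    rintro ⟨y, f⟩ ⟨hy, hf⟩
    obtain rfl : f = f0 := hf
    have hy' : IY y ≤ (b' : ℝ≥0∞) := hy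
    have hyα : y ∈ Calpha α := by
      by_contra h
      rw [S.suppI y h] at hy'
      simp at hy'
    exact lt_of_lt_of_le hb2 (iInf₂_le y hyα)
  obtain ⟨u, v, hu, hv, hKu, hfv, huv⟩ := generalized_tube_lemma hK isCompact_singleton hopen hsub
  filter_upwards [hv.mem_nhds (hfv rfl)] with f hf
  refine lt_of_lt_of_le hb1 (le_iInf₂ fun y _ => ?_)
  by_cases hy : y ∈ u
  · have : (b' : ℝ≥0∞) < IJ m V IY (y, f) := huv (show (y, f) ∈ u ×ˢ v from ⟨hy, hf⟩)
    exact this.le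
  · have : ¬ IY y ≤ (b' : ℝ≥0∞) := fun h => hy (hKu h)
    exact (not_le.1 this).le.trans le_self_add

lemma IZ_eq (S : QSetup α ν R Q IY) (f : CC) :
    (⨅ y ∈ Calpha α, IJ m V IY (y, f)) = ⨅ y, IJ m V IY (y, f) := by
  refine iInf_congr fun y => ?_
  by_cases hy : y ∈ Calpha α
  · simp [hy]
  · simp [hy, IJ, S.suppI y hy]

lemma ldp_Z [CompleteSpace H] (G : GSetup α m V C ν) (S : QSetup α ν R Q IY) :
    LDP (fun n => (Q n).map Prod.snd) (fun n => (n : ℝ))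
      (fun f => ⨅ y ∈ Calpha α, IJ m V IY (y, f)) := by
  have := S.probQ
  have hpre : ∀ B : Set CC, Prod.snd ⁻¹' B = (Set.univ : Set CC) ×ˢ B := fun B => by
    ext p; simp
  refine ⟨lsc_IZ G S, ?_, ?_⟩
  · intro Θ hΘ
    rw [lower_iff]
    intro f hf hfin ε hε
    rw [IZ_eq S] at hfin
    simp only [IZ_eq S]
    have hlt : (⨅ y, IJ m V IY (y, f)) <
        ENNReal.ofReal ((⨅ y, IJ m V IY (y, f)).toReal + ε / 2) := by
      rw [ENNReal.lt_ofReal_iff_toReal_lt hfin]; linarith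
    obtain ⟨y, hy⟩ := iInf_lt_iff.1 hlt
    have hyfin : IJ m V IY (y, f) ≠ ⊤ := hy.ne_top
    have hyle := (ENNReal.lt_ofReal_iff_toReal_lt hyfin).1 hy
    have h1 := (lower_iff Q (IJ m V IY) (Set.univ ×ˢ Θ)).1
      (joint_lower G S _ (isOpen_univ.prod hΘ)) (y, f) ⟨trivial, hf⟩ hyfin (ε / 2) (half_pos hε)
    filter_upwards [h1] with n hn
    rw [Measure.map_apply measurable_snd hΘ.measurableSet, hpre]
    refine le_trans (ENNReal.ofReal_le_ofReal (Real.exp_le_exp.2 ?_)) hn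
    rw [neg_le_neg_iff]
    refine mul_le_mul_of_nonneg_left ?_ (by positivity)
    linarith
  · intro Γ hΓ
    rw [upper_iff _ (fun n => Measure.isProbabilityMeasure_map measurable_snd.aemeasurable)]
    intro a ha haI
    have h1 := (upper_iff Q S.probQ (IJ m V IY) (Set.univ ×ˢ Γ)).1
      (joint_upper G S _ (isClosed_univ.prod hΓ)) a ha (by
        refine lt_of_lt_of_le haI (le_iInf₂ ?_)
        rintro ⟨y, f⟩ ⟨-, hf⟩
        refine (iInf₂_le f hf).trans ?_
        rw [IZ_eq S]
        exact iInf_le _ y)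
    filter_upwards [h1] with n hn
    rwa [Measure.map_apply measurable_snd hΓ.measurableSet, hpre]

end Assemble

/-! ### Variation of constants -/

lemma voc_E (a1 : ℝ) (g : ℝ → ℝ) (hg : IntervalIntegrable g volume 0 1) (t : ℝ)
    (ht : t ∈ Set.Icc (0:ℝ) 1) :
    ∫ s in (0:ℝ)..t, a1 * (∫ u in (0:ℝ)..s, Real.exp (a1 * (s - u)) * g u) =
      (∫ u in (0:ℝ)..t, Real.exp (a1 * (t - u)) * g u) - ∫ u in (0:ℝ)..t, g u := by
  have hsub : Set.uIcc (0:ℝ) t ⊆ Set.uIcc (0:ℝ) 1 := by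
    rw [Set.uIcc_of_le ht.1, Set.uIcc_of_le zero_le_one]
    exact Set.Icc_subset_Icc_right ht.2
  have hgt : IntervalIntegrable g volume 0 t := hg.mono_set hsub
  set r : ℝ → ℝ := fun u => Real.exp (-(a1 * u)) * g u with hr
  have hrt : IntervalIntegrable r volume 0 t :=
    hgt.continuousOn_mul (by fun_prop)
  have hE : ∀ s, (∫ u in (0:ℝ)..s, Real.exp (a1 * (s - u)) * g u) =
      Real.exp (a1 * s) * ∫ u in (0:ℝ)..s, r u := by
    intro s
    rw [← intervalIntegral.integral_const_mul]
    refine intervalIntegral.integral_congr fun u _ => ?_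
    simp only [hr]
    rw [← mul_assoc, ← Real.exp_add]
    ring_nf
  have hac1 : AbsolutelyContinuousOnInterval (fun s => Real.exp (a1 * s)) 0 t := by
    apply ContDiffOn.absolutelyContinuousOnInterval
    fun_prop
  have hac2 : AbsolutelyContinuousOnInterval (fun s => ∫ u in (0:ℝ)..s, r u) 0 t :=
    hrt.absolutelyContinuousOnInterval_intervalIntegral Set.left_mem_uIcc
  have hparts := hac1.integral_mul_deriv_eq_deriv_mul hac2
  have hd1 : ∀ s, deriv (fun s => Real.exp (a1 * s)) s = a1 * Real.exp (a1 * s) := by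
    intro s
    have : HasDerivAt (fun s => Real.exp (a1 * s)) (Real.exp (a1 * s) * (a1 * 1)) s :=
      ((hasDerivAt_id s).const_mul a1).exp
    rw [this.deriv]; ring
  have h1 : ∫ s in (0:ℝ)..t, Real.exp (a1 * s) * deriv (fun s => ∫ u in (0:ℝ)..s, r u) s =
      ∫ u in (0:ℝ)..t, g u := by
    apply intervalIntegral.integral_congr_ae
    filter_upwards [hrt.ae_hasDerivAt_integral] with s hs hs'
    rw [(hs (Set.uIoc_subset_uIcc hs') 0 Set.left_mem_uIcc).deriv]
    simp only [hr]
    rw [← mul_assoc, ← Real.exp_add]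
    simp
  rw [h1] at hparts
  simp only [hd1, intervalIntegral.integral_same, mul_zero, sub_zero] at hparts
  simp only [hE]
  rw [hparts]
  simp only [sub_sub_cancel, mul_assoc]

lemma ode_unique (a1 : ℝ) (D : ℝ → ℝ) (hD : IntervalIntegrable D volume 0 1)
    (h : ∀ t ∈ Set.Icc (0:ℝ) 1, D t = a1 * ∫ s in (0:ℝ)..t, D s) (t : ℝ)
    (ht : t ∈ Set.Icc (0:ℝ) 1) : D t = 0 := by
  have hsub : Set.uIcc (0:ℝ) t ⊆ Set.uIcc (0:ℝ) 1 := by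
    rw [Set.uIcc_of_le ht.1, Set.uIcc_of_le zero_le_one]
    exact Set.Icc_subset_Icc_right ht.2
  have hDt : IntervalIntegrable D volume 0 t := hD.mono_set hsub
  have hac1 : AbsolutelyContinuousOnInterval (fun s => Real.exp (-a1 * s)) 0 t := by
    apply ContDiffOn.absolutelyContinuousOnInterval
    fun_prop
  have hac2 : AbsolutelyContinuousOnInterval (fun s => ∫ u in (0:ℝ)..s, D u) 0 t :=
    hDt.absolutelyContinuousOnInterval_intervalIntegral Set.left_mem_uIcc
  have hd1 : ∀ s, deriv (fun s => Real.exp (-a1 * s)) s = -a1 * Real.exp (-a1 * s) := by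
    intro s
    have : HasDerivAt (fun s => Real.exp (-a1 * s)) (Real.exp (-a1 * s) * (-a1 * 1)) s :=
      ((hasDerivAt_id s).const_mul (-a1)).exp
    rw [this.deriv]; ring
  have hmain := hac1.integral_deriv_mul_eq_sub hac2
  have h0 : ∫ s in (0:ℝ)..t, (deriv (fun s => Real.exp (-a1 * s)) s * (∫ u in (0:ℝ)..s, D u) +
      Real.exp (-a1 * s) * deriv (fun s => ∫ u in (0:ℝ)..s, D u) s) = 0 := by
    refine (intervalIntegral.integral_congr_ae (g := fun _ => 0) ?_).trans
      intervalIntegral.integral_zero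
    filter_upwards [hDt.ae_hasDerivAt_integral] with s hs hs'
    have hs2 := Set.uIoc_subset_uIcc hs'
    have hs3 : s ∈ Set.Icc (0:ℝ) 1 := by
      have := hsub hs2
      rwa [Set.uIcc_of_le zero_le_one] at this
    rw [(hs hs2 0 Set.left_mem_uIcc).deriv, hd1, h s hs3]
    ring
  rw [h0] at hmain
  simp only [intervalIntegral.integral_same, mul_zero, sub_zero] at hmain
  rw [h t ht, (mul_eq_zero.1 hmain.symm).resolve_left (Real.exp_pos _).ne', mul_zero]

lemma voc_m (a0 a1 x : ℝ) (ha1 : a1 ≠ 0) (t : ℝ) :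
    ∫ s in (0:ℝ)..t, (a0 + a1 * (Real.exp (a1 * s) * (x + a0 / a1 * (1 - Real.exp (-(a1 * s)))))) =
      Real.exp (a1 * t) * (x + a0 / a1 * (1 - Real.exp (-(a1 * t)))) - x := by
  have hd : ∀ s : ℝ, HasDerivAt
      (fun s => Real.exp (a1 * s) * (x + a0 / a1 * (1 - Real.exp (-(a1 * s)))))
      (a0 + a1 * (Real.exp (a1 * s) * (x + a0 / a1 * (1 - Real.exp (-(a1 * s)))))) s := by
    intro s
    have h1 : HasDerivAt (fun s => Real.exp (a1 * s)) (Real.exp (a1 * s) * (a1 * 1)) s :=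
      ((hasDerivAt_id s).const_mul a1).exp
    have h2 : HasDerivAt (fun s => Real.exp (-(a1 * s))) (Real.exp (-(a1 * s)) * (-(a1 * 1))) s :=
      (((hasDerivAt_id s).const_mul a1).neg).exp
    have h3 := h1.mul (((h2.const_sub 1).const_mul (a0 / a1)).const_add x)
    refine h3.congr_deriv ?_
    have he : Real.exp (a1 * s) * Real.exp (-(a1 * s)) = 1 := by
      rw [← Real.exp_add]; simp
    field_simp
    linear_combination a0 * he
  rw [intervalIntegral.integral_eq_sub_of_hasDerivAt (fun s _ => hd s)]
  · simp
  · exact Continuous.intervalIntegrable (by fun_prop) _ _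

/-- Variation of constants formula with an integrable forcing. -/
lemma ode_iff (a0 a1 x : ℝ) (ha1 : a1 ≠ 0) (F : ℝ → ℝ) (hF : Continuous F) (g : ℝ → ℝ)
    (hg : IntervalIntegrable g volume 0 1) :
    (∀ t ∈ Set.Icc (0:ℝ) 1, F t = x + ∫ s in (0:ℝ)..t, (a0 + a1 * F s + g s)) ↔
    ∀ t ∈ Set.Icc (0:ℝ) 1, F t = Real.exp (a1 * t) * (x + a0 / a1 * (1 - Real.exp (-(a1 * t)))) +
      ∫ u in (0:ℝ)..t, Real.exp (a1 * (t - u)) * g u := by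
  set M : ℝ → ℝ := fun t => Real.exp (a1 * t) * (x + a0 / a1 * (1 - Real.exp (-(a1 * t)))) with hM
  set E : ℝ → ℝ := fun t => ∫ u in (0:ℝ)..t, Real.exp (a1 * (t - u)) * g u with hE
  have hMc : Continuous M := by simp only [hM]; fun_prop
  have hsub : ∀ t ∈ Set.Icc (0:ℝ) 1, Set.uIcc (0:ℝ) t ⊆ Set.uIcc (0:ℝ) 1 := by
    intro t ht
    rw [Set.uIcc_of_le ht.1, Set.uIcc_of_le zero_le_one]
    exact Set.Icc_subset_Icc_right ht.2
  have hEI : IntervalIntegrable E volume 0 1 := by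
    have hr : IntervalIntegrable (fun u => Real.exp (-(a1 * u)) * g u) volume 0 1 :=
      hg.continuousOn_mul (by fun_prop)
    have : E = fun s => Real.exp (a1 * s) * ∫ u in (0:ℝ)..s, Real.exp (-(a1 * u)) * g u := by
      funext s
      simp only [hE]
      rw [← intervalIntegral.integral_const_mul]
      refine intervalIntegral.integral_congr fun u _ => ?_
      rw [← mul_assoc, ← Real.exp_add]
      ring_nf
    rw [this]
    refine ContinuousOn.intervalIntegrable (ContinuousOn.mul (by fun_prop) ?_)
    exact intervalIntegral.continuousOn_primitive_interval' hr Set.left_mem_uIcc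
  have hsol : ∀ t ∈ Set.Icc (0:ℝ) 1,
      M t + E t = x + ∫ s in (0:ℝ)..t, (a0 + a1 * (M s + E s) + g s) := by
    intro t ht
    have hgt := hg.mono_set (hsub t ht)
    have hEt := (hEI.mono_set (hsub t ht)).const_mul a1
    have hMt : IntervalIntegrable (fun s => a0 + a1 * M s) volume 0 t :=
      Continuous.intervalIntegrable (by fun_prop) _ _
    have : (fun s => a0 + a1 * (M s + E s) + g s) = fun s => (a0 + a1 * M s) + a1 * E s + g s := by
      funext s; ring
    rw [this, intervalIntegral.integral_add (hMt.add hEt) hgt, intervalIntegral.integral_add hMt hEt,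
      voc_m a0 a1 x ha1, voc_E a1 g hg t ht]
    simp only [hM, hE]
    ring
  constructor
  · intro h t ht
    have hD := ode_unique a1 (fun t => F t - (M t + E t))
      ((hF.intervalIntegrable _ _).sub ((hMc.intervalIntegrable _ _).add hEI)) (by
        intro t ht
        have hgt := hg.mono_set (hsub t ht)
        have hEt := hEI.mono_set (hsub t ht)
        have hFt : IntervalIntegrable F volume 0 t := hF.intervalIntegrable _ _
        have hMt : IntervalIntegrable M volume 0 t := hMc.intervalIntegrable _ _
        have hc : IntervalIntegrable (fun _ : ℝ => a0) volume 0 t := intervalIntegrable_const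
        rw [h t ht, hsol t ht, add_sub_add_left_eq_sub, ← intervalIntegral.integral_sub,
          ← intervalIntegral.integral_const_mul]
        · refine intervalIntegral.integral_congr fun s _ => ?_
          ring
        · exact (hc.add (hFt.const_mul a1)).add hgt
        · exact (hc.add ((hMt.add hEt).const_mul a1)).add hgt) t ht
    linarith
  · intro h t ht
    rw [h t ht, hsol t ht]
    congr 1
    refine intervalIntegral.integral_congr fun s hs => ?_
    have hs' := hsub t ht hs
    rw [Set.uIcc_of_le zero_le_one] at hs'
    rw [h s hs']

/-! ### The feature map in `L²` -/

/-- Lebesgue measure on `[0,1]`. -/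
abbrev leb : Measure ℝ := volume.restrict (Set.Icc (0:ℝ) 1)

/-- The Hilbert space `L²[0,1]`. -/
abbrev HH : Type := Lp ℝ 2 leb

/-- Extension of a continuous function by constants. -/
abbrev iext (y : CC) : ℝ → ℝ := Set.IccExtend zero_le_one (⇑y)

lemma continuous_iext (y : CC) : Continuous (iext y) := y.continuous.Icc_extend'

lemma abs_iext_le (y : CC) (u : ℝ) : |iext y u| ≤ ‖y‖ := by
  have := y.norm_coe_le_norm (Set.projIcc 0 1 zero_le_one u)
  simpa [iext, Set.IccExtend] using this

lemma iext_coe (y : CC) (t : UI) : iext y t = y t := by simp [iext]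

/-- The kernel `1_{u ≤ t} e^{a₁(t-u)} y(u)`. -/
def vfun (a1 : ℝ) (y : CC) (t : UI) : ℝ → ℝ :=
  Set.indicator (Set.Ioc (0:ℝ) t) fun u => Real.exp (a1 * (t - u)) * iext y u

lemma measurable_vfun (a1 : ℝ) (y : CC) (t : UI) : Measurable (vfun a1 y t) := by
  have := continuous_iext y
  refine Measurable.indicator (Continuous.measurable ?_) measurableSet_Ioc
  fun_prop

lemma exp_le_B (a1 : ℝ) (t u : ℝ) (ht : t ≤ 1) (hu : 0 ≤ u) (hut : u ≤ t) :
    Real.exp (a1 * (t - u)) ≤ Real.exp |a1| := by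
  apply Real.exp_le_exp.2
  calc a1 * (t - u) ≤ |a1| * (t - u) := mul_le_mul_of_nonneg_right (le_abs_self _) (by linarith)
    _ ≤ |a1| * 1 := mul_le_mul_of_nonneg_left (by linarith) (abs_nonneg _)
    _ = |a1| := mul_one _

lemma abs_vfun_le (a1 : ℝ) (y : CC) (t : UI) (u : ℝ) :
    |vfun a1 y t u| ≤ Real.exp |a1| * ‖y‖ := by
  unfold vfun
  by_cases h : u ∈ Set.Ioc (0:ℝ) t
  · rw [Set.indicator_of_mem h, abs_mul, Real.abs_exp]
    exact mul_le_mul (exp_le_B a1 t u t.2.2 h.1.le h.2) (abs_iext_le y u) (abs_nonneg _)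
      (Real.exp_pos _).le
  · rw [Set.indicator_of_notMem h, abs_zero]
    positivity

lemma memLp_vfun (a1 : ℝ) (y : CC) (t : UI) : MemLp (vfun a1 y t) 2 leb :=
  MemLp.of_bound (measurable_vfun a1 y t).aestronglyMeasurable (Real.exp |a1| * ‖y‖)
    (Eventually.of_forall fun u => abs_vfun_le a1 y t u)

/-- The feature map. -/
def VV (a1 : ℝ) (y : CC) (t : UI) : HH := (memLp_vfun a1 y t).toLp _

lemma inner_toLp (ψ : HH) (f : ℝ → ℝ) (hf : MemLp f 2 leb) :
    inner ℝ ψ (hf.toLp f) = ∫ u, ψ u * f u ∂leb := by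
  rw [L2.inner_def]
  refine integral_congr_ae ?_
  filter_upwards [hf.coeFn_toLp] with u hu
  rw [hu]
  simp [mul_comm]

lemma norm_sq_toLp (f : ℝ → ℝ) (hf : MemLp f 2 leb) :
    ‖hf.toLp f‖ ^ 2 = ∫ u, f u ^ 2 ∂leb := by
  rw [← real_inner_self_eq_norm_sq, inner_toLp]
  refine integral_congr_ae ?_
  filter_upwards [hf.coeFn_toLp] with u hu
  rw [hu, sq]

lemma integral_leb_indicator (t : ℝ) (ht : t ∈ Set.Icc (0:ℝ) 1) (h : ℝ → ℝ) :
    ∫ u, (Set.Ioc (0:ℝ) t).indicator h u ∂leb = ∫ u in (0:ℝ)..t, h u := by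
  rw [integral_indicator measurableSet_Ioc, Measure.restrict_restrict measurableSet_Ioc,
    intervalIntegral.integral_of_le ht.1]
  congr 2
  apply Set.inter_eq_left.2
  exact fun u hu => ⟨hu.1.le, hu.2.trans ht.2⟩

lemma inner_VV (a1 : ℝ) (y : CC) (t : UI) (ψ : HH) :
    inner ℝ ψ (VV a1 y t) = ∫ u in (0:ℝ)..t, Real.exp (a1 * (t - u)) * (iext y u * ψ u) := by
  unfold VV
  rw [inner_toLp, ← integral_leb_indicator t t.2]
  refine integral_congr_ae (Eventually.of_forall fun u => ?_)
  simp only [vfun]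
  by_cases h : u ∈ Set.Ioc (0:ℝ) t
  · simp only [Set.indicator_of_mem h]; ring
  · simp only [Set.indicator_of_notMem h]; ring

lemma inner_VV_VV (a1 : ℝ) (y : CC) (s t : UI) :
    inner ℝ (VV a1 y s) (VV a1 y t) = kyFun a1 y s t := by
  have hmin : min (s : ℝ) t ∈ Set.Icc (0:ℝ) 1 := ⟨le_min s.2.1 t.2.1, (min_le_left _ _).trans s.2.2⟩
  have : inner ℝ (VV a1 y s) (VV a1 y t) = ∫ u, vfun a1 y s u * vfun a1 y t u ∂leb := by
    conv_lhs => rw [VV, VV]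
    rw [inner_toLp]
    refine integral_congr_ae ?_
    filter_upwards [(memLp_vfun a1 y s).coeFn_toLp] with u hu
    rw [hu]
  rw [this, kyFun, ← intervalIntegral.integral_const_mul, ← integral_leb_indicator _ hmin]
  refine integral_congr_ae (Eventually.of_forall fun u => ?_)
  simp only [vfun]
  by_cases h1 : u ∈ Set.Ioc (0:ℝ) s
  · by_cases h2 : u ∈ Set.Ioc (0:ℝ) t
    · have h3 : u ∈ Set.Ioc (0:ℝ) (min (s : ℝ) t) := ⟨h1.1, le_min h1.2 h2.2⟩
      simp only [Set.indicator_of_mem h1, Set.indicator_of_mem h2, Set.indicator_of_mem h3]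
      have : Real.exp (a1 * (s - u)) * Real.exp (a1 * (t - u)) =
          Real.exp (a1 * ((s : ℝ) + t)) * Real.exp (-(2 * a1 * u)) := by
        rw [← Real.exp_add, ← Real.exp_add]; ring_nf
      linear_combination (iext y u) ^ 2 * this
    · have h3 : u ∉ Set.Ioc (0:ℝ) (min (s : ℝ) t) := fun h => h2 ⟨h.1, h.2.trans (min_le_right _ _)⟩
      simp only [Set.indicator_of_notMem h2, Set.indicator_of_notMem h3, mul_zero]
  · have h3 : u ∉ Set.Ioc (0:ℝ) (min (s : ℝ) t) := fun h => h1 ⟨h.1, h.2.trans (min_le_left _ _)⟩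
    simp only [Set.indicator_of_notMem h1, Set.indicator_of_notMem h3, zero_mul]

lemma norm_toLp_le (f : ℝ → ℝ) (hf : MemLp f 2 leb) (B : ℝ) (hB : 0 ≤ B) (h : ∀ u, |f u| ≤ B) :
    ‖hf.toLp f‖ ≤ B := by
  have h1 := Lp.norm_le_of_ae_bound (f := hf.toLp f) hB (by
    filter_upwards [hf.coeFn_toLp] with u hu
    rw [hu]; exact h u)
  have h2 : measureUnivNNReal leb = 1 := by
    simp [measureUnivNNReal]
  rw [h2] at h1
  simpa using h1

lemma VV_bdd (a1 : ℝ) (y : CC) (t : UI) : ‖VV a1 y t‖ ≤ Real.exp |a1| * ‖y‖ :=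
  norm_toLp_le _ _ _ (by positivity) (abs_vfun_le a1 y t)

lemma VV_sub (a1 : ℝ) (y y' : CC) (t : UI) : VV a1 y t - VV a1 y' t = VV a1 (y - y') t := by
  unfold VV
  rw [← MemLp.toLp_sub]
  refine MemLp.toLp_congr _ _ (Eventually.of_forall fun u => ?_)
  simp only [vfun, Pi.sub_apply]
  by_cases h : u ∈ Set.Ioc (0:ℝ) t
  · simp only [Set.indicator_of_mem h, iext, Set.IccExtend, Function.comp_apply,
      ContinuousMap.sub_apply]
    ring
  · simp only [Set.indicator_of_notMem h, sub_zero]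

lemma VV_zero (a1 : ℝ) (y : CC) : VV a1 y 0 = 0 := by
  unfold VV
  rw [← MemLp.toLp_zero (MemLp.zero (p := 2) (μ := leb) (ε := ℝ))]
  refine MemLp.toLp_congr _ _ (Eventually.of_forall fun u => ?_)
  simp [vfun]

lemma exp_sub_exp_le (a1 s t u : ℝ) (hst : s ≤ t) (ht : t ≤ 1) (hu : 0 ≤ u) (hus : u ≤ s) :
    |Real.exp (a1 * (t - u)) - Real.exp (a1 * (s - u))| ≤ Real.exp |a1| * (|a1| * (t - s)) := by
  have h := Convex.norm_image_sub_le_of_norm_hasDerivWithin_le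
    (f := fun r => Real.exp (a1 * (r - u))) (f' := fun r => Real.exp (a1 * (r - u)) * (a1 * 1))
    (s := Set.Icc s t) (x := s) (y := t) (C := Real.exp |a1| * |a1|)
    (fun r _ => ((((hasDerivAt_id r).sub_const u).const_mul a1).exp).hasDerivWithinAt)
    (fun r hr => by
      rw [mul_one, norm_mul, Real.norm_eq_abs, Real.abs_exp, Real.norm_eq_abs]
      exact mul_le_mul_of_nonneg_right (exp_le_B a1 r u (hr.2.trans ht) hu (hus.trans hr.1))
        (abs_nonneg _))
    (convex_Icc s t) (Set.left_mem_Icc.2 hst) (Set.right_mem_Icc.2 hst)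
  rw [Real.norm_eq_abs, Real.norm_eq_abs, abs_of_nonneg (sub_nonneg.2 hst)] at h
  linarith

lemma VV_inc_aux (a1 : ℝ) (y : CC) (s t : UI) (hst : s ≤ t) :
    ‖VV a1 y t - VV a1 y s‖ ^ 2 ≤
      (Real.exp |a1| ^ 2 * (|a1| ^ 2 + 1)) * ‖y‖ ^ 2 * |(t : ℝ) - s| := by
  have hst' : (s : ℝ) ≤ t := hst
  set K := Real.exp |a1| ^ 2 * ‖y‖ ^ 2 with hK
  have hts1 : (t : ℝ) - s ≤ 1 := by have := t.2.2; have := s.2.1; linarith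
  unfold VV
  rw [← MemLp.toLp_sub, norm_sq_toLp, abs_of_nonneg (sub_nonneg.2 hst')]
  have hpt : ∀ u, ((vfun a1 y t - vfun a1 y s) u) ^ 2 ≤
      K * |a1| ^ 2 * (t - s) + (Set.Ioc (s : ℝ) t).indicator (fun _ => K) u := by
    intro u
    have hyy : (iext y u) ^ 2 ≤ ‖y‖ ^ 2 := by
      rw [← sq_abs]; exact pow_le_pow_left₀ (abs_nonneg _) (abs_iext_le y u) 2
    have hnn : 0 ≤ K * |a1| ^ 2 * ((t : ℝ) - s) := by
      have := sub_nonneg.2 hst'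
      positivity
    simp only [Pi.sub_apply, vfun]
    by_cases h1 : u ∈ Set.Ioc (0:ℝ) s
    · have h2 : u ∈ Set.Ioc (0:ℝ) t := ⟨h1.1, h1.2.trans hst'⟩
      have h3 : u ∉ Set.Ioc (s:ℝ) t := fun h => absurd h1.2 (not_le.2 h.1)
      rw [Set.indicator_of_mem h1, Set.indicator_of_mem h2, Set.indicator_of_notMem h3, add_zero,
        ← sub_mul, mul_pow]
      have h4 := exp_sub_exp_le a1 s t u hst' t.2.2 h1.1.le h1.2
      have h5 : (Real.exp (a1 * (t - u)) - Real.exp (a1 * (s - u))) ^ 2 ≤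
          (Real.exp |a1| * (|a1| * ((t : ℝ) - s))) ^ 2 := by
        rw [← sq_abs]; exact pow_le_pow_left₀ (abs_nonneg _) h4 2
      calc _ ≤ (Real.exp |a1| * (|a1| * ((t : ℝ) - s))) ^ 2 * ‖y‖ ^ 2 := by gcongr
        _ = K * |a1| ^ 2 * (((t : ℝ) - s) * (t - s)) := by rw [hK]; ring
        _ ≤ K * |a1| ^ 2 * (((t : ℝ) - s) * 1) := by
          gcongr
        _ = _ := by ring
    · rw [Set.indicator_of_notMem h1, sub_zero]
      by_cases h2 : u ∈ Set.Ioc (0:ℝ) t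
      · have h3 : u ∈ Set.Ioc (s:ℝ) t := by
          refine ⟨?_, h2.2⟩
          by_contra hc
          exact h1 ⟨h2.1, not_lt.1 hc⟩
        rw [Set.indicator_of_mem h2, Set.indicator_of_mem h3, mul_pow]
        have h6 := exp_le_B a1 t u t.2.2 h2.1.le h2.2
        have : Real.exp (a1 * (t - u)) ^ 2 * iext y u ^ 2 ≤ K := by
          rw [hK]; gcongr
        linarith
      · rw [Set.indicator_of_notMem h2]
        have : 0 ≤ (Set.Ioc (s : ℝ) t).indicator (fun _ => K) u :=
          Set.indicator_nonneg (fun _ _ => by positivity) _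
        simp only [ne_eq, OfNat.ofNat_ne_zero, not_false_eq_true, zero_pow]
        linarith
  have hi2 : Integrable ((Set.Ioc (s : ℝ) t).indicator fun _ => K) leb :=
    (integrable_const K).indicator measurableSet_Ioc
  have hi1 : Integrable (fun _ : ℝ => K * |a1| ^ 2 * ((t : ℝ) - s)) leb := integrable_const _
  calc ∫ u, ((vfun a1 y t - vfun a1 y s) u) ^ 2 ∂leb
      ≤ ∫ u, (K * |a1| ^ 2 * ((t : ℝ) - s) + (Set.Ioc (s : ℝ) t).indicator (fun _ => K) u) ∂leb :=
        integral_mono (((memLp_vfun a1 y t).sub (memLp_vfun a1 y s)).integrable_sq)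
          (hi1.add hi2) hpt
    _ = K * |a1| ^ 2 * ((t : ℝ) - s) + ∫ u in Set.Ioc (s : ℝ) t, K ∂leb := by
        rw [integral_add hi1 hi2, integral_indicator measurableSet_Ioc]
        simp
    _ = K * |a1| ^ 2 * ((t : ℝ) - s) + K * (t - s) := by
        have hss : Set.Ioc (s : ℝ) t ⊆ Set.Icc 0 1 :=
          fun u hu => ⟨s.2.1.trans hu.1.le, hu.2.trans t.2.2⟩
        rw [Measure.restrict_restrict measurableSet_Ioc, Set.inter_eq_left.2 hss,
          setIntegral_const]
        simp [Measure.real, ENNReal.toReal_ofReal (sub_nonneg.2 hst'), mul_comm]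
    _ = _ := by rw [hK]; ring

lemma VV_inc (a1 : ℝ) (y : CC) (s t : UI) :
    ‖VV a1 y t - VV a1 y s‖ ^ 2 ≤
      (Real.exp |a1| ^ 2 * (|a1| ^ 2 + 1)) * ‖y‖ ^ 2 * |(t : ℝ) - s| := by
  rcases le_total s t with h | h
  · exact VV_inc_aux a1 y s t h
  · rw [norm_sub_rev, abs_sub_comm]
    exact VV_inc_aux a1 y t s h

/-! ### The Freidlin-Wentzell functional -/

/-- The mean function as a continuous function. -/
def mCC (a0 a1 x : ℝ) : CC := ⟨mFun a0 a1 x, by unfold mFun; fun_prop⟩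

lemma intervalIntegrable_of_memLp (g : ℝ → ℝ) (hg : MemLp g 2 leb) :
    IntervalIntegrable g volume 0 1 := by
  rw [intervalIntegrable_iff_integrableOn_Icc_of_le zero_le_one]
  exact hg.integrable (by norm_num)

lemma memLp_mul_bdd (g h : ℝ → ℝ) (hg : MemLp g 2 leb) (hh : Measurable h) (B : ℝ)
    (hB : ∀ u, |h u| ≤ B) : MemLp (fun u => h u * g u) 2 leb := by
  refine MemLp.of_le_mul (c := B) hg (hh.aestronglyMeasurable.mul hg.1)
    (Eventually.of_forall fun u => ?_)
  rw [norm_mul]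
  exact mul_le_mul_of_nonneg_right (hB u) (norm_nonneg _)

lemma memLp_bdd (h : ℝ → ℝ) (hh : Measurable h) (B : ℝ)
    (hB : ∀ u, |h u| ≤ B) : MemLp h 2 leb :=
  MemLp.of_bound hh.aestronglyMeasurable B (Eventually.of_forall hB)

lemma le_iext {α : ℝ} {y : CC} (hy : y ∈ Calpha α) (u : ℝ) : α ≤ iext y u := by
  have h : ∀ t, α ≤ y t := hy
  exact h _

lemma integral_leb (h : ℝ → ℝ) : ∫ u, h u ∂leb = ∫ u in (0:ℝ)..1, h u := by
  rw [intervalIntegral.integral_of_le zero_le_one, integral_Icc_eq_integral_Ioc]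

lemma cond_iff (a0 a1 x : ℝ) (ha1 : a1 ≠ 0) (y f : CC) (ψ : HH) :
    (∀ t : UI, f t = x + ∫ s in (0:ℝ)..(t : ℝ), (a0 + a1 * iext f s + iext y s * ψ s)) ↔
      ∀ t : UI, f t = mCC a0 a1 x t + inner ℝ ψ (VV a1 y t) := by
  have hg : IntervalIntegrable (fun u => iext y u * ψ u) volume 0 1 :=
    intervalIntegrable_of_memLp _ (memLp_mul_bdd _ _ (Lp.memLp ψ) (continuous_iext y).measurable _
      (abs_iext_le y))
  have h := ode_iff a0 a1 x ha1 (iext f) (continuous_iext f) _ hg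
  constructor
  · intro h1 t
    have := h.1 (fun t ht => by rw [← h1 ⟨t, ht⟩]; exact iext_coe f ⟨t, ht⟩) t t.2
    rw [iext_coe] at this
    rw [this, inner_VV]
    rfl
  · intro h1 t
    have := h.2 (fun t ht => by
      have h2 := h1 ⟨t, ht⟩
      rw [inner_VV] at h2
      rw [← iext_coe f] at h2
      exact h2) t t.2
    rw [iext_coe] at this
    exact this

lemma Jfw_eq {α : ℝ} (hα : 0 < α) (a0 a1 x : ℝ) (ha1 : a1 ≠ 0) (y f : CC) (hy : y ∈ Calpha α) :
    Jfw a0 a1 x y f = Jinf (mCC a0 a1 x) (VV a1) y f := by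
  have hypos : ∀ u, 0 < iext y u := fun u => hα.trans_le (le_iext hy u)
  have hfm := continuous_iext f
  have hym := continuous_iext y
  apply le_antisymm
  · refine le_iInf₂ fun ψ hψ => ?_
    rw [← cond_iff a0 a1 x ha1] at hψ
    have hmem : MemLp (fun s => a0 + a1 * iext f s + iext y s * ψ s) 2 leb := by
      refine MemLp.add ?_ (memLp_mul_bdd _ _ (Lp.memLp ψ) hym.measurable _ (abs_iext_le y))
      refine memLp_bdd _ (by fun_prop) (|a0| + |a1| * ‖f‖) fun u => ?_
      refine (abs_add_le _ _).trans ?_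
      rw [abs_mul]
      gcongr
      exact abs_iext_le f u
    refine (iInf_le _ _).trans ((iInf₂_le hmem hψ).trans (le_of_eq ?_))
    congr 2
    have h1 : ‖ψ‖ ^ 2 = ∫ u, ψ u ^ 2 ∂leb := by
      have := norm_sq_toLp ψ (Lp.memLp ψ)
      rwa [Lp.toLp_coeFn] at this
    rw [h1, integral_leb]
    refine intervalIntegral.integral_congr fun u _ => ?_
    have := (hypos u).ne'
    change ((a0 + a1 * iext f u + iext y u * ψ u - a0 - a1 * iext f u) / iext y u) ^ 2 = ψ u ^ 2
    congr 1
    field_simp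
    ring
  · refine le_iInf fun φ => le_iInf₂ fun hφ hf => ?_
    set p : ℝ → ℝ := fun u => (φ u - a0 - a1 * iext f u) / iext y u with hp
    have hpm : MemLp p 2 leb := by
      have h1 : MemLp (fun u => φ u - a0 - a1 * iext f u) 2 leb := by
        refine (hφ.sub (memLp_const a0)).sub ?_
        refine memLp_bdd _ (by fun_prop) (|a1| * ‖f‖) fun u => ?_
        rw [abs_mul]
        gcongr
        exact abs_iext_le f u
      have h2 := memLp_mul_bdd _ (fun u => (iext y u)⁻¹) h1 (by fun_prop) α⁻¹ (fun u => by
        rw [abs_of_pos (inv_pos.2 (hypos u))]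
        exact inv_anti₀ hα (le_iext hy u))
      refine h2.congr_norm ?_ ?_
      · exact (h2.1.congr (Eventually.of_forall fun u => by simp only [hp]; ring))
      · exact Eventually.of_forall fun u => by simp only [hp]; ring_nf
    have hcond : ∀ t : UI, f t = mCC a0 a1 x t + inner ℝ (hpm.toLp p) (VV a1 y t) := by
      rw [← cond_iff a0 a1 x ha1]
      intro t
      rw [hf t]
      congr 1
      rw [intervalIntegral.integral_of_le t.2.1, intervalIntegral.integral_of_le t.2.1]
      refine integral_congr_ae ?_
      have hss : Set.Ioc (0:ℝ) t ⊆ Set.Icc 0 1 := fun u hu => ⟨hu.1.le, hu.2.trans t.2.2⟩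
      have hle : volume.restrict (Set.Ioc (0:ℝ) t) ≤ leb := Measure.restrict_mono hss le_rfl
      filter_upwards [ae_mono hle hpm.coeFn_toLp] with u hu
      rw [hu]
      have := (hypos u).ne'
      simp only [hp]
      field_simp
      ring
    refine (iInf₂_le (hpm.toLp p) hcond).trans (le_of_eq ?_)
    congr 2
    rw [norm_sq_toLp, integral_leb]

/-! ### Gaussian marginals -/

lemma integrable_UI (μ : Measure UI) [IsFiniteMeasure μ] (h : UI → ℝ) (hh : Continuous h) :
    Integrable h μ :=
  hh.integrable_of_hasCompactSupport (HasCompactSupport.of_compactSpace h)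

lemma pairSM_sub (μ ν : Measure UI) [IsFiniteMeasure μ] [IsFiniteMeasure ν] (h : UI → ℝ)
    (hh : Continuous h) :
    pairSM (μ.toSignedMeasure - ν.toSignedMeasure) h = (∫ t, h t ∂μ) - ∫ t, h t ∂ν := by
  unfold pairSM
  set lam := μ.toSignedMeasure - ν.toSignedMeasure with hlam
  set j := lam.toJordanDecomposition with hj
  have h1 : j.posPart.toSignedMeasure - j.negPart.toSignedMeasure = lam :=
    SignedMeasure.toSignedMeasure_toJordanDecomposition lam
  have h2 : (j.posPart + ν).toSignedMeasure = (μ + j.negPart).toSignedMeasure := by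
    rw [Measure.toSignedMeasure_add, Measure.toSignedMeasure_add]
    rw [hlam] at h1
    exact sub_eq_sub_iff_add_eq_add.1 h1
  have h3 : j.posPart + ν = μ + j.negPart := Measure.toSignedMeasure_eq_toSignedMeasure_iff.1 h2
  have h4 : ∫ t, h t ∂(j.posPart + ν) = ∫ t, h t ∂(μ + j.negPart) := by rw [h3]
  rw [integral_add_measure (integrable_UI _ h hh) (integrable_UI _ h hh),
    integral_add_measure (integrable_UI _ h hh) (integrable_UI _ h hh)] at h4
  linarith

/-- A finite combination of Dirac masses with nonnegative weights. -/
def posM (c : UI →₀ ℝ) : Measure UI := ∑ t ∈ c.support, ENNReal.ofReal (c t) • Measure.dirac t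

instance (c : UI →₀ ℝ) : IsFiniteMeasure (posM c) := by
  refine ⟨?_⟩
  simp [posM, Measure.finsetSum_apply]

lemma integral_posM (c : UI →₀ ℝ) (h : UI → ℝ) (hh : Continuous h) :
    ∫ t, h t ∂(posM c) = ∑ t ∈ c.support, max (c t) 0 * h t := by
  unfold posM
  rw [integral_finsetSum_measure]
  · refine Finset.sum_congr rfl fun t _ => ?_
    rw [integral_smul_measure, integral_dirac, ENNReal.toReal_ofReal', smul_eq_mul]
  · intro t _
    exact (integrable_UI _ h hh).smul_measure ENNReal.ofReal_ne_top

/-- The signed measure attached to finitely supported weights. -/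
def lamM (c : UI →₀ ℝ) : SignedMeasure UI :=
  (posM c).toSignedMeasure - (posM (-c)).toSignedMeasure

lemma pairSM_lamM (c : UI →₀ ℝ) (h : UI → ℝ) (hh : Continuous h) :
    pairSM (lamM c) h = ∑ t ∈ c.support, c t * h t := by
  unfold lamM
  rw [pairSM_sub _ _ h hh, integral_posM c h hh, integral_posM (-c) h hh, Finsupp.support_neg,
    ← Finset.sum_sub_distrib]
  refine Finset.sum_congr rfl fun t _ => ?_
  rw [← sub_mul]
  congr 1
  rw [Finsupp.neg_apply]
  rcases le_total 0 (c t) with h0 | h0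
  · rw [max_eq_left h0, max_eq_right (by linarith)]; ring
  · rw [max_eq_right h0, max_eq_left (by linarith)]; ring

lemma continuous_VV (a1 : ℝ) (y : CC) : Continuous fun t => VV a1 y t := by
  refine continuous_iff_continuousAt.2 fun t0 => ?_
  rw [ContinuousAt, tendsto_iff_norm_sub_tendsto_zero]
  set C := Real.exp |a1| ^ 2 * (|a1| ^ 2 + 1)
  have h1 : Tendsto (fun t : UI => Real.sqrt (C * ‖y‖ ^ 2 * |(t : ℝ) - t0|)) (𝓝 t0) (𝓝 0) := by
    have : Continuous fun t : UI => Real.sqrt (C * ‖y‖ ^ 2 * |(t : ℝ) - t0|) := by fun_prop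
    have h := this.tendsto t0
    simpa using h
  exact squeeze_zero (fun _ => norm_nonneg _)
    (fun t => Real.le_sqrt_of_sq_le (VV_inc a1 y t0 t)) h1

lemma dblInt_lamM (a1 : ℝ) (y : CC) (c : UI →₀ ℝ) :
    dblInt (lamM c) (kyFun a1 y) = ‖AV (VV a1) c y‖ ^ 2 := by
  have hV := continuous_VV a1 y
  unfold dblInt
  have h1 : ∀ t, pairSM (lamM c) (fun s => kyFun a1 y t s) =
      ∑ s ∈ c.support, c s * inner ℝ (VV a1 y t) (VV a1 y s) := by
    intro t
    simp only [← inner_VV_VV]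
    exact pairSM_lamM c _ (continuous_const.inner hV)
  simp only [h1]
  rw [pairSM_lamM c _ (by
    refine continuous_finsetSum _ fun s _ => ?_
    exact continuous_const.mul (hV.inner continuous_const))]
  rw [AV, ← real_inner_self_eq_norm_sq, Finsupp.linearCombination_apply, Finsupp.sum, sum_inner]
  refine Finset.sum_congr rfl fun t _ => ?_
  rw [real_inner_smul_left, inner_sum]
  congr 1
  refine Finset.sum_congr rfl fun s _ => ?_
  rw [real_inner_smul_right]

lemma SL_eq (a0 a1 x : ℝ) (c : UI →₀ ℝ) (z : CC) :
    SL (mCC a0 a1 x) c z = pairSM (lamM c) z - pairSM (lamM c) (mFun a0 a1 x) := by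
  rw [pairSM_lamM c _ z.continuous, pairSM_lamM c (mFun a0 a1 x) (mCC a0 a1 x).continuous, SL,
    Finsupp.linearCombination_apply, Finsupp.sum, ← Finset.sum_sub_distrib]
  refine Finset.sum_congr rfl fun t _ => ?_
  rw [smul_eq_mul, mul_sub]
  rfl

lemma gsetup (α a0 a1 x : ℝ) (ν : ℕ → CC → Measure CC)
    (hνgauss : ∀ (n : ℕ) (y : CC), y ∈ Calpha α → ∀ lam : MeasureTheory.SignedMeasure UI,
      ∃ v : ℝ≥0, (v : ℝ) = (1 / (n : ℝ)) * dblInt lam (kyFun a1 y) ∧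
        (ν n y).map (fun z : CC => pairSM lam (⇑z)) =
          gaussianReal (pairSM lam (mFun a0 a1 x)) v) :
    ∃ C, GSetup α (mCC a0 a1 x) (VV a1) C ν := by
  set C := max (Real.exp |a1|) (Real.exp |a1| ^ 2 * (|a1| ^ 2 + 1)) with hCdef
  have hC1 : Real.exp |a1| ≤ C := le_max_left _ _
  have hC2 : Real.exp |a1| ^ 2 * (|a1| ^ 2 + 1) ≤ C := le_max_right _ _
  have hmeas : ∀ c : UI →₀ ℝ, Measurable fun z : CC => pairSM (lamM c) z := by
    intro c
    have : (fun z : CC => pairSM (lamM c) z) =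
        fun z => SL (mCC a0 a1 x) c z + pairSM (lamM c) (mFun a0 a1 x) := by
      funext z; rw [SL_eq]; ring
    rw [this]
    exact (measurable_SL _ c).add_const _
  refine ⟨C, ⟨(Real.exp_pos _).trans_le hC1, ?_, ?_, ?_, VV_zero a1, ?_, ?_⟩⟩
  · intro y y' t
    rw [VV_sub]
    exact (VV_bdd a1 _ t).trans (by gcongr)
  · intro y t
    exact (VV_bdd a1 _ t).trans (by gcongr)
  · intro y s t
    exact (VV_inc a1 y s t).trans (by gcongr)
  · intro n hn y hy
    obtain ⟨v, hv, hmap⟩ := hνgauss n y hy (lamM (Finsupp.single 0 1))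
    have hp : ∀ h : UI → ℝ, Continuous h → pairSM (lamM (Finsupp.single 0 1)) h = h 0 := by
      intro h hh
      rw [pairSM_lamM _ h hh]
      classical
      rw [Finsupp.support_single_ne_zero _ one_ne_zero]
      simp
    rw [dblInt_lamM, AV, Finsupp.linearCombination_single, VV_zero] at hv
    have hv0 : v = 0 := by
      rw [← NNReal.coe_eq_zero, hv]; simp
    rw [hv0, gaussianReal_zero_var, hp (mFun a0 a1 x) (mCC a0 a1 x).continuous] at hmap
    have hset : {z : CC | z 0 ≠ mCC a0 a1 x 0} =
        (fun z : CC => pairSM (lamM (Finsupp.single 0 1)) z) ⁻¹' {mFun a0 a1 x 0}ᶜ := by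
      ext z
      change z 0 ≠ mFun a0 a1 x 0 ↔ pairSM (lamM (Finsupp.single 0 1)) z ≠ mFun a0 a1 x 0
      rw [hp z z.continuous]
    rw [hset, ← Measure.map_apply (hmeas _) (measurableSet_singleton _).compl, hmap]
    simp
  · intro n hn y hy c
    obtain ⟨v, hv, hmap⟩ := hνgauss n y hy (lamM c)
    rw [dblInt_lamM] at hv
    have hn' : (n : ℝ) ≠ 0 := by exact_mod_cast hn.ne'
    have hmgf := mgf_gaussianReal hmap (n : ℝ)
    set S0 := pairSM (lamM c) (mFun a0 a1 x) with hS0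
    rw [mgf] at hmgf
    have hintg : Integrable (fun z : CC => Real.exp (n * pairSM (lamM c) z)) (ν n y) := by
      by_contra hcon
      rw [integral_undef hcon] at hmgf
      exact (Real.exp_pos _).ne hmgf
    have heq : ∀ z : CC, Real.exp (n * SL (mCC a0 a1 x) c z) =
        Real.exp (n * pairSM (lamM c) z) * Real.exp (-(n * S0)) := by
      intro z
      rw [SL_eq, ← Real.exp_add, ← hS0]
      ring_nf
    simp only [heq]
    rw [← ofReal_integral_eq_lintegral_ofReal (hintg.mul_const _)
      (Eventually.of_forall fun z => by positivity), integral_mul_const, hmgf, ← Real.exp_add, hv]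
    congr 2
    field_simp
    ring

/-- LDP for Ornstein–Uhlenbeck processes with random diffusion
coefficient. -/
theorem statement1 {Ω : Type*} [MeasurableSpace Ω] (P : Measure Ω) [IsProbabilityMeasure P]
    (α : ℝ) (hα : 0 < α) (a0 a1 x : ℝ) (ha1 : a1 ≠ 0)
    (Y : ℕ → Ω → CC) (hYmeas : ∀ n, Measurable (Y n)) (hYval : ∀ n ω, Y n ω ∈ Calpha α)
    (IY : CC → ℝ≥0∞) (hIYgood : GoodRate IY) (hIYsupp : ∀ y, y ∉ Calpha α → IY y = ⊤)
    (hYLDP : LDPrv P Y (fun n => (n : ℝ)) IY)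
    (Z : ℕ → Ω → CC) (hZmeas : ∀ n, Measurable (Z n))
    (ν : ℕ → CC → Measure CC)
    (hνprob : ∀ n y, IsProbabilityMeasure (ν n y))
    (hνmeas : ∀ n (B : Set CC), MeasurableSet B → Measurable fun y => ν n y B)
    (hdisint : ∀ n (B1 B2 : Set CC), MeasurableSet B1 → MeasurableSet B2 →
      P.map (fun ω => (Y n ω, Z n ω)) (B1 ×ˢ B2) = ∫⁻ y in B1, ν n y B2 ∂(P.map (Y n)))
    (hνgauss : ∀ (n : ℕ) (y : CC), y ∈ Calpha α → ∀ lam : MeasureTheory.SignedMeasure UI,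
      ∃ v : ℝ≥0, (v : ℝ) = (1 / (n : ℝ)) * dblInt lam (kyFun a1 y) ∧
        (ν n y).map (fun z : CC => pairSM lam (⇑z)) =
          gaussianReal (pairSM lam (mFun a0 a1 x)) v) :
    WLDPrv P (fun n ω => (Y n ω, Z n ω)) (fun n => (n : ℝ))
        (fun p : CC × CC => IY p.1 + Jfw a0 a1 x p.1 p.2) ∧
      LDPrv P Z (fun n => (n : ℝ))
        (fun f : CC => ⨅ y ∈ Calpha α, IY y + Jfw a0 a1 x y f) := by
  obtain ⟨C, G⟩ := gsetup α a0 a1 x ν hνgauss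
  have hYZ : ∀ n, Measurable fun ω => (Y n ω, Z n ω) := fun n => (hYmeas n).prodMk (hZmeas n)
  have hclosed : IsClosed (Calpha α) := by
    have : Calpha α = ⋂ t, {y : CC | α ≤ y t} := by
      ext y
      simp only [Set.mem_iInter]
      rfl
    rw [this]
    exact isClosed_iInter fun t =>
      isClosed_le continuous_const (continuous_eval_const (F := CC) t)
  have S : QSetup α ν (fun n => P.map (Y n)) (fun n => P.map (fun ω => (Y n ω, Z n ω))) IY := by
    refine ⟨fun n => Measure.isProbabilityMeasure_map (hYmeas n).aemeasurable,
      fun n => Measure.isProbabilityMeasure_map (hYZ n).aemeasurable, fun n => ?_, hνprob,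
      hdisint, hIYgood, hIYsupp, hYLDP.2.1, hYLDP.2.2⟩
    exact (ae_map_iff (p := fun y => y ∈ Calpha α) (hYmeas n).aemeasurable
      hclosed.measurableSet).2 (Eventually.of_forall fun ω => hYval n ω)
  have hI : ∀ p : CC × CC, IY p.1 + Jfw a0 a1 x p.1 p.2 = IJ (mCC a0 a1 x) (VV a1) IY p := by
    intro p
    unfold IJ
    by_cases hp : p.1 ∈ Calpha α
    · rw [Jfw_eq hα a0 a1 x ha1 _ _ hp]
    · rw [hIYsupp _ hp, top_add, top_add]
  constructor
  · have : (fun p : CC × CC => IY p.1 + Jfw a0 a1 x p.1 p.2) = IJ (mCC a0 a1 x) (VV a1) IY :=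
      funext hI
    rw [this]
    exact ⟨lsc_IJ G S, joint_lower G S, fun Γ hΓ => joint_upper G S Γ hΓ.isClosed⟩
  · have h1 := ldp_Z G S
    have h2 : (fun f : CC => ⨅ y ∈ Calpha α, IY y + Jfw a0 a1 x y f) =
        fun f => ⨅ y ∈ Calpha α, IJ (mCC a0 a1 x) (VV a1) IY (y, f) := by
      funext f
      exact iInf_congr fun y => iInf_congr fun _ => hI (y, f)
    have h3 : ∀ n, (P.map (fun ω => (Y n ω, Z n ω))).map Prod.snd = P.map (Z n) := by
      intro n
      rw [Measure.map_map measurable_snd (hYZ n)]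
      rfl
    rw [h2]
    simp only [h3] at h1
    exact h1

end
end

section
/- Let ((Xⁿ_t)_{t∈[0,1]}) be a family of continuous Gaussian processes (C-valued random variables), exponentially tight at speed γ(n)→+∞. Suppose that for every λ ∈ M[0,1], limₙ E[⟨λ,Xⁿ⟩] = 0 and limₙ γ(n)·Var(⟨λ,Xⁿ⟩) = ∫₀¹∫₀¹ k̄(t,s) dλ(t)dλ(s), where k̄ is a continuous, symmetric, positive semidefinite kernel on [0,1]² which is the covariance function of some centered continuous Gaussian process. Then (Xⁿ) satisfies an LDP on C with speed γ(n) and good rate function Λ*_{k̄}. -/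
open MeasureTheory ProbabilityTheory Filter Topology
open scoped ENNReal NNReal

noncomputable section

theorem pairSM_eq {lam : SignedMeasure UI} (α β : Measure UI) [IsFiniteMeasure α]
    [IsFiniteMeasure β] (hl : lam = α.toSignedMeasure - β.toSignedMeasure) (h : CC) :
    pairSM lam h = (∫ t, h t ∂α) - ∫ t, h t ∂β := by
  have h1 : lam = lam.toJordanDecomposition.posPart.toSignedMeasure
      - lam.toJordanDecomposition.negPart.toSignedMeasure :=
    (lam.toSignedMeasure_toJordanDecomposition).symm
  set p := lam.toJordanDecomposition.posPart with hp
  set q := lam.toJordanDecomposition.negPart with hq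
  have h2 : p + β = α + q := by
    rw [← Measure.toSignedMeasure_eq_toSignedMeasure_iff, Measure.toSignedMeasure_add,
      Measure.toSignedMeasure_add]
    rw [h1] at hl
    exact (sub_eq_sub_iff_add_eq_add).1 hl
  have hi : ∀ (m : Measure UI) [IsFiniteMeasure m], Integrable (fun t => h t) m := fun m _ =>
    (BoundedContinuousFunction.mkOfCompact h).integrable m
  have h3 : ∫ t, h t ∂(p + β) = ∫ t, h t ∂(α + q) := by rw [h2]
  rw [integral_add_measure (hi _) (hi _), integral_add_measure (hi _) (hi _)] at h3
  unfold pairSM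
  linarith

theorem pairSM_smul (s : ℝ) (lam : SignedMeasure UI) (h : UI → ℝ) :
    pairSM (s • lam) h = s * pairSM lam h := by
  unfold pairSM
  rw [SignedMeasure.toJordanDecomposition_smul_real]
  rcases le_or_gt 0 s with hs | hs
  · rw [JordanDecomposition.real_smul_posPart_nonneg _ _ hs,
      JordanDecomposition.real_smul_negPart_nonneg _ _ hs, integral_smul_nnreal_measure,
      integral_smul_nnreal_measure]
    simp only [NNReal.smul_def, Real.coe_toNNReal _ hs, smul_eq_mul]
    ring
  · rw [JordanDecomposition.real_smul_posPart_neg _ _ hs,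
      JordanDecomposition.real_smul_negPart_neg _ _ hs, integral_smul_nnreal_measure,
      integral_smul_nnreal_measure]
    simp only [NNReal.smul_def, Real.coe_toNNReal _ (neg_pos.2 hs).le, smul_eq_mul]
    ring

theorem pairSM_zero (h : UI → ℝ) : pairSM 0 h = 0 := by
  have := pairSM_smul 0 0 h
  simpa using this

theorem pairSM_add (lam mu : SignedMeasure UI) (h : CC) :
    pairSM (lam + mu) h = pairSM lam h + pairSM mu h := by
  have h1 : lam = lam.toJordanDecomposition.posPart.toSignedMeasure
      - lam.toJordanDecomposition.negPart.toSignedMeasure :=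
    (lam.toSignedMeasure_toJordanDecomposition).symm
  have h2 : mu = mu.toJordanDecomposition.posPart.toSignedMeasure
      - mu.toJordanDecomposition.negPart.toSignedMeasure :=
    (mu.toSignedMeasure_toJordanDecomposition).symm
  have hi : ∀ (m : Measure UI) [IsFiniteMeasure m], Integrable (fun t => h t) m := fun m _ =>
    (BoundedContinuousFunction.mkOfCompact h).integrable m
  rw [pairSM_eq (lam.toJordanDecomposition.posPart + mu.toJordanDecomposition.posPart)
    (lam.toJordanDecomposition.negPart + mu.toJordanDecomposition.negPart),
    integral_add_measure (hi _) (hi _), integral_add_measure (hi _) (hi _)]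
  · unfold pairSM; ring
  · rw [Measure.toSignedMeasure_add, Measure.toSignedMeasure_add]
    nth_rewrite 1 [h1]
    nth_rewrite 1 [h2]
    abel

theorem pairSM_comb (lam mu : SignedMeasure UI) (s : ℝ) (h : CC) :
    pairSM (lam + s • mu) h = pairSM lam h + s * pairSM mu h := by
  rw [pairSM_add, pairSM_smul]

/-- The Dirac signed measure. -/
def diracSM (t : UI) : SignedMeasure UI := (Measure.dirac t).toSignedMeasure

theorem diracSM_jordan (t : UI) : (diracSM t).toJordanDecomposition =
    { posPart := Measure.dirac t, negPart := 0, mutuallySingular := by simp } := by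
  apply SignedMeasure.toJordanDecomposition_eq
  simp [JordanDecomposition.toSignedMeasure, diracSM, Measure.toSignedMeasure_zero]

theorem pairSM_dirac (t : UI) (h : UI → ℝ) : pairSM (diracSM t) h = h t := by
  unfold pairSM
  rw [diracSM_jordan]
  simp

theorem pairSM_continuous (lam : SignedMeasure UI) : Continuous (fun h : CC => pairSM lam h) := by
  unfold pairSM
  have key : ∀ (m : Measure UI) [IsFiniteMeasure m], Continuous (fun h : CC => ∫ t, h t ∂m) := by
    intro m _
    refine continuous_iff_continuousAt.2 fun h0 => ?_
    have hc : ∀ t : UI, Continuous fun h : CC => h t := fun t => by fun_prop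
    refine MeasureTheory.continuousAt_of_dominated (bound := fun _ => ‖h0‖ + 1) ?_ ?_ ?_ ?_
    · exact Eventually.of_forall fun h => h.continuous.aestronglyMeasurable
    · filter_upwards [Metric.ball_mem_nhds h0 one_pos] with h hh
      refine Eventually.of_forall fun t => (h.norm_coe_le_norm t).trans ?_
      rw [mem_ball_iff_norm] at hh
      have := norm_add_le (h - h0) h0
      simp only [sub_add_cancel] at this
      linarith
    · exact integrable_const _
    · exact Eventually.of_forall fun t => (hc t).continuousAt
  exact (key _).sub (key _)

theorem elog_mono {p q : ℝ≥0∞} (h : p ≤ q) : elog p ≤ elog q := by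
  unfold elog
  split_ifs with h1 h2 h3 h4 h5 h6 h7
  all_goals try simp
  · simp_all
  · simp_all
  · simp_all
  · exact Real.log_le_log (ENNReal.toReal_pos h1 h4) (ENNReal.toReal_mono (by assumption) h)

theorem elog_exp (y : ℝ) : elog (ENNReal.ofReal (Real.exp y)) = (y : EReal) := by
  unfold elog
  rw [if_neg (by simp [Real.exp_pos]), if_neg (by simp),
    ENNReal.toReal_ofReal (Real.exp_pos y).le, Real.log_exp]

theorem inv_mul_elog_exp {g a : ℝ} (hg : 0 < g) :
    ((g⁻¹ : ℝ) : EReal) * elog (ENNReal.ofReal (Real.exp (g * a))) = (a : EReal) := by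
  rw [elog_exp, ← EReal.coe_mul, inv_mul_cancel_left₀ hg.ne']

theorem le_elog {g a : ℝ} (hg : 0 < g) {p : ℝ≥0∞} (h : ENNReal.ofReal (Real.exp (g * a)) ≤ p) :
    (a : EReal) ≤ ((g⁻¹ : ℝ) : EReal) * elog p := by
  rw [← inv_mul_elog_exp hg]
  exact mul_le_mul_of_nonneg_left (elog_mono h) (by exact_mod_cast (inv_pos.2 hg).le)

theorem elog_le {g a : ℝ} (hg : 0 < g) {p : ℝ≥0∞} (h : p ≤ ENNReal.ofReal (Real.exp (g * a))) :
    ((g⁻¹ : ℝ) : EReal) * elog p ≤ (a : EReal) := by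
  rw [← inv_mul_elog_exp (a := a) hg]
  exact mul_le_mul_of_nonneg_left (elog_mono h) (by exact_mod_cast (inv_pos.2 hg).le)

theorem le_exp_of_elog_lt {g a : ℝ} (hg : 0 < g) {p : ℝ≥0∞}
    (h : ((g⁻¹ : ℝ) : EReal) * elog p < (a : EReal)) : p ≤ ENNReal.ofReal (Real.exp (g * a)) := by
  by_contra! hc
  exact absurd (le_elog hg hc.le) (not_le.2 h)

/-- Tail estimate extracted from exponential tightness. -/
theorem ExpTight.bound {Ω : Type*} [MeasurableSpace Ω] {P : Measure Ω} {X : ℕ → Ω → CC}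
    {γ : ℕ → ℝ} (h : ExpTight P X γ) (hγ : Tendsto γ atTop atTop) (R : ℝ) :
    ∃ K : Set CC, IsCompact K ∧ ∀ᶠ n in atTop,
      P (X n ⁻¹' Kᶜ) ≤ ENNReal.ofReal (Real.exp (γ n * (-R))) := by
  obtain ⟨K, hK, hl⟩ := h (|R| + 1) (by positivity)
  refine ⟨K, hK, ?_⟩
  have h1 : (Filter.atTop.limsup fun n => (((γ n)⁻¹ : ℝ) : EReal) * elog (P (X n ⁻¹' Kᶜ))) <
      ((-R : ℝ) : EReal) := by
    refine hl.trans_lt ?_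
    have := le_abs_self R
    exact_mod_cast (by linarith : -(|R| + 1) < -R)
  filter_upwards [eventually_lt_of_limsup_lt h1, hγ.eventually_gt_atTop 0] with n hn hg
  exact le_exp_of_elog_lt hg hn

section Gauss
variable {Ω : Type*} [MeasurableSpace Ω] {P : Measure Ω} [IsProbabilityMeasure P]

theorem IsContGaussian.meas {X : Ω → CC} (hX : IsContGaussian P X) (lam : SignedMeasure UI) :
    Measurable fun ω => pairSM lam (X ω) :=
  (pairSM_continuous lam).measurable.comp hX.1

theorem IsContGaussian.memLp {X : Ω → CC} (hX : IsContGaussian P X) (lam : SignedMeasure UI) :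
    MemLp (fun ω => pairSM lam (X ω)) 2 P := by
  obtain ⟨m, v, h⟩ := hX.2 lam
  have := memLp_id_gaussianReal' (μ := m) (v := v) 2 (by simp)
  rw [← h] at this
  exact (memLp_map_measure_iff aestronglyMeasurable_id (hX.meas lam).aemeasurable).1 this

theorem IsContGaussian.lmgf {X : Ω → CC} (hX : IsContGaussian P X) (lam : SignedMeasure UI)
    (g : ℝ) :
    ∫⁻ ω, ENNReal.ofReal (Real.exp (g * pairSM lam (X ω))) ∂P =
      ENNReal.ofReal (Real.exp (g * ((∫ ω, pairSM lam (X ω) ∂P) +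
        (g * variance (fun ω => pairSM lam (X ω)) P) / 2))) := by
  obtain ⟨m, v, h⟩ := hX.2 lam
  have hm := (hX.meas lam).aemeasurable (μ := P)
  have e1 : ∫ ω, pairSM lam (X ω) ∂P = m := by
    rw [← integral_id_gaussianReal (μ := m) (v := v), ← h,
      integral_map hm (f := fun x : ℝ => x) aestronglyMeasurable_id]
  have e2 : variance (fun ω => pairSM lam (X ω)) P = v := by
    rw [← variance_id_gaussianReal (μ := m) (v := v), ← h, variance_map aemeasurable_id hm]
    rfl
  have e3 := mgf_gaussianReal h g
  have hi : Integrable (fun ω => Real.exp (g * pairSM lam (X ω))) P := by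
    have := integrable_exp_mul_gaussianReal (μ := m) (v := v) g
    rw [← h] at this
    exact (integrable_map_measure (by fun_prop) hm).1 this
  rw [← ofReal_integral_eq_lintegral_ofReal hi (Eventually.of_forall fun _ => (Real.exp_pos _).le)]
  congr 1
  rw [e1, e2]
  unfold mgf at e3
  rw [e3]
  congr 1
  ring

theorem IsContGaussian.var_comb {X : Ω → CC} (hX : IsContGaussian P X)
    (lam mu : SignedMeasure UI) (s : ℝ) :
    variance (fun ω => pairSM (lam + s • mu) (X ω)) P =
      variance (fun ω => pairSM lam (X ω)) P +
        s * (variance (fun ω => pairSM (lam + mu) (X ω)) P -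
          variance (fun ω => pairSM lam (X ω)) P - variance (fun ω => pairSM mu (X ω)) P) +
        s ^ 2 * variance (fun ω => pairSM mu (X ω)) P := by
  have h1 := hX.memLp lam
  have h2 := hX.memLp mu
  simp only [pairSM_add, pairSM_smul]
  rw [variance_fun_add h1 (h2.const_mul s), variance_fun_add h1 h2, variance_const_mul,
    covariance_const_mul_right]
  ring

end Gauss

/-- The limiting bilinear form, defined by polarization. -/
def Bil (k : UI → UI → ℝ) (lam mu : SignedMeasure UI) : ℝ :=
  (dblInt (lam + mu) k - dblInt lam k - dblInt mu k) / 2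

section Main
variable {Ω : Type*} [MeasurableSpace Ω] {P : Measure Ω} [IsProbabilityMeasure P]
    {X : ℕ → Ω → CC} {γ : ℕ → ℝ} {kbar : UI → UI → ℝ}

theorem quad_comb (hX : ∀ n, IsContGaussian P (X n))
    (hvar : ∀ lam : SignedMeasure UI,
      Tendsto (fun n => γ n * variance (fun ω => pairSM lam (X n ω)) P) atTop
        (nhds (dblInt lam kbar))) (lam mu : SignedMeasure UI) (s : ℝ) :
    dblInt (lam + s • mu) kbar =
      dblInt lam kbar + 2 * s * Bil kbar lam mu + s ^ 2 * dblInt mu kbar := by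
  refine tendsto_nhds_unique (hvar (lam + s • mu)) ?_
  have := ((hvar lam).add ((((hvar (lam + mu)).sub (hvar lam)).sub (hvar mu)).const_mul s)).add
    ((hvar mu).const_mul (s ^ 2))
  refine (this.congr fun n => ?_).trans_eq ?_
  · rw [(hX n).var_comb]; ring
  · unfold Bil; congr 1; ring

theorem quad_nonneg (hγ : Tendsto γ atTop atTop)
    (hvar : ∀ lam : SignedMeasure UI,
      Tendsto (fun n => γ n * variance (fun ω => pairSM lam (X n ω)) P) atTop
        (nhds (dblInt lam kbar))) (lam : SignedMeasure UI) : 0 ≤ dblInt lam kbar := by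
  refine ge_of_tendsto (hvar lam) ?_
  filter_upwards [hγ.eventually_gt_atTop 0] with n hn
  exact mul_nonneg hn.le (variance_nonneg _ _)

theorem quad_zero (k : UI → UI → ℝ) : dblInt 0 k = 0 := pairSM_zero _

theorem quad_smul (k : UI → UI → ℝ) (s : ℝ) (lam : SignedMeasure UI) :
    dblInt (s • lam) k = s ^ 2 * dblInt lam k := by
  unfold dblInt
  have : (fun t => pairSM (s • lam) (fun u => k t u)) =
      fun t => s * pairSM lam (fun u => k t u) := by
    funext t; rw [pairSM_smul]
  rw [this, pairSM_smul]
  have h2 : pairSM lam (fun t => s * pairSM lam (fun u => k t u)) =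
      s * pairSM lam (fun t => pairSM lam (fun u => k t u)) := by
    conv_lhs => unfold pairSM
    rw [integral_const_mul, integral_const_mul, ← mul_sub]
    rfl
  rw [h2]; ring

theorem Bil_self (k : UI → UI → ℝ) (lam : SignedMeasure UI) :
    Bil k lam lam = dblInt lam k := by
  unfold Bil
  have : lam + lam = (2 : ℝ) • lam := by rw [two_smul]
  rw [this, quad_smul]; ring

theorem Bil_neg (hX : ∀ n, IsContGaussian P (X n))
    (hvar : ∀ lam : SignedMeasure UI,
      Tendsto (fun n => γ n * variance (fun ω => pairSM lam (X n ω)) P) atTop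
        (nhds (dblInt lam kbar))) (lam mu : SignedMeasure UI) :
    Bil kbar lam ((-1 : ℝ) • mu) = - Bil kbar lam mu := by
  have h := quad_comb hX hvar lam mu (-1)
  have h2 := quad_smul kbar (-1) mu
  conv_lhs => unfold Bil
  rw [h, h2]; ring

theorem quad_dirac (k : UI → UI → ℝ) (t : UI) : dblInt (diracSM t) k = k t t := by
  unfold dblInt
  rw [pairSM_dirac, pairSM_dirac]

/-- Scaled log-mgf. -/
def Lg (P : Measure Ω) (X : ℕ → Ω → CC) (γ : ℕ → ℝ) (lam : SignedMeasure UI) (n : ℕ) : ℝ :=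
  (∫ ω, pairSM lam (X n ω) ∂P) + (γ n * variance (fun ω => pairSM lam (X n ω)) P) / 2

theorem Lg_tendsto
    (hmean : ∀ lam : SignedMeasure UI,
      Tendsto (fun n => ∫ ω, pairSM lam (X n ω) ∂P) atTop (nhds 0))
    (hvar : ∀ lam : SignedMeasure UI,
      Tendsto (fun n => γ n * variance (fun ω => pairSM lam (X n ω)) P) atTop
        (nhds (dblInt lam kbar))) (lam : SignedMeasure UI) :
    Tendsto (Lg P X γ lam) atTop (nhds (LamK kbar lam)) := by
  have := (hmean lam).add ((hvar lam).div_const 2)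
  refine this.trans_eq ?_
  unfold LamK; congr 1; ring

theorem lint_Lg (hX : ∀ n, IsContGaussian P (X n)) (lam : SignedMeasure UI) (n : ℕ) :
    ∫⁻ ω, ENNReal.ofReal (Real.exp (γ n * pairSM lam (X n ω))) ∂P =
      ENNReal.ofReal (Real.exp (γ n * Lg P X γ lam n)) := (hX n).lmgf lam (γ n)

/-- Chernoff bound. -/
theorem chernoff (hX : ∀ n, IsContGaussian P (X n)) (lam : SignedMeasure UI) (c : ℝ) (n : ℕ)
    (hg : 0 < γ n) :
    P {ω | c < pairSM lam (X n ω)} ≤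
      ENNReal.ofReal (Real.exp (γ n * (Lg P X γ lam n - c))) := by
  have hm : MeasurableSet {ω | c < pairSM lam (X n ω)} :=
    measurableSet_lt measurable_const ((hX n).meas lam)
  calc P {ω | c < pairSM lam (X n ω)}
      = ∫⁻ ω in {ω | c < pairSM lam (X n ω)}, 1 ∂P := by simp
    _ ≤ ∫⁻ ω in {ω | c < pairSM lam (X n ω)}, ENNReal.ofReal (Real.exp (-(γ n * c))) *
          ENNReal.ofReal (Real.exp (γ n * pairSM lam (X n ω))) ∂P := by
        refine setLIntegral_mono' hm fun ω hω => ?_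
        rw [← ENNReal.ofReal_mul (Real.exp_pos _).le, ← Real.exp_add, ENNReal.one_le_ofReal,
          Real.one_le_exp_iff]
        have : γ n * c ≤ γ n * pairSM lam (X n ω) := mul_le_mul_of_nonneg_left (le_of_lt hω) hg.le
        linarith
    _ ≤ ∫⁻ ω, ENNReal.ofReal (Real.exp (-(γ n * c))) *
          ENNReal.ofReal (Real.exp (γ n * pairSM lam (X n ω))) ∂P := setLIntegral_le_lintegral _ _
    _ = _ := by
        rw [lintegral_const_mul' _ _ (by simp), lint_Lg hX, ← ENNReal.ofReal_mul (Real.exp_pos _).le,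
          ← Real.exp_add]
        congr 2; ring

theorem upper (hX : ∀ n, IsContGaussian P (X n)) (hγ : Tendsto γ atTop atTop)
    (htight : ExpTight P X γ)
    (hmean : ∀ lam : SignedMeasure UI,
      Tendsto (fun n => ∫ ω, pairSM lam (X n ω) ∂P) atTop (nhds 0))
    (hvar : ∀ lam : SignedMeasure UI,
      Tendsto (fun n => γ n * variance (fun ω => pairSM lam (X n ω)) P) atTop
        (nhds (dblInt lam kbar))) :
    LDPUpper (fun n => P.map (X n)) γ (fun h : CC => CramerK kbar (⇑h)) := by
  intro Γ hΓ
  rw [← EReal.le_of_forall_lt_iff_le]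
  intro z hz
  obtain ⟨z', hz1, hz2⟩ := EReal.lt_iff_exists_real_btwn.1 hz
  have hzz : z' < z := by exact_mod_cast hz2
  have hx : ∀ x ∈ Γ, ∃ lam : SignedMeasure UI, -z' < pairSM lam x - LamK kbar lam := by
    intro x hxΓ
    have h1 : ((-z' : ℝ) : EReal) < (CramerK kbar x : EReal) := by
      have : -(z' : EReal) < ⨅ x ∈ Γ, (CramerK kbar x : EReal) := EReal.neg_lt_comm.1 hz1
      rw [EReal.coe_neg]
      exact this.trans_le (iInf₂_le x hxΓ)
    by_cases hneg : -z' < 0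
    · refine ⟨0, ?_⟩
      rw [pairSM_zero, LamK, quad_zero]; simpa using hneg
    · push Not at hneg
      have h2 : ENNReal.ofReal (-z') < CramerK kbar x := by
        rw [← EReal.coe_ennreal_lt_coe_ennreal_iff, EReal.coe_ennreal_ofReal, max_eq_left hneg]
        exact h1
      obtain ⟨lam, hl⟩ := lt_iSup_iff.1 h2
      exact ⟨lam, (ENNReal.ofReal_lt_ofReal_iff_of_nonneg hneg).1 hl⟩
  choose! f hf using hx
  obtain ⟨K, hK, hKb⟩ := htight.bound hγ (-z')
  have hU : ∀ x ∈ Γ ∩ K, {y : CC | -z' + LamK kbar (f x) < pairSM (f x) y} ∈ 𝓝 x := by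
    intro x hx
    refine (isOpen_lt continuous_const (pairSM_continuous (f x))).mem_nhds ?_
    have := hf x hx.1
    simp only [Set.mem_ofPred_eq]; linarith
  obtain ⟨T, hT, hcov⟩ := (hK.inter_left hΓ).elim_nhds_subcover _ hU
  set d := (z - z') / 2 with hd
  have hdpos : 0 < d := by rw [hd]; linarith
  have hL : ∀ᶠ n in atTop, ∀ x ∈ T, Lg P X γ (f x) n < LamK kbar (f x) + d := by
    rw [Filter.eventually_all_finset]
    intro x _
    exact (Lg_tendsto hmean hvar (f x)).eventually_lt_const (by linarith)
  have hlarge : ∀ᶠ n in atTop, ((T.card : ℝ) + 1) ≤ Real.exp (γ n * d) :=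
    (Real.tendsto_exp_atTop.comp (hγ.atTop_mul_const hdpos)).eventually_ge_atTop _
  refine limsup_le_of_le (by isBoundedDefault) ?_
  filter_upwards [hL, hlarge, hKb, hγ.eventually_gt_atTop 0] with n h1 h2 h3 hg
  refine elog_le hg ?_
  rw [Measure.map_apply (hX n).1 hΓ.measurableSet]
  have hsub : X n ⁻¹' Γ ⊆ (⋃ x ∈ T, {ω | -z' + LamK kbar (f x) < pairSM (f x) (X n ω)}) ∪
      X n ⁻¹' Kᶜ := by
    intro ω hω
    by_cases hk : X n ω ∈ K
    · left
      have := hcov ⟨hω, hk⟩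
      simpa using this
    · right; exact hk
  calc P (X n ⁻¹' Γ) ≤ P (⋃ x ∈ T, {ω | -z' + LamK kbar (f x) < pairSM (f x) (X n ω)}) +
        P (X n ⁻¹' Kᶜ) := (measure_mono hsub).trans (measure_union_le _ _)
    _ ≤ (∑ x ∈ T, ENNReal.ofReal (Real.exp (γ n * (z' + d)))) +
        ENNReal.ofReal (Real.exp (γ n * (z' + d))) := by
        gcongr
        · refine (measure_biUnion_finset_le _ _).trans (Finset.sum_le_sum fun x hx => ?_)
          refine (chernoff hX (f x) _ n hg).trans ?_
          gcongr
          have := h1 x hx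
          linarith
        · refine h3.trans ?_
          gcongr
          linarith
    _ = ENNReal.ofReal (((T.card : ℝ) + 1) * Real.exp (γ n * (z' + d))) := by
        rw [Finset.sum_const, nsmul_eq_mul, ENNReal.ofReal_mul (by positivity),
          ENNReal.ofReal_add (by positivity) (by positivity), ENNReal.ofReal_natCast, add_mul]
        simp
    _ ≤ ENNReal.ofReal (Real.exp (γ n * d) * Real.exp (γ n * (z' + d))) := by gcongr
    _ = _ := by
        rw [← Real.exp_add]; congr 2; rw [hd]; ring

/-- The exponentially tilted measure. -/
def TiltM (P : Measure Ω) (X : ℕ → Ω → CC) (γ : ℕ → ℝ) (lam : SignedMeasure UI) (n : ℕ) :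
    Measure Ω :=
  P.withDensity fun ω => ENNReal.ofReal (Real.exp (γ n * (pairSM lam (X n ω) - Lg P X γ lam n)))

theorem TiltM_univ (hX : ∀ n, IsContGaussian P (X n)) (lam : SignedMeasure UI) (n : ℕ) :
    TiltM P X γ lam n Set.univ = 1 := by
  unfold TiltM
  rw [withDensity_apply _ MeasurableSet.univ, Measure.restrict_univ]
  have : ∀ ω, ENNReal.ofReal (Real.exp (γ n * (pairSM lam (X n ω) - Lg P X γ lam n))) =
      ENNReal.ofReal (Real.exp (-(γ n * Lg P X γ lam n))) *
        ENNReal.ofReal (Real.exp (γ n * pairSM lam (X n ω))) := by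
    intro ω
    rw [← ENNReal.ofReal_mul (Real.exp_pos _).le, ← Real.exp_add]
    congr 2; ring
  simp only [this]
  rw [lintegral_const_mul' _ _ (by simp), lint_Lg hX, ← ENNReal.ofReal_mul (Real.exp_pos _).le,
    ← Real.exp_add]
  simp

/-- On a set where `⟨λ,X⟩ ≤ c`, the tilted mass is controlled by the original one. -/
theorem TiltM_le (lam : SignedMeasure UI) (n : ℕ) (hg : 0 < γ n)
    (A : Set Ω) (hA : MeasurableSet A) (c : ℝ) (hc : ∀ ω ∈ A, pairSM lam (X n ω) ≤ c) :
    TiltM P X γ lam n A ≤ ENNReal.ofReal (Real.exp (γ n * (c - Lg P X γ lam n))) * P A := by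
  unfold TiltM
  rw [withDensity_apply _ hA, ← setLIntegral_const]
  refine setLIntegral_mono' hA fun ω hω => ?_
  have := hc ω hω
  gcongr

theorem exp_neg_tendsto (hγ : Tendsto γ atTop atTop) {d : ℕ → ℝ} {l : ℝ} (hl : l < 0)
    (hd : Tendsto d atTop (nhds l)) :
    Tendsto (fun n => ENNReal.ofReal (Real.exp (γ n * d n))) atTop (nhds 0) := by
  have h1 : Tendsto (fun n => γ n * d n) atTop atBot := hγ.atTop_mul_neg hl hd
  have := ENNReal.tendsto_ofReal (Real.tendsto_exp_atBot.comp h1)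
  simpa using this

/-- TiltMed concentration. -/
theorem TiltM_conc (hX : ∀ n, IsContGaussian P (X n)) (hγ : Tendsto γ atTop atTop)
    (hmean : ∀ lam : SignedMeasure UI,
      Tendsto (fun n => ∫ ω, pairSM lam (X n ω) ∂P) atTop (nhds 0))
    (hvar : ∀ lam : SignedMeasure UI,
      Tendsto (fun n => γ n * variance (fun ω => pairSM lam (X n ω)) P) atTop
        (nhds (dblInt lam kbar))) (lam mu : SignedMeasure UI) {η : ℝ} (hη : 0 < η) :
    Tendsto (fun n => TiltM P X γ lam n {ω | Bil kbar lam mu + η < pairSM mu (X n ω)}) atTop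
      (nhds 0) := by
  have hq := quad_nonneg hγ hvar mu
  set q := dblInt mu kbar with hqd
  set s := η / (q + 1) with hs
  have hspos : 0 < s := by positivity
  have hsq : s * (q + 1) = η := by rw [hs]; field_simp
  set b := Bil kbar lam mu with hb
  have hlim : Tendsto (fun n => Lg P X γ (lam + s • mu) n - Lg P X γ lam n - s * (b + η)) atTop
      (nhds (LamK kbar (lam + s • mu) - LamK kbar lam - s * (b + η))) :=
    ((Lg_tendsto hmean hvar _).sub (Lg_tendsto hmean hvar _)).sub_const _
  have hneg : LamK kbar (lam + s • mu) - LamK kbar lam - s * (b + η) < 0 := by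
    unfold LamK
    rw [quad_comb hX hvar, ← hb, ← hqd]
    have : s * η = s * (s * (q + 1)) := by rw [hsq]
    nlinarith [mul_pos hspos hspos, mul_nonneg (mul_pos hspos hspos).le hq]
  refine tendsto_of_tendsto_of_tendsto_of_le_of_le' tendsto_const_nhds
    (exp_neg_tendsto hγ hneg hlim) (Eventually.of_forall fun _ => zero_le) ?_
  filter_upwards [hγ.eventually_gt_atTop 0] with n hg
  have hm : MeasurableSet {ω | b + η < pairSM mu (X n ω)} :=
    measurableSet_lt measurable_const ((hX n).meas mu)
  unfold TiltM
  rw [withDensity_apply _ hm]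
  calc _ ≤ ∫⁻ ω in {ω | b + η < pairSM mu (X n ω)},
          ENNReal.ofReal (Real.exp (γ n * (- Lg P X γ lam n - s * (b + η)))) *
          ENNReal.ofReal (Real.exp (γ n * pairSM (lam + s • mu) (X n ω))) ∂P := by
        refine setLIntegral_mono' hm fun ω hω => ?_
        rw [← ENNReal.ofReal_mul (Real.exp_pos _).le, ← Real.exp_add, pairSM_comb, ← mul_add]
        have : s * (b + η) ≤ s * pairSM mu (X n ω) := mul_le_mul_of_nonneg_left (le_of_lt hω) hspos.le
        gcongr
        linarith
    _ ≤ ∫⁻ ω, ENNReal.ofReal (Real.exp (γ n * (- Lg P X γ lam n - s * (b + η)))) *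
          ENNReal.ofReal (Real.exp (γ n * pairSM (lam + s • mu) (X n ω))) ∂P :=
        setLIntegral_le_lintegral _ _
    _ = _ := by
        rw [lintegral_const_mul' _ _ (by simp), lint_Lg hX, ← ENNReal.ofReal_mul (Real.exp_pos _).le,
          ← Real.exp_add, ← mul_add]
        congr 3; ring

theorem approx_sq (hX : ∀ n, IsContGaussian P (X n))
    (hvar : ∀ lam : SignedMeasure UI,
      Tendsto (fun n => γ n * variance (fun ω => pairSM lam (X n ω)) P) atTop
        (nhds (dblInt lam kbar))) (x : CC) {c ε : ℝ}
    (hc : ∀ lam : SignedMeasure UI, pairSM lam x - LamK kbar lam ≤ c)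
    {lam : SignedMeasure UI} (hl : c - ε ≤ pairSM lam x - LamK kbar lam)
    (mu : SignedMeasure UI) :
    (pairSM mu x - Bil kbar lam mu) ^ 2 ≤ 2 * ε * dblInt mu kbar := by
  have h : ∀ s : ℝ, 0 ≤ (dblInt mu kbar / 2) * (s * s) +
      (-(pairSM mu x - Bil kbar lam mu)) * s + ε := by
    intro s
    have h1 := hc (lam + s • mu)
    unfold LamK at h1 hl
    rw [pairSM_comb, quad_comb hX hvar] at h1
    nlinarith
  have := discrim_le_zero h
  unfold discrim at this
  nlinarith

theorem exists_near (x : CC) (hx : CramerK kbar x ≠ ⊤) {ε : ℝ} (hε : 0 < ε) :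
    ∃ lam : SignedMeasure UI,
      (CramerK kbar x).toReal - ε ≤ pairSM lam x - LamK kbar lam := by
  by_cases hneg : (CramerK kbar x).toReal - ε < 0
  · refine ⟨0, ?_⟩
    rw [pairSM_zero, LamK, quad_zero]; simpa using hneg.le
  · push Not at hneg
    have h2 : ENNReal.ofReal ((CramerK kbar x).toReal - ε) < CramerK kbar x := by
      rw [ENNReal.ofReal_lt_iff_lt_toReal hneg hx]; linarith
    obtain ⟨lam, hl⟩ := lt_iSup_iff.1 h2
    exact ⟨lam, ((ENNReal.ofReal_lt_ofReal_iff_of_nonneg hneg).1 hl).le⟩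

theorem cramer_bound (x : CC) (hx : CramerK kbar x ≠ ⊤) (lam : SignedMeasure UI) :
    pairSM lam x - LamK kbar lam ≤ (CramerK kbar x).toReal := by
  have h : ENNReal.ofReal (pairSM lam x - LamK kbar lam) ≤ CramerK kbar x :=
    le_iSup (fun lam : SignedMeasure UI => ENNReal.ofReal (pairSM lam x - LamK kbar lam)) lam
  exact (ENNReal.ofReal_le_iff_le_toReal hx).1 h

/-- Lower bound for balls around a point close to the tilted mean. -/
theorem lower_ball (hX : ∀ n, IsContGaussian P (X n)) (hγ : Tendsto γ atTop atTop)
    (htight : ExpTight P X γ)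
    (hmean : ∀ lam : SignedMeasure UI,
      Tendsto (fun n => ∫ ω, pairSM lam (X n ω) ∂P) atTop (nhds 0))
    (hvar : ∀ lam : SignedMeasure UI,
      Tendsto (fun n => γ n * variance (fun ω => pairSM lam (X n ω)) P) atTop
        (nhds (dblInt lam kbar))) (x : CC) (lam : SignedMeasure UI) {r η : ℝ} (hr : 0 < r)
    (hη : 0 < η) (hclose : ∀ t : UI, |x t - Bil kbar lam (diracSM t)| ≤ r / 3) :
    ∀ᶠ n in atTop, ENNReal.ofReal (Real.exp (γ n * (-(LamK kbar lam + 3 * η)))) ≤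
      P (X n ⁻¹' Metric.ball x r) := by
  set q := dblInt lam kbar with hq
  have hLam : LamK kbar lam = q / 2 := by unfold LamK; rw [← hq]; ring
  obtain ⟨K, hK, hKb⟩ := htight.bound hγ (q / 2 + η + 1)
  have hfar : ∀ y ∈ K ∩ (Metric.ball x r)ᶜ, ∃ t : UI, r ≤ |y t - x t| := by
    intro y hy
    by_contra! hcon
    exact hy.2 ((ContinuousMap.dist_lt_iff hr).2 fun t => hcon t)
  choose! τ hτ using hfar
  set b : CC → ℝ := fun y => Bil kbar lam (diracSM (τ y)) with hb
  have hU : ∀ y ∈ K ∩ (Metric.ball x r)ᶜ, {z : CC | r / 2 < |z (τ y) - b y|} ∈ 𝓝 y := by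
    intro y hy
    refine (isOpen_lt continuous_const (by fun_prop)).mem_nhds ?_
    simp only [Set.mem_ofPred_eq]
    have h1 := hτ y hy
    have h2 := hclose (τ y)
    have h3 := abs_sub_le (y (τ y)) (b y) (x (τ y))
    rw [abs_sub_comm (b y)] at h3
    change |x (τ y) - b y| ≤ r / 3 at h2
    linarith
  obtain ⟨T, hT, hcov⟩ := (hK.inter_right Metric.isOpen_ball.isClosed_compl).elim_nhds_subcover _ hU
  have hBs : Bil kbar lam lam = q := Bil_self kbar lam
  set A1 : ℕ → Set Ω := fun n => {ω | q + η < pairSM lam (X n ω)} with hA1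
  set A2 : ℕ → Set Ω := fun n => X n ⁻¹' Kᶜ ∩ {ω | pairSM lam (X n ω) ≤ q + η} with hA2
  set A3 : CC → ℕ → Set Ω := fun y n =>
    {ω | b y + r / 2 < pairSM (diracSM (τ y)) (X n ω)} with hA3
  set A4 : CC → ℕ → Set Ω := fun y n =>
    {ω | Bil kbar lam ((-1 : ℝ) • diracSM (τ y)) + r / 2 <
      pairSM ((-1 : ℝ) • diracSM (τ y)) (X n ω)} with hA4
  set G : ℕ → Set Ω := fun n =>
    X n ⁻¹' Metric.ball x r ∩ {ω | pairSM lam (X n ω) ≤ q + η} with hG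
  have hle : ∀ n, MeasurableSet {ω | pairSM lam (X n ω) ≤ q + η} := fun n =>
    measurableSet_le ((hX n).meas lam) measurable_const
  have hGm : ∀ n, MeasurableSet (G n) := fun n =>
    ((hX n).1 Metric.isOpen_ball.measurableSet).inter (hle n)
  have hA2m : ∀ n, MeasurableSet (A2 n) := fun n =>
    ((hX n).1 hK.isClosed.isOpen_compl.measurableSet).inter (hle n)
  have t1 : Tendsto (fun n => TiltM P X γ lam n (A1 n)) atTop (nhds 0) := by
    have := TiltM_conc hX hγ hmean hvar lam lam hη
    rwa [hBs] at this
  have t2 : Tendsto (fun n => TiltM P X γ lam n (A2 n)) atTop (nhds 0) := by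
    have hlim : Tendsto (fun n => (q + η - Lg P X γ lam n) + (-(q / 2 + η + 1))) atTop
        (nhds ((q + η - q / 2) + (-(q / 2 + η + 1)))) := by
      have := Lg_tendsto hmean hvar lam
      rw [hLam] at this
      exact (this.const_sub _).add_const _
    refine tendsto_of_tendsto_of_tendsto_of_le_of_le' tendsto_const_nhds
      (exp_neg_tendsto hγ (by linarith) hlim) (Eventually.of_forall fun _ => zero_le) ?_
    filter_upwards [hγ.eventually_gt_atTop 0, hKb] with n hg hn
    refine (TiltM_le lam n hg (A2 n) (hA2m n) (q + η) fun ω hω => hω.2).trans ?_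
    rw [mul_add, Real.exp_add, ENNReal.ofReal_mul (Real.exp_pos _).le]
    gcongr
    exact (measure_mono Set.inter_subset_left).trans hn
  have t3 : ∀ y ∈ T, Tendsto (fun n => TiltM P X γ lam n (A3 y n) + TiltM P X γ lam n (A4 y n))
      atTop (nhds 0) := by
    intro y _
    have a := TiltM_conc hX hγ hmean hvar lam (diracSM (τ y)) (half_pos hr)
    have b := TiltM_conc hX hγ hmean hvar lam ((-1 : ℝ) • diracSM (τ y)) (half_pos hr)
    simpa using a.add b
  have tS : Tendsto (fun n => TiltM P X γ lam n (A1 n) + TiltM P X γ lam n (A2 n) +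
      ∑ y ∈ T, (TiltM P X γ lam n (A3 y n) + TiltM P X γ lam n (A4 y n))) atTop (nhds 0) := by
    simpa using (t1.add t2).add (tendsto_finsetSum T t3)
  have hcover : ∀ n, (Set.univ : Set Ω) ⊆ G n ∪ (A1 n ∪ A2 n ∪ ⋃ y ∈ T, (A3 y n ∪ A4 y n)) := by
    intro n ω _
    by_cases h1 : pairSM lam (X n ω) ≤ q + η
    · by_cases h2 : X n ω ∈ K
      · by_cases h3 : X n ω ∈ Metric.ball x r
        · exact Or.inl ⟨h3, h1⟩
        · right; right
          obtain ⟨y, hy, hz⟩ := Set.mem_iUnion₂.1 (hcov ⟨h2, h3⟩)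
          refine Set.mem_iUnion₂.2 ⟨y, hy, ?_⟩
          simp only [Set.mem_ofPred_eq] at hz
          rcases lt_abs.1 hz with h | h
          · left
            simp only [hA3, Set.mem_ofPred_eq, pairSM_dirac]
            linarith
          · right
            simp only [hA4, Set.mem_ofPred_eq, pairSM_smul, pairSM_dirac, Bil_neg hX hvar]
            change -b y + r / 2 < _
            linarith
      · exact Or.inr (Or.inl (Or.inr ⟨h2, h1⟩))
    · exact Or.inr (Or.inl (Or.inl (not_le.1 h1)))
  have hhalf : ∀ᶠ n in atTop, Real.exp (γ n * (-η)) ≤ 1 / 2 := by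
    have h1 : Tendsto (fun n => γ n * (-η)) atTop atBot :=
      hγ.atTop_mul_const_of_neg (by linarith)
    exact (Real.tendsto_exp_atBot.comp h1).eventually_le_const (by norm_num)
  have hLow : ∀ᶠ n in atTop, LamK kbar lam - η < Lg P X γ lam n :=
    (Lg_tendsto hmean hvar lam).eventually_const_lt (by linarith)
  filter_upwards [tS.eventually_le_const (show (0 : ℝ≥0∞) < 1 / 2 by norm_num), hhalf, hLow,
    hγ.eventually_gt_atTop 0] with n hS hh hL hg
  set L := Lg P X γ lam n with hLdef
  have h1 : (1 : ℝ≥0∞) ≤ TiltM P X γ lam n (G n) + 1 / 2 := by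
    rw [← TiltM_univ (γ := γ) hX lam n]
    refine (measure_mono (hcover n)).trans ((measure_union_le _ _).trans ?_)
    rw [TiltM_univ (γ := γ) hX lam n]
    gcongr
    refine le_trans ((measure_union_le _ _).trans ?_) hS
    gcongr
    · exact measure_union_le _ _
    · exact (measure_biUnion_finset_le _ _).trans
        (Finset.sum_le_sum fun y _ => measure_union_le _ _)
  have h2 : (1 / 2 : ℝ≥0∞) ≤ TiltM P X γ lam n (G n) := by
    have : (1 : ℝ≥0∞) - 1 / 2 ≤ TiltM P X γ lam n (G n) := tsub_le_iff_right.2 h1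
    simpa [ENNReal.one_sub_inv_two] using this
  have h3 := TiltM_le (P := P) lam n hg (G n) (hGm n) (q + η) fun ω hω => hω.2
  have h4 : ENNReal.ofReal (Real.exp (γ n * (-η))) ≤ 1 / 2 := by
    refine (ENNReal.ofReal_le_ofReal hh).trans_eq ?_
    rw [ENNReal.ofReal_div_of_pos two_pos]; simp
  have h5 : ENNReal.ofReal (Real.exp (γ n * (-η))) ≤
      ENNReal.ofReal (Real.exp (γ n * (q + η - L))) * P (X n ⁻¹' Metric.ball x r) :=
    h4.trans (h2.trans (h3.trans (by gcongr; exact Set.inter_subset_left)))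
  calc ENNReal.ofReal (Real.exp (γ n * (-(LamK kbar lam + 3 * η))))
      ≤ ENNReal.ofReal (Real.exp (-(γ n * (q + η - L))) * Real.exp (γ n * (-η))) := by
        rw [← Real.exp_add]
        refine ENNReal.ofReal_le_ofReal (Real.exp_le_exp.2 ?_)
        have : γ n * (-(LamK kbar lam + 3 * η)) ≤ γ n * (-(q + η - L) - η) := by
          refine mul_le_mul_of_nonneg_left ?_ hg.le
          linarith
        linarith
    _ = ENNReal.ofReal (Real.exp (-(γ n * (q + η - L)))) *
        ENNReal.ofReal (Real.exp (γ n * (-η))) := ENNReal.ofReal_mul (Real.exp_pos _).le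
    _ ≤ ENNReal.ofReal (Real.exp (-(γ n * (q + η - L)))) *
        (ENNReal.ofReal (Real.exp (γ n * (q + η - L))) * P (X n ⁻¹' Metric.ball x r)) := by
        gcongr
    _ = P (X n ⁻¹' Metric.ball x r) := by
        rw [← mul_assoc, ← ENNReal.ofReal_mul (Real.exp_pos _).le, ← Real.exp_add]
        simp

theorem lower (hX : ∀ n, IsContGaussian P (X n)) (hγ : Tendsto γ atTop atTop)
    (htight : ExpTight P X γ) (hk : IsPSDKernel kbar)
    (hmean : ∀ lam : SignedMeasure UI,
      Tendsto (fun n => ∫ ω, pairSM lam (X n ω) ∂P) atTop (nhds 0))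
    (hvar : ∀ lam : SignedMeasure UI,
      Tendsto (fun n => γ n * variance (fun ω => pairSM lam (X n ω)) P) atTop
        (nhds (dblInt lam kbar))) :
    LDPLower (fun n => P.map (X n)) γ (fun h : CC => CramerK kbar (⇑h)) := by
  intro Θ hΘ
  rw [EReal.neg_le]
  refine le_iInf₂ fun x hx => ?_
  rw [EReal.neg_le]
  beta_reduce
  by_cases htop : CramerK kbar x = ⊤
  · rw [htop]; simp
  set c := (CramerK kbar x).toReal with hc
  have hc0 : 0 ≤ c := ENNReal.toReal_nonneg
  have hcE : (CramerK kbar x : EReal) = ((c : ℝ) : EReal) := by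
    rw [← ENNReal.ofReal_toReal htop, ← hc, EReal.coe_ennreal_ofReal, max_eq_left hc0]
  rw [hcE, ← EReal.ge_of_forall_gt_iff_ge]
  intro z hz
  have hz' : z < -c := by exact_mod_cast hz
  set δ := (-c - z) / 4 with hδ
  have hδ0 : 0 < δ := by rw [hδ]; linarith
  obtain ⟨r, hr, hball⟩ := Metric.isOpen_iff.1 hΘ x hx
  obtain ⟨M, hM⟩ : ∃ M : ℝ, ∀ t : UI, kbar t t ≤ M := by
    have hcont : Continuous fun t : UI => kbar t t := hk.1.comp (continuous_id.prodMk continuous_id)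
    obtain ⟨M, hM⟩ := (isCompact_range hcont).bddAbove
    exact ⟨M, fun t => hM ⟨t, rfl⟩⟩
  have hM0 : 0 < |M| + 1 := by positivity
  obtain ⟨ε, hε, e1, e2, e3⟩ : ∃ ε : ℝ, 0 < ε ∧ ε * (8 * (c + 1)) ≤ δ ^ 2 ∧ ε * 8 ≤ δ ∧
      ε * (2 * (|M| + 1)) ≤ (r / 3) ^ 2 := by
    refine ⟨min (δ ^ 2 / (8 * (c + 1))) (min (δ / 8) ((r / 3) ^ 2 / (2 * (|M| + 1)))), ?_, ?_, ?_, ?_⟩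
    · positivity
    · exact (le_div_iff₀ (by positivity)).1 (min_le_left _ _)
    · exact (le_div_iff₀ (by positivity)).1 ((min_le_right _ _).trans (min_le_left _ _))
    · exact (le_div_iff₀ (by positivity)).1 ((min_le_right _ _).trans (min_le_right _ _))
  obtain ⟨lam, hlam⟩ := exists_near x htop hε
  have hb := cramer_bound (kbar := kbar) x htop
  have hsq := approx_sq hX hvar x hb hlam
  have hclose : ∀ t : UI, |x t - Bil kbar lam (diracSM t)| ≤ r / 3 := by
    intro t
    have h := hsq (diracSM t)
    rw [pairSM_dirac, quad_dirac] at h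
    refine abs_le_of_sq_le_sq (h.trans ?_) (by positivity)
    have := hM t
    have h2 := le_abs_self M
    nlinarith
  have hLam : LamK kbar lam ≤ c + δ := by
    have h1 := hsq lam
    have h2 := hb lam
    rw [Bil_self] at h1
    unfold LamK at h2 ⊢
    set q := dblInt lam kbar
    set D := pairSM lam x - q with hD
    by_contra! hcon
    have hu : δ < -D := by rw [hD]; linarith
    have h3 : q ≤ 2 * (c + -D) := by rw [hD]; linarith
    have h4 : D ^ 2 ≤ 4 * ε * (c + -D) := by nlinarith
    have h5 : δ ^ 2 < D ^ 2 := by nlinarith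
    have h6 : ε * 8 * (-D) ≤ δ * (-D) := mul_le_mul_of_nonneg_right e2 (by linarith)
    have h7 : δ * (-D) ≤ D ^ 2 := by nlinarith
    nlinarith
  refine le_liminf_of_le (by isBoundedDefault) ?_
  filter_upwards [lower_ball hX hγ htight hmean hvar x lam hr hδ0 hclose,
    hγ.eventually_gt_atTop 0] with n hn hg
  refine le_elog hg ?_
  rw [Measure.map_apply (hX n).1 hΘ.measurableSet]
  refine le_trans ?_ (hn.trans (measure_mono (Set.preimage_mono hball)))
  gcongr
  rw [hδ] at hLam ⊢
  linarith

theorem cramer_lsc (k : UI → UI → ℝ) : LowerSemicontinuous (fun h : CC => CramerK k (⇑h)) := by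
  unfold CramerK
  refine lowerSemicontinuous_iSup fun lam => Continuous.lowerSemicontinuous ?_
  exact ENNReal.continuous_ofReal.comp ((pairSM_continuous lam).sub continuous_const)

theorem good (hX : ∀ n, IsContGaussian P (X n))
    (htight : ExpTight P X γ)
    (hlow : LDPLower (fun n => P.map (X n)) γ (fun h : CC => CramerK kbar (⇑h))) :
    GoodRate (fun h : CC => CramerK kbar (⇑h)) := by
  refine ⟨cramer_lsc kbar, fun a => ?_⟩
  obtain ⟨K, hK, hl⟩ := htight (a + 1) (by positivity)
  refine hK.of_isClosed_subset ((cramer_lsc kbar).isClosed_preimage _) fun x hx => ?_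
  by_contra hxK
  have h1 := hlow Kᶜ hK.isClosed.isOpen_compl
  have h2 : ∀ n, (P.map (X n)) Kᶜ = P (X n ⁻¹' Kᶜ) := fun n =>
    Measure.map_apply (hX n).1 hK.isClosed.isOpen_compl.measurableSet
  simp only [h2] at h1
  have h3 := (h1.trans (liminf_le_limsup)).trans hl
  rw [EReal.neg_le] at h3
  have h4 := h3.trans (iInf₂_le x hxK)
  have h5 : (CramerK kbar x : EReal) ≤ (((a : ℝ≥0∞)) : EReal) :=
    EReal.coe_ennreal_le_coe_ennreal_iff.2 hx
  have h6 := h4.trans h5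
  have h7 : (((a : ℝ≥0∞)) : EReal) = ((a : ℝ) : EReal) := rfl
  rw [h7, ← EReal.coe_neg, EReal.coe_le_coe_iff] at h6
  linarith

end Main

/-- LDP for exponentially tight families of continuous Gaussian
processes with converging means and covariances. -/
theorem statement2 {Ω : Type*} [MeasurableSpace Ω] (P : Measure Ω) [IsProbabilityMeasure P]
    (X : ℕ → Ω → CC) (hX : ∀ n, IsContGaussian P (X n))
    (γ : ℕ → ℝ) (hγ : Tendsto γ atTop atTop) (htight : ExpTight P X γ)
    (kbar : UI → UI → ℝ) (hk : IsPSDKernel kbar) (hcov : IsCovOfCenteredCGP kbar)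
    (hmean : ∀ lam : MeasureTheory.SignedMeasure UI,
      Tendsto (fun n => ∫ ω, pairSM lam (X n ω) ∂P) atTop (nhds 0))
    (hvar : ∀ lam : MeasureTheory.SignedMeasure UI,
      Tendsto (fun n => γ n * variance (fun ω => pairSM lam (X n ω)) P) atTop
        (nhds (dblInt lam kbar))) :
    LDPrv P X γ (fun h : CC => CramerK kbar (⇑h)) ∧
      GoodRate (fun h : CC => CramerK kbar (⇑h)) := by
  have hlow := lower hX hγ htight hk hmean hvar
  exact ⟨⟨cramer_lsc kbar, hlow, upper hX hγ htight hmean hvar⟩, good hX htight hlow⟩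

end
end
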